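/- arXiv:1611.10056 — 3 statements merged into one kernel-verified Lean document; each statement's English description precedes it below -/
import Mathlib

section
/- For every integer L ≥ 1 there exists ℓ₀ > 1 such that for all real ℓ₋, ℓ₊ ≥ ℓ₀, every integer q ≥ 1 and every c ∈ ℝ the following holds: if f_c^q(0) = 0, f_c^j(0) ≠ 0 for all 1 ≤ j < q, and #{1 ≤ j < q : f_c^j(0) < 0} ≤ L, then ∑_{n=0}^{q−1} 1/Df_c^n(c) > 0. -/
/-- The unimodal map `f_{c,ℓ₋,ℓ₊}(x) = |x|^{ℓ₋} + c` for `x ≤ 0` and `|x|^{ℓ₊} + c` for `x ≥ 0`. -/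
noncomputable def fml (lm lp c : ℝ) (x : ℝ) : ℝ :=
  if x ≤ 0 then |x| ^ lm + c else |x| ^ lp + c

/-- `Df_c^n(c) = ∏_{k=0}^{n−1} f_c'(f_c^k(c))`, the derivative of the `n`-th iterate at `c`. -/
noncomputable def fmlDfn (lm lp c : ℝ) (n : ℕ) : ℝ :=
  ∏ k ∈ Finset.range n, deriv (fml lm lp c) ((fml lm lp c)^[k] c)


/-- slope of the vector `v` between the points `c i` and `c j` -/
noncomputable def slp (c v : ℕ → ℝ) (i j : ℕ) : ℝ := (v i - v j) / (c i - c j)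

lemma slp_comm (c v : ℕ → ℝ) (i j : ℕ) : slp c v i j = slp c v j i := by
  unfold slp
  rw [← neg_sub (v j) (v i), ← neg_sub (c j) (c i), neg_div_neg_eq]

/-- `alpha` estimates -/
lemma alpha_bounds (x z l : ℝ) (hz : 0 < z) (hzx : z < x) (hl : 1 ≤ l) :
    0 < x ^ l ∧ 0 < z ^ l ∧ z ^ l < x ^ l ∧
    1 / l ≤ x * (x ^ l - z ^ l) / (x ^ l * (l * (x - z))) ∧
    x * (x ^ l - z ^ l) / (x ^ l * (l * (x - z))) ≤ 1 := by
  have hx : 0 < x := hz.trans hzx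
  have ha : 0 < x ^ l := Real.rpow_pos_of_pos hx l
  have hb : 0 < z ^ l := Real.rpow_pos_of_pos hz l
  have hab : z ^ l < x ^ l := Real.rpow_lt_rpow hz.le hzx (by linarith)
  have hl0 : 0 < l := by linarith
  have hxz : 0 < x - z := by linarith
  refine ⟨ha, hb, hab, ?_, ?_⟩
  · have h1 : (z / x) ^ l ≤ z / x := by
      have := Real.rpow_le_rpow_of_exponent_ge (x := z / x) (div_pos hz hx)
        ((div_le_one hx).2 hzx.le) hl
      simpa using this
    rw [Real.div_rpow hz.le hx.le, div_le_div_iff₀ ha hx] at h1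
    rw [div_le_div_iff₀ hl0 (by positivity)]
    nlinarith [mul_le_mul_of_nonneg_left h1 hl0.le]
  · have h1 : 1 + l * (z / x - 1) ≤ (1 + (z / x - 1)) ^ l := by
      apply one_add_mul_self_le_rpow_one_add _ hl
      have : 0 < z / x := div_pos hz hx
      linarith
    have h2 : (1 + (z / x - 1)) = z / x := by ring
    rw [h2, Real.div_rpow hz.le hx.le] at h1
    rw [div_le_one (by positivity)]
    have h3 : (1 + l * (z / x - 1)) * (x * x ^ l) ≤ z ^ l / x ^ l * (x * x ^ l) :=
      mul_le_mul_of_nonneg_right h1 (by positivity)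
    have e1 : (1 + l * (z / x - 1)) * (x * x ^ l) = x * x ^ l + l * (z - x) * x ^ l := by
      field_simp
    have e2 : z ^ l / x ^ l * (x * x ^ l) = z ^ l * x := by field_simp
    rw [e1, e2] at h3
    nlinarith

lemma alpha_identity (x z a b l A C : ℝ) (ha : a ≠ 0) (hb : b ≠ 0) (hl : l ≠ 0)
    (hxz : x - z ≠ 0) (hab : a - b ≠ 0) :
    (x * (A / a) - z * (C / b)) / (l * (x - z)) =
      x * (a - b) / (a * (l * (x - z))) * ((A - C) / (a - b) - C / b) + C / b / l := by
  field_simp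
  ring

lemma stepA (x z l A C : ℝ) (hz : 0 < z) (hzx : z < x) (hl : 1 ≤ l) :
    |(x * (A / x ^ l) - z * (C / z ^ l)) / (l * (x - z))| ≤
      |(A - C) / (x ^ l - z ^ l)| + |C / z ^ l| := by
  obtain ⟨ha, hb, hab, h1, h2⟩ := alpha_bounds x z l hz hzx hl
  rw [alpha_identity x z (x ^ l) (z ^ l) l A C ha.ne' hb.ne' (by linarith)
    (by linarith) (by linarith)]
  set α := x * (x ^ l - z ^ l) / (x ^ l * (l * (x - z))) with hα
  set S := (A - C) / (x ^ l - z ^ l)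
  set s := C / z ^ l
  have hl0 : 0 < 1 / l := by positivity
  have : α * (S - s) + s / l = α * S + (-(α - 1 / l)) * s := by ring
  rw [this]
  refine (abs_add_le _ _).trans ?_
  rw [abs_mul, abs_mul, abs_neg, abs_of_nonneg (by linarith : 0 ≤ α),
    abs_of_nonneg (by linarith : 0 ≤ α - 1 / l)]
  have : (α - 1 / l) ≤ 1 := by linarith
  nlinarith [abs_nonneg S, abs_nonneg s]

lemma stepB (η : ℝ) (hη : 0 < η) : ∃ ε : ℝ, 0 < ε ∧ ∃ ℓ₁ : ℝ, 1 ≤ ℓ₁ ∧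
    ∀ x z l A C : ℝ, 0 < z → z < x → ℓ₁ ≤ l →
      |(A - C) / (x ^ l - z ^ l)| ≤ ε → |A / x ^ l| ≤ ε → |C / z ^ l| ≤ 1 →
      |(x * (A / x ^ l) - z * (C / z ^ l)) / (l * (x - z))| ≤ η := by
  set Q : ℝ := 4 / η with hQ
  have hQ0 : 0 < Q := by positivity
  set t0 : ℝ := Real.exp (-(2 * Q)) with ht0
  have ht0p : 0 < t0 := Real.exp_pos _
  have ht01 : t0 ≤ 1 := Real.exp_le_one_iff.2 (by linarith)
  refine ⟨t0 * η / 8, by positivity, max (max 1 (2 * Q)) (4 / η), le_trans (le_max_left _ _) (le_max_left _ _), ?_⟩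
  intro x z l A C hz hzx hl h1 h2 h3
  have hl1 : 1 ≤ l := le_trans (le_trans (le_max_left _ _) (le_max_left _ _)) hl
  have hl2 : 2 * Q ≤ l := le_trans (le_trans (le_max_right _ _) (le_max_left _ _)) hl
  have hl3 : 4 / η ≤ l := le_trans (le_max_right _ _) hl
  have hl0 : 0 < l := by linarith
  have hx : 0 < x := hz.trans hzx
  obtain ⟨ha, hb, hab, ha1, ha2⟩ := alpha_bounds x z l hz hzx hl1
  have hil : 1 / l ≤ η / 4 := by
    rw [div_le_div_iff₀ hl0 (by norm_num)]
    rw [div_le_iff₀ hη] at hl3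
    linarith
  have hε : t0 * η / 8 ≤ η / 8 := by nlinarith
  rw [alpha_identity x z (x ^ l) (z ^ l) l A C ha.ne' hb.ne' (by linarith)
    (by linarith) (by linarith)]
  set α := x * (x ^ l - z ^ l) / (x ^ l * (l * (x - z))) with hα
  have hα0 : 0 ≤ α := le_trans (by positivity) ha1
  have hS : (A - C) / (x ^ l - z ^ l) * (x ^ l - z ^ l) = A - C := by
    apply div_mul_cancel₀; linarith
  set S := (A - C) / (x ^ l - z ^ l)
  have hsa : A / x ^ l * x ^ l = A := div_mul_cancel₀ _ ha.ne'
  have hsb : C / z ^ l * z ^ l = C := div_mul_cancel₀ _ hb.ne'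
  set s := C / z ^ l
  set s' := A / x ^ l
  have hsl : |s / l| ≤ η / 4 := by
    rw [abs_div, abs_of_pos hl0, div_eq_mul_one_div]
    nlinarith [abs_nonneg s]
  have key : α * |s| ≤ η / 4 := by
    by_cases hc : l * (x - z) ≤ Q * x
    · have hτ : t0 ≤ (z / x) ^ l := by
        have h4 : 1 - Q / l ≤ z / x := by
          rw [le_div_iff₀ hx, sub_mul, one_mul, div_mul_eq_mul_div, sub_le_comm, le_div_iff₀ hl0]
          linarith
        have hQl : Q / l ≤ 1 / 2 := by
          rw [div_le_div_iff₀ hl0 (by norm_num)]; linarith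
        have h5 : Real.exp (-(2 * (Q / l))) ≤ 1 - Q / l := by
          set u := Q / l
          have hu : 0 < u := by positivity
          rw [Real.exp_neg]
          have := Real.add_one_le_exp (2 * u)
          rw [inv_le_comm₀ (Real.exp_pos _) (by linarith)]
          refine le_trans ?_ this
          rw [inv_le_iff_one_le_mul₀ (by linarith)]
          nlinarith
        calc t0 = (Real.exp (-(2 * (Q / l)))) ^ l := by
              rw [← Real.exp_mul, ht0]; congr 1; field_simp
          _ ≤ (z / x) ^ l := Real.rpow_le_rpow (Real.exp_pos _).le (h5.trans h4) hl0.le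
      rw [Real.div_rpow hz.le hx.le, le_div_iff₀ ha] at hτ
      have e : s * z ^ l = s' * x ^ l - S * (x ^ l - z ^ l) := by linarith
      have e2 : |s| * z ^ l ≤ (2 * (t0 * η / 8)) * x ^ l := by
        rw [← abs_of_pos hb, ← abs_mul, e]
        refine (abs_sub _ _).trans ?_
        rw [abs_mul, abs_mul, abs_of_pos ha, abs_of_pos (by linarith : 0 < x ^ l - z ^ l)]
        have g1 := mul_le_mul_of_nonneg_right h2 ha.le
        have g2 : |S| * (x ^ l - z ^ l) ≤ (t0 * η / 8) * x ^ l :=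
          mul_le_mul h1 (by linarith) (by linarith) (by positivity)
        linarith
      have e3 : |s| * (t0 * x ^ l) ≤ |s| * z ^ l := mul_le_mul_of_nonneg_left hτ (abs_nonneg _)
      have e4 : |s| ≤ η / 4 := by
        have : |s| * (t0 * x ^ l) ≤ η / 4 * (t0 * x ^ l) := by linarith
        exact le_of_mul_le_mul_right this (by positivity)
      have e5 := mul_le_mul ha2 e4 (abs_nonneg s) zero_le_one
      linarith
    · push Not at hc
      have : α ≤ η / 4 := by
        rw [hα, div_le_iff₀ (mul_pos ha (mul_pos hl0 (by linarith)))]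
        have h6 : x ≤ η / 4 * (l * (x - z)) := by
          have : η / 4 * (Q * x) = x := by rw [hQ]; field_simp
          have h6' := mul_le_mul_of_nonneg_left hc.le (by positivity : 0 ≤ η / 4)
          linarith
        have h7 : x * (x ^ l - z ^ l) ≤ x * x ^ l :=
          mul_le_mul_of_nonneg_left (by linarith) hx.le
        have h8 := mul_le_mul_of_nonneg_right h6 ha.le
        linarith
      have h9 := mul_le_mul this h3 (abs_nonneg s) (by positivity)
      linarith
  calc |α * (S - s) + s / l| ≤ |α * (S - s)| + |s / l| := abs_add_le _ _
    _ ≤ α * (|S| + |s|) + η / 4 := by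
        rw [abs_mul, abs_of_nonneg hα0]
        gcongr
        exact abs_sub _ _
    _ ≤ η := by
        have g1 := mul_le_mul ha2 h1 (abs_nonneg S) zero_le_one
        rw [mul_add]
        linarith

/-- the (normalised) eigenvector system along the orbit `c 1, …, c q = 0` -/
structure OrbSys (L : ℕ) (ℓ : ℝ) (q : ℕ) (c v l : ℕ → ℝ) (ρ : ℝ) : Prop where
  hℓ : 2 ≤ ℓ
  hq : 2 ≤ q
  c1 : c 1 < 0
  cne : ∀ k, 1 ≤ k → k < q → c k ≠ 0
  cq : c q = 0
  lge : ∀ k, ℓ ≤ l k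
  lsame : ∀ i j, 0 < c i * c j → l i = l j
  crec : ∀ k, 1 ≤ k → k < q → c (k + 1) - c 1 = |c k| ^ (l k)
  vq : v q = 0
  vrec : ∀ k, 1 ≤ k → k < q → slp c v k q = ρ / l k * slp c v (k + 1) 1
  ρ0 : 0 < ρ
  ρ1 : ρ ≤ 1
  hN : ((Finset.Icc 1 q).filter (fun k => c k < 0)).card ≤ L
  hs : ∀ k, 2 ≤ k → k ≤ q → |slp c v k 1| ≤ 1

namespace OrbSys

variable {L : ℕ} {ℓ : ℝ} {q : ℕ} {c v l : ℕ → ℝ} {ρ : ℝ}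

lemma lt_c (h : OrbSys L ℓ q c v l ρ) (k : ℕ) (h2 : 2 ≤ k) (hk : k ≤ q) : c 1 < c k := by
  have := h.crec (k - 1) (by omega) (by omega)
  rw [Nat.sub_add_cancel (by omega)] at this
  have h3 : 0 < |c (k - 1)| ^ (l (k - 1)) :=
    Real.rpow_pos_of_pos (abs_pos.2 (h.cne _ (by omega) (by omega))) _
  linarith

lemma inj_aux (h : OrbSys L ℓ q c v l ρ) (n : ℕ) : ∀ i j, 1 ≤ i → i < j → j + n = q → c i ≠ c j := by
  induction n with
  | zero =>
    intro i j hi hij hj he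
    simp only [add_zero] at hj
    subst hj
    exact h.cne i hi hij (he.trans h.cq)
  | succ n ih =>
    intro i j hi hij hj he
    have hne := h.cne i hi (by omega)
    refine ih (i + 1) (j + 1) (by omega) (by omega) (by omega) ?_
    have h1 := h.crec i hi (by omega)
    have h2 := h.crec j (by omega) (by omega)
    have h3 := h.lsame i j (by rw [← he]; exact mul_self_pos.2 hne)
    rw [he, h3] at h1
    linarith

lemma inj (h : OrbSys L ℓ q c v l ρ) (i j : ℕ) (hi : 1 ≤ i) (hiq : i ≤ q) (hj : 1 ≤ j) (hjq : j ≤ q)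
    (hij : i ≠ j) : c i ≠ c j := by
  rcases lt_or_gt_of_ne hij with hlt | hlt
  · exact h.inj_aux (q - j) i j hi hlt (by omega)
  · exact (h.inj_aux (q - i) j i hj hlt (by omega)).symm

lemma w_le (h : OrbSys L ℓ q c v l ρ) (k : ℕ) (h1 : 1 ≤ k) (hk : k < q) :
    |slp c v k q| ≤ |slp c v (k + 1) 1| / ℓ := by
  have hl := h.lge k
  have hℓ := h.hℓ
  have h0 := h.ρ0
  rw [h.vrec k h1 hk, abs_mul, abs_of_pos (div_pos h0 (by linarith)), mul_comm,
    div_eq_mul_one_div (|slp c v (k + 1) 1|)]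
  refine mul_le_mul_of_nonneg_left ?_ (abs_nonneg _)
  exact div_le_div₀ zero_le_one h.ρ1 (by linarith) hl

lemma w_le' (h : OrbSys L ℓ q c v l ρ) (k : ℕ) (h1 : 1 ≤ k) (hk : k < q) :
    |slp c v k q| ≤ 1 / ℓ := by
  refine (h.w_le k h1 hk).trans ?_
  have hℓ := h.hℓ
  exact div_le_div_of_nonneg_right (h.hs (k + 1) (by omega) (by omega)) (by linarith)

lemma opp_max (h : OrbSys L ℓ q c v l ρ) (a b : ℕ) (ha : c a < 0) (hb : 0 < c b) :
    |slp c v a b| ≤ max |slp c v a q| |slp c v b q| := by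
  set m := max |slp c v a q| |slp c v b q| with hm
  have h1 : |slp c v a q| ≤ m := le_max_left _ _
  have h2 : |slp c v b q| ≤ m := le_max_right _ _
  have e1 : v a = slp c v a q * c a := by
    unfold slp; rw [h.cq, h.vq]; simp [ha.ne]
  have e2 : v b = slp c v b q * c b := by
    unfold slp; rw [h.cq, h.vq]; simp [hb.ne']
  have e3 : slp c v a b = (v b - v a) / (c b - c a) := slp_comm c v a b
  rw [e3, abs_div, abs_of_pos (by linarith : 0 < c b - c a), div_le_iff₀ (by linarith)]
  rw [abs_le] at *
  generalize slp c v a q = x at *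
  generalize slp c v b q = y at *
  rw [e1, e2]
  constructor <;> nlinarith

lemma opp (h : OrbSys L ℓ q c v l ρ) (a b : ℕ) (ha : 1 ≤ a) (haq : a ≤ q) (hb : 1 ≤ b) (hbq : b ≤ q)
    (hab : a ≠ b) (hc : c a * c b ≤ 0) : |slp c v a b| ≤ 1 / ℓ := by
  rcases eq_or_lt_of_le hbq with rfl | hbq
  · exact h.w_le' a ha (by omega)
  rcases eq_or_lt_of_le haq with rfl | haq
  · rw [slp_comm]; exact h.w_le' b hb (by omega)
  have h1 := h.cne a ha haq
  have h2 := h.cne b hb hbq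
  rcases lt_or_gt_of_ne h1 with h1 | h1
  · have h2 : 0 < c b := by
      rcases lt_or_gt_of_ne h2 with h2 | h2
      · nlinarith [mul_pos_of_neg_of_neg h1 h2]
      · exact h2
    exact (h.opp_max a b h1 h2).trans (max_le (h.w_le' a ha haq) (h.w_le' b hb hbq))
  · have h2 : c b < 0 := by
      rcases lt_or_gt_of_ne h2 with h2 | h2
      · exact h2
      · nlinarith [mul_pos h1 h2]
    rw [slp_comm]
    exact (h.opp_max b a h2 h1).trans (max_le (h.w_le' b hb hbq) (h.w_le' a ha haq))

/-- form of a pair on the same side -/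
lemma pair_form (h : OrbSys L ℓ q c v l ρ) (i j : ℕ) (hi : 1 ≤ i) (hiq : i < q) (hj : 1 ≤ j) (hjq : j < q)
    (hc : 0 < c i * c j) (hlt : |c j| < |c i|) :
    |slp c v i j| ≤ |(|c i| * ((v (i+1) - v 1) / |c i| ^ (l i))
      - |c j| * ((v (j+1) - v 1) / |c j| ^ (l i))) / (l i * (|c i| - |c j|))| := by
  have hl := h.lge i
  have hℓ := h.hℓ
  have hll := h.lsame i j hc
  have hi0 := h.cne i hi hiq
  have hj0 := h.cne j hj hjq
  have e1 : v i = slp c v i q * c i := by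
    unfold slp; rw [h.cq, h.vq]; simp [hi0]
  have e2 : v j = slp c v j q * c j := by
    unfold slp; rw [h.cq, h.vq]; simp [hj0]
  have f1 : slp c v (i + 1) 1 = (v (i+1) - v 1) / |c i| ^ (l i) := by
    rw [← h.crec i hi hiq]; rfl
  have f2 : slp c v (j + 1) 1 = (v (j+1) - v 1) / |c j| ^ (l i) := by
    rw [hll, ← h.crec j hj hjq]; rfl
  have g1 := h.vrec i hi hiq
  have g2 := h.vrec j hj hjq
  rw [f1] at g1
  rw [f2, ← hll] at g2
  rw [g1] at e1
  rw [g2] at e2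
  generalize (v (i+1) - v 1) / |c i| ^ (l i) = X at *
  generalize (v (j+1) - v 1) / |c j| ^ (l i) = Y at *
  have key : |slp c v i j| = ρ * |(|c i| * X - |c j| * Y) / (l i * (|c i| - |c j|))| := by
    have hpos : 0 < l i * (|c i| - |c j|) := mul_pos (by linarith) (by linarith)
    have : ρ * |(|c i| * X - |c j| * Y) / (l i * (|c i| - |c j|))|
      = |ρ * ((|c i| * X - |c j| * Y) / (l i * (|c i| - |c j|)))| := by
      rw [abs_mul, abs_of_pos h.ρ0]
    rw [this]
    congr 1
    unfold slp
    rw [e1, e2]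
    have hl0 : l i ≠ 0 := by linarith
    have hd : |c i| - |c j| ≠ 0 := by linarith
    rcases lt_or_gt_of_ne hi0 with hi0 | hi0
    · have hj0 : c j < 0 := by
        by_contra hh; push Not at hh; nlinarith
      rw [abs_of_neg hi0, abs_of_neg hj0] at hd ⊢
      have hd' : c i - c j ≠ 0 := fun hh => hd (by linarith)
      field_simp
      ring
    · have hj0 : 0 < c j := by
        by_contra hh; push Not at hh; nlinarith
      rw [abs_of_pos hi0, abs_of_pos hj0] at hd ⊢
      field_simp
  rw [key]
  have := h.ρ1
  have := abs_nonneg ((|c i| * X - |c j| * Y) / (l i * (|c i| - |c j|)))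
  nlinarith

lemma slp_next (h : OrbSys L ℓ q c v l ρ) (i j : ℕ) (hi : 1 ≤ i) (hiq : i < q) (hj : 1 ≤ j) (hjq : j < q)
    (hc : 0 < c i * c j) :
    slp c v (i+1) (j+1) = ((v (i+1) - v 1) - (v (j+1) - v 1)) / (|c i| ^ (l i) - |c j| ^ (l i)) ∧
    slp c v (i+1) 1 = (v (i+1) - v 1) / |c i| ^ (l i) ∧
    slp c v (j+1) 1 = (v (j+1) - v 1) / |c j| ^ (l i) := by
  have hll := h.lsame i j hc
  have h1 := h.crec i hi hiq
  have h2 := h.crec j hj hjq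
  rw [← hll] at h2
  refine ⟨?_, ?_, ?_⟩
  · rw [← h1, ← h2]; unfold slp; simp
  · rw [← h1]; rfl
  · rw [← h2]; rfl

lemma abs_ne (h : OrbSys L ℓ q c v l ρ) (i j : ℕ) (hi : 1 ≤ i) (hiq : i < q) (hj : 1 ≤ j) (hjq : j < q)
    (hij : i ≠ j) (hc : 0 < c i * c j) : |c i| ≠ |c j| := by
  intro he
  rcases abs_eq_abs.1 he with he | he
  · exact h.inj i j hi hiq.le hj hjq.le hij he
  · rw [he] at hc; nlinarith [mul_self_nonneg (c j)]

lemma near_step (h : OrbSys L ℓ q c v l ρ) (i j : ℕ) (hi : 1 ≤ i) (hiq : i < q) (hj : 1 ≤ j) (hjq : j < q)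
    (hc : 0 < c i * c j) (hlt : |c j| < |c i|) :
    |slp c v i j| ≤ |slp c v (i+1) (j+1)| + |slp c v (j+1) 1| := by
  obtain ⟨e1, e2, e3⟩ := h.slp_next i j hi hiq hj hjq hc
  rw [e1, e3]
  refine (h.pair_form i j hi hiq hj hjq hc hlt).trans ?_
  have := h.hℓ
  exact stepA _ _ _ _ _ (abs_pos.2 (h.cne j hj hjq)) hlt (by linarith [h.lge i])

lemma step_sum (h : OrbSys L ℓ q c v l ρ) (i j : ℕ) (hi : 1 ≤ i) (hiq : i < q) (hj : 1 ≤ j) (hjq : j < q)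
    (hij : i ≠ j) (hc : 0 < c i * c j) :
    |slp c v i j| ≤ |slp c v (i+1) (j+1)| + |slp c v (i+1) 1| + |slp c v (j+1) 1| := by
  rcases lt_or_gt_of_ne (h.abs_ne i j hi hiq hj hjq hij hc) with hlt | hlt
  · have := h.near_step j i hj hjq hi hiq (by rwa [mul_comm]) hlt
    rw [slp_comm c v j i, slp_comm c v (j+1) (i+1)] at this
    linarith [abs_nonneg (slp c v (j+1) 1)]
  · have := h.near_step i j hi hiq hj hjq hc hlt
    linarith [abs_nonneg (slp c v (i+1) 1)]

/-- bound for all pairs whose images are split by the set `B` -/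
lemma step_split (η : ℝ) (hη : 0 < η) : ∃ ε : ℝ, 0 < ε ∧ ∃ ℓ₁ : ℝ, 1 ≤ ℓ₁ ∧
    ∀ (L : ℕ) (ℓ : ℝ) (q : ℕ) (c v l : ℕ → ℝ) (ρ : ℝ), OrbSys L ℓ q c v l ρ → ℓ₁ ≤ ℓ →
      ∀ i j, 1 ≤ i → i < q → 1 ≤ j → j < q → i ≠ j → 0 < c i * c j →
        |slp c v (i+1) (j+1)| ≤ ε → |slp c v (i+1) 1| ≤ ε → |slp c v i j| ≤ η := by
  obtain ⟨ε, hε, ℓ₁, hℓ₁, H⟩ := stepB η hη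
  refine ⟨min ε (η / 2), by positivity, ℓ₁, hℓ₁, ?_⟩
  intro L ℓ q c v l ρ h hℓ i j hi hiq hj hjq hij hc h1 h2
  rcases lt_or_gt_of_ne (h.abs_ne i j hi hiq hj hjq hij hc) with hlt | hlt
  · have := h.near_step j i hj hjq hi hiq (by rwa [mul_comm]) hlt
    rw [slp_comm c v j i, slp_comm c v (j+1) (i+1)] at this
    have := min_le_right ε (η / 2)
    linarith
  · obtain ⟨e1, e2, e3⟩ := h.slp_next i j hi hiq hj hjq hc
    refine (h.pair_form i j hi hiq hj hjq hc hlt).trans ?_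
    apply H _ _ _ _ _ (abs_pos.2 (h.cne j hj hjq)) hlt (hℓ.trans (h.lge i))
    · rw [← e1]; exact h1.trans (min_le_left _ _)
    · rw [← e2]; exact h2.trans (min_le_left _ _)
    · rw [← e3]; exact h.hs (j+1) (by omega) (by omega)

lemma pos_le (h : OrbSys L ℓ q c v l ρ) (k : ℕ) (h2 : 2 ≤ k) (hk : k < q) (hc : 0 < c k) :
    |slp c v k 1| ≤ max |slp c v k q| |slp c v 1 q| := by
  rw [slp_comm, max_comm]
  exact h.opp_max 1 k h.c1 hc

lemma s2_le (h : OrbSys L ℓ q c v l ρ) (m : ℕ) (hm : ∀ r, r < m → 2 + r < q ∧ 0 < c (2 + r)) :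
    ∀ r, r ≤ m → |slp c v 2 1| ≤ (1 / ℓ) ^ r * |slp c v (2 + r) 1| := by
  have hℓ := h.hℓ
  have hℓ0 : 0 < 1 / ℓ := by positivity
  have hℓ1 : 1 / ℓ ≤ 1 / 2 := by
    rw [div_le_div_iff₀ (by linarith) (by norm_num)]; linarith
  intro r
  induction r with
  | zero => intro _; simp
  | succ r ih =>
    intro hr
    have ih := ih (by omega)
    obtain ⟨hrq, hrc⟩ := hm r (by omega)
    have h1 := h.pos_le (2 + r) (by omega) hrq hrc
    have h2 := h.w_le (2 + r) (by omega) hrq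
    have h3 := h.w_le 1 le_rfl (by omega)
    have hp : 0 < (1 / ℓ) ^ r := by positivity
    have hp1 : (1 / ℓ) ^ r ≤ 1 := pow_le_one₀ hℓ0.le (by linarith)
    rw [pow_succ, ← add_assoc, mul_assoc]
    rcases le_max_iff.1 h1 with h4 | h4
    · refine ih.trans (mul_le_mul_of_nonneg_left ?_ hp.le)
      refine (h4.trans h2).trans (le_of_eq ?_)
      ring
    · have h5 : |slp c v 2 1| ≤ 1 / 2 * |slp c v 2 1| := by
        calc |slp c v 2 1| ≤ (1 / ℓ) ^ r * |slp c v (2 + r) 1| := ih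
          _ ≤ 1 * |slp c v (2 + r) 1| := mul_le_mul_of_nonneg_right hp1 (abs_nonneg _)
          _ ≤ |slp c v 2 1| / ℓ := by rw [one_mul]; exact h4.trans h3
          _ = 1 / ℓ * |slp c v 2 1| := by ring
          _ ≤ 1 / 2 * |slp c v 2 1| := mul_le_mul_of_nonneg_right hℓ1 (abs_nonneg _)
      have h6 : |slp c v 2 1| ≤ 0 := by linarith
      refine h6.trans (by positivity)

lemma mono_next (h : OrbSys L ℓ q c v l ρ) (i j : ℕ) (hi : 1 ≤ i) (hiq : i < q) (hj : 1 ≤ j) (hjq : j < q)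
    (hc : 0 < c i * c j) (hle : |c i| ≤ |c j|) : c (i + 1) ≤ c (j + 1) := by
  have h1 := h.crec i hi hiq
  have h2 := h.crec j hj hjq
  rw [← h.lsame i j hc] at h2
  have := h.hℓ
  have := h.lge i
  have := Real.rpow_le_rpow (abs_nonneg _) hle (by linarith : 0 ≤ l i)
  linarith

lemma run_le (h : OrbSys L ℓ q c v l ρ) (p : ℕ) (hp : 1 ≤ p) (hpc : c p < 0) (n : ℕ) :
    p + 1 + n < q → (∀ r, r ≤ n → 0 < c (p + 1 + r)) → 2 + n < q ∧ c (p + 1 + n) ≤ c (2 + n) := by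
  induction n with
  | zero =>
    intro hq hr
    have h1 : 2 < q := by
      rcases Nat.lt_or_ge 2 q with h1 | h1
      · exact h1
      · omega
    refine ⟨h1, ?_⟩
    have hle : |c p| ≤ |c 1| := by
      rw [abs_of_neg hpc, abs_of_neg h.c1]
      rcases eq_or_lt_of_le hp with rfl | hp
      · exact le_rfl
      · linarith [h.lt_c p hp (by omega)]
    exact h.mono_next p 1 hp (by omega) le_rfl (by omega) (mul_pos_of_neg_of_neg hpc h.c1) hle
  | succ n ih =>
    intro hq hr
    obtain ⟨h1, h2⟩ := ih (by omega) (fun r hr' => hr r (by omega))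
    have h3 := hr n (by omega)
    have h4 : 2 + (n + 1) < q := by omega
    refine ⟨h4, ?_⟩
    refine h.mono_next (p + 1 + n) (2 + n) (by omega) (by omega) (by omega) h1 (by nlinarith) ?_
    rw [abs_of_pos h3, abs_of_pos (by linarith)]
    exact h2

lemma count (h : OrbSys L ℓ q c v l ρ) :
    (((Finset.Icc 2 q).filter (fun k => 0 < c k)).card : ℝ) * |slp c v 1 q| ≤ L / ℓ := by
  classical
  have hℓ := h.hℓ
  have hq := h.hq
  have hex : ∃ r, 2 + r ≤ q ∧ c (2 + r) ≤ 0 := ⟨q - 2, by omega, by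
    rw [Nat.add_sub_cancel' hq, h.cq]⟩
  set m := Nat.find hex with hmdef
  have hm1 := Nat.find_spec hex
  rw [← hmdef] at hm1
  have hm : ∀ r, r < m → 2 + r < q ∧ 0 < c (2 + r) := by
    intro r hr
    have := Nat.find_min hex hr
    push Not at this
    exact ⟨by omega, this (by omega)⟩
  have hs2 := h.s2_le m hm m le_rfl
  have hcard : ((Finset.Icc 2 q).filter (fun k => 0 < c k)).card ≤ L * m := by
    have hsub : (Finset.Icc 2 q).filter (fun k => 0 < c k) ⊆
        Finset.image (fun x : ℕ × ℕ => x.1 + x.2)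
          (((Finset.Icc 1 q).filter (fun k => c k < 0)) ×ˢ Finset.Icc 1 m) := by
      intro k hk
      simp only [Finset.mem_filter, Finset.mem_Icc] at hk
      obtain ⟨⟨hk2, hkq⟩, hkc⟩ := hk
      have hkq' : k < q := by
        rcases eq_or_lt_of_le hkq with rfl | hh
        · rw [h.cq] at hkc; exact absurd hkc (lt_irrefl _)
        · exact hh
      have hex2 : ∃ u, 1 ≤ u ∧ u < k ∧ c (k - u) < 0 := ⟨k - 1, by omega, by omega, by
        rw [Nat.sub_sub_self (by omega)]; exact h.c1⟩
      set u := Nat.find hex2 with hu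
      obtain ⟨hu1, hu2, hu3⟩ := Nat.find_spec hex2
      rw [← hu] at hu1 hu2 hu3
      have hrun : ∀ r, r ≤ u - 1 → 0 < c ((k - u) + 1 + r) := by
        intro r hr
        rcases eq_or_lt_of_le hr with rfl | hr
        · have : (k - u) + 1 + (u - 1) = k := by omega
          rw [this]; exact hkc
        · have := Nat.find_min hex2 (m := u - 1 - r) (by omega)
          push Not at this
          have h4 := this (by omega) (by omega)
          have e : k - (u - 1 - r) = (k - u) + 1 + r := by omega
          rw [e] at h4
          exact lt_of_le_of_ne h4 (h.cne _ (by omega) (by omega)).symm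
      have hum : u ≤ m := by
        by_contra hcon
        push Not at hcon
        have := h.run_le (k - u) (by omega) hu3 m (by omega) (fun r hr => hrun r (by omega))
        have h5 := hrun m (by omega)
        linarith [hm1.2, this.2]
      rw [Finset.mem_image]
      refine ⟨(k - u, u), ?_, by simp; omega⟩
      simp only [Finset.mem_product, Finset.mem_filter, Finset.mem_Icc]
      exact ⟨⟨⟨by omega, by omega⟩, hu3⟩, hu1, hum⟩
    refine (Finset.card_le_card hsub).trans (Finset.card_image_le.trans ?_)
    rw [Finset.card_product, Nat.card_Icc, Nat.add_sub_cancel]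
    exact Nat.mul_le_mul_right _ h.hN
  have hw := h.w_le 1 le_rfl (by omega)
  have hs1 := h.hs (2 + m) (by omega) hm1.1
  have hmm : (m : ℝ) * (1 / ℓ) ^ m ≤ 1 := by
    have h2m : (m : ℝ) ≤ 2 ^ m := by exact_mod_cast Nat.lt_two_pow_self.le
    have h3 : (2 : ℝ) ^ m ≤ ℓ ^ m := pow_le_pow_left₀ (by norm_num) hℓ m
    rw [one_div, inv_pow, ← div_eq_mul_inv]
    exact (div_le_one (by positivity)).2 (h2m.trans h3)
  have hc' : (((Finset.Icc 2 q).filter (fun k => 0 < c k)).card : ℝ) ≤ L * m := by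
    exact_mod_cast hcard
  have hp : 0 ≤ (1 / ℓ) ^ m := by positivity
  calc (((Finset.Icc 2 q).filter (fun k => 0 < c k)).card : ℝ) * |slp c v 1 q|
      ≤ (L * m) * ((1 / ℓ) ^ m / ℓ) := by
        apply mul_le_mul hc' _ (abs_nonneg _) (by positivity)
        refine hw.trans (div_le_div_of_nonneg_right ?_ (by linarith))
        refine hs2.trans ?_
        nlinarith
    _ = (m * (1 / ℓ) ^ m) * (L / ℓ) := by ring
    _ ≤ 1 * (L / ℓ) := mul_le_mul_of_nonneg_right hmm (by positivity)
    _ = L / ℓ := one_mul _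

lemma nonpos_card (h : OrbSys L ℓ q c v l ρ) :
    ((Finset.Icc 2 q).filter (fun k => ¬ 0 < c k)).card ≤ L + 1 := by
  classical
  have hsub : (Finset.Icc 2 q).filter (fun k => ¬ 0 < c k) ⊆
      insert q ((Finset.Icc 1 q).filter (fun k => c k < 0)) := by
    intro k hk
    simp only [Finset.mem_filter, Finset.mem_Icc, not_lt] at hk
    simp only [Finset.mem_insert, Finset.mem_filter, Finset.mem_Icc]
    rcases eq_or_lt_of_le hk.1.2 with hh | hh
    · exact Or.inl hh
    · exact Or.inr ⟨⟨by omega, hh.le⟩, lt_of_le_of_ne hk.2 (h.cne k (by omega) hh)⟩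
  refine (Finset.card_le_card hsub).trans ((Finset.card_insert_le _ _).trans ?_)
  have := h.hN
  omega

lemma pos_sum (h : OrbSys L ℓ q c v l ρ) :
    ∑ k ∈ (Finset.Icc 2 q).filter (fun k => 0 < c k), |slp c v k 1| ≤ 2 * (2 * L + 1) / ℓ := by
  classical
  have hℓ := h.hℓ
  have hq := h.hq
  set P := (Finset.Icc 2 q).filter (fun k => 0 < c k) with hP
  set Z := ∑ k ∈ P, |slp c v k 1| with hZ
  have hlt : ∀ k ∈ P, 2 ≤ k ∧ k < q ∧ 0 < c k := by
    intro k hk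
    simp only [hP, Finset.mem_filter, Finset.mem_Icc] at hk
    refine ⟨hk.1.1, lt_of_le_of_ne hk.1.2 ?_, hk.2⟩
    rintro rfl
    rw [h.cq] at hk
    exact lt_irrefl _ hk.2
  have h1 : Z ≤ ∑ k ∈ P, (|slp c v (k + 1) 1| / ℓ + |slp c v 1 q|) := by
    refine Finset.sum_le_sum fun k hk => ?_
    obtain ⟨h2, h3, h4⟩ := hlt k hk
    refine (h.pos_le k h2 h3 h4).trans (max_le ?_ ?_)
    · linarith [h.w_le k (by omega) h3, abs_nonneg (slp c v 1 q)]
    · have : 0 ≤ |slp c v (k + 1) 1| / ℓ := div_nonneg (abs_nonneg _) (by linarith)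
      linarith
  rw [Finset.sum_add_distrib, Finset.sum_const, nsmul_eq_mul, ← Finset.sum_div] at h1
  have h2 : ∑ k ∈ P, |slp c v (k + 1) 1| ≤ ∑ k ∈ Finset.Icc 2 q, |slp c v k 1| := by
    have := Finset.sum_image (s := P) (g := fun k => k + 1) (f := fun k => |slp c v k 1|)
      (by intro a _ b _ hab; simpa using hab)
    rw [← this]
    refine Finset.sum_le_sum_of_subset_of_nonneg ?_ (fun _ _ _ => abs_nonneg _)
    intro k hk
    rw [Finset.mem_image] at hk
    obtain ⟨a, ha, rfl⟩ := hk
    have := hlt a ha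
    rw [Finset.mem_Icc]; omega
  rw [← Finset.sum_filter_add_sum_filter_not (Finset.Icc 2 q) (fun k => 0 < c k)] at h2
  have h3 : ∑ k ∈ (Finset.Icc 2 q).filter (fun k => ¬ 0 < c k), |slp c v k 1| ≤ L + 1 := by
    refine (Finset.sum_le_card_nsmul _ _ 1 ?_).trans ?_
    · intro k hk
      simp only [Finset.mem_filter, Finset.mem_Icc] at hk
      exact h.hs k hk.1.1 hk.1.2
    · rw [nsmul_eq_mul, mul_one]
      exact_mod_cast h.nonpos_card
  have h4 := h.count
  have h5 : Z ≤ (Z + (L + 1)) / ℓ + L / ℓ := by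
    refine h1.trans (add_le_add (div_le_div_of_nonneg_right ?_ (by linarith)) h4)
    linarith
  have hℓ0 : 0 < ℓ := by linarith
  rw [← add_div, le_div_iff₀ hℓ0] at h5
  rw [le_div_iff₀ hℓ0]
  have hZ0 : 0 ≤ Z := Finset.sum_nonneg fun _ _ => abs_nonneg _
  nlinarith

lemma tot_sum (h : OrbSys L ℓ q c v l ρ) (B : Finset ℕ) (ε : ℝ) (hε : 0 ≤ ε)
    (hB : ∀ k, 2 ≤ k → k ≤ q → k ∉ B → |slp c v k 1| ≤ ε) :
    ∑ k ∈ (Finset.Icc 2 q) \ B, |slp c v k 1| ≤ 2 * (2 * L + 1) / ℓ + (L + 1) * ε := by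
  classical
  rw [← Finset.sum_filter_add_sum_filter_not _ (fun k => 0 < c k)]
  refine add_le_add (le_trans ?_ h.pos_sum) ?_
  · refine Finset.sum_le_sum_of_subset_of_nonneg ?_ (fun _ _ _ => abs_nonneg _)
    exact Finset.filter_subset_filter _ Finset.sdiff_subset
  · refine (Finset.sum_le_card_nsmul _ _ ε ?_).trans ?_
    · intro k hk
      simp only [Finset.mem_filter, Finset.mem_sdiff, Finset.mem_Icc] at hk
      exact hB k hk.1.1.1 hk.1.1.2 hk.1.2
    · rw [nsmul_eq_mul]
      refine mul_le_mul_of_nonneg_right ?_ hε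
      have := Finset.card_le_card (Finset.filter_subset_filter (fun k => ¬ 0 < c k)
        (Finset.sdiff_subset (s := Finset.Icc 2 q) (t := B)))
      exact_mod_cast this.trans h.nonpos_card

/-- `a` and `b` return to `B` simultaneously for the first time and without being separated -/
def Ret (c : ℕ → ℝ) (B : Finset ℕ) (a b : ℕ) : Prop :=
  ∃ n, (∀ r, r ≤ n → 0 < c (a + r) * c (b + r)) ∧
    (∀ r, 1 ≤ r → r ≤ n → a + r ∉ B ∧ b + r ∉ B) ∧ a + n + 1 ∈ B ∧ b + n + 1 ∈ B

lemma Ret.trans' {B : Finset ℕ} {a b d : ℕ} (h1 : Ret c B a b) (h2 : Ret c B b d) : Ret c B a d := by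
  obtain ⟨n, s1, r1, a1, b1⟩ := h1
  obtain ⟨n', s2, r2, a2, b2⟩ := h2
  have hn : n = n' := by
    rcases lt_trichotomy n n' with hlt | heq | hgt
    · exact absurd b1 (r2 (n + 1) (by omega) (by omega)).1
    · exact heq
    · exact absurd a2 (r1 (n' + 1) (by omega) (by omega)).2
  subst hn
  refine ⟨n, fun r hr => ?_, fun r hr hr' => ⟨(r1 r hr hr').1, (r2 r hr hr').2⟩, a1, b2⟩
  have g1 := s1 r hr
  have g2 := s2 r hr
  have g3 := mul_pos g1 g2
  have g4 : 0 < c (b + r) ^ 2 := by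
    have : c (b + r) ≠ 0 := fun h0 => by rw [h0] at g1; simp at g1
    positivity
  have : c (a + r) * c (b + r) * (c (b + r) * c (d + r)) = (c (a + r) * c (d + r)) * c (b + r) ^ 2 := by
    ring
  rw [this] at g3
  exact (pos_iff_pos_of_mul_pos g3).2 g4

lemma Ret.prev {B : Finset ℕ} {a b : ℕ} (h : Ret c B (a + 1) (b + 1)) (hc : 0 < c a * c b)
    (ha : a + 1 ∉ B) (hb : b + 1 ∉ B) : Ret c B a b := by
  obtain ⟨n, s1, r1, a1, b1⟩ := h
  have e : ∀ x r, x + (r + 1) = x + 1 + r := fun x r => by omega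
  refine ⟨n + 1, ?_, ?_, ?_, ?_⟩
  · intro r hr
    rcases r with _ | r
    · simpa using hc
    · rw [e a r, e b r]; exact s1 r (by omega)
  · intro r hr hr'
    rcases r with _ | r
    · omega
    · rw [e a r, e b r]
      rcases r with _ | r
      · exact ⟨ha, hb⟩
      · exact r1 (r + 1) (by omega) (by omega)
  · rw [e a n]; exact a1
  · rw [e b n]; exact b1

lemma chain (h : OrbSys L ℓ q c v l ρ) (B : Finset ℕ) (η : ℝ) (hη : 1 / ℓ ≤ η)
    (hsplit : ∀ i j, 1 ≤ i → i < q → 1 ≤ j → j < q → i ≠ j → 0 < c i * c j →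
      i + 1 ∉ B → j + 1 ∈ B → |slp c v i j| ≤ η) (n : ℕ) :
    ∀ a b, 1 ≤ a → a ≤ q → 1 ≤ b → b ≤ q → a ≠ b → a + n = q → ¬ Ret c B a b →
      |slp c v a b| ≤ η + ∑ k ∈ (Finset.Icc (a + 1) q) \ B, |slp c v k 1|
        + ∑ k ∈ (Finset.Icc (b + 1) q) \ B, |slp c v k 1| := by
  classical
  induction n with
  | zero =>
    intro a b ha haq hb hbq hab hn hret
    have h1 : |slp c v a b| ≤ 1 / ℓ := by
      apply h.opp a b ha haq hb hbq hab
      have : a = q := by omega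
      rw [this, h.cq, zero_mul]
    have h2 : ∀ s : Finset ℕ, 0 ≤ ∑ k ∈ s, |slp c v k 1| :=
      fun s => Finset.sum_nonneg fun _ _ => abs_nonneg _
    linarith [h2 ((Finset.Icc (a + 1) q) \ B), h2 ((Finset.Icc (b + 1) q) \ B)]
  | succ n ih =>
    intro a b ha haq hb hbq hab hn hret
    have h2 : ∀ s : Finset ℕ, 0 ≤ ∑ k ∈ s, |slp c v k 1| :=
      fun s => Finset.sum_nonneg fun _ _ => abs_nonneg _
    have g1 := h2 ((Finset.Icc (a + 1) q) \ B)
    have g2 := h2 ((Finset.Icc (b + 1) q) \ B)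
    rcases le_or_gt (c a * c b) 0 with hc | hc
    · have := h.opp a b ha haq hb hbq hab hc
      linarith
    have haq' : a < q := by omega
    have hbq' : b < q := by
      rcases eq_or_lt_of_le hbq with rfl | hh
      · rw [h.cq] at hc; simp at hc
      · exact hh
    by_cases hA : a + 1 ∈ B
    · by_cases hB : b + 1 ∈ B
      · exfalso
        apply hret
        refine ⟨0, ?_, ?_, hA, hB⟩
        · intro r hr
          have : r = 0 := by omega
          subst this
          simpa using hc
        · intro r hr hr'; omega
      · have := hsplit b a hb hbq' ha haq' hab.symm (by rwa [mul_comm]) hB hA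
        rw [slp_comm] at this
        linarith
    · by_cases hB : b + 1 ∈ B
      · have := hsplit a b ha haq' hb hbq' hab hc hA hB
        linarith
      · have hr' : ¬ Ret c B (a + 1) (b + 1) := fun hr => hret (hr.prev hc hA hB)
        have h3 := ih (a + 1) (b + 1) (by omega) (by omega) (by omega) (by omega) (by omega)
          (by omega) hr'
        have h4 := h.step_sum a b ha haq' hb hbq' hab hc
        have key : ∀ x, x < q → x + 1 ∉ B → ∑ k ∈ (Finset.Icc (x + 1) q) \ B, |slp c v k 1| =
            |slp c v (x + 1) 1| + ∑ k ∈ (Finset.Icc (x + 1 + 1) q) \ B, |slp c v k 1| := by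
          intro x hx hxB
          have : (Finset.Icc (x + 1) q) \ B = insert (x + 1) ((Finset.Icc (x + 1 + 1) q) \ B) := by
            ext k
            simp only [Finset.mem_sdiff, Finset.mem_Icc, Finset.mem_insert]
            constructor
            · rintro ⟨⟨k1, k2⟩, k3⟩
              rcases eq_or_lt_of_le k1 with hh | hh
              · exact Or.inl hh.symm
              · exact Or.inr ⟨⟨by omega, k2⟩, k3⟩
            · rintro (rfl | ⟨⟨k1, k2⟩, k3⟩)
              · exact ⟨⟨le_rfl, by omega⟩, hxB⟩
              · exact ⟨⟨by omega, k2⟩, k3⟩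
          rw [this, Finset.sum_insert (by simp)]
        rw [key a haq' hA, key b hbq' hB]
        linarith

/-- one refinement step -/
lemma refine_step (L : ℕ) (η : ℝ) (hη : 0 < η) : ∃ ε : ℝ, 0 < ε ∧ ∃ ℓ₁ : ℝ, 1 ≤ ℓ₁ ∧
    ∀ (ℓ : ℝ) (q : ℕ) (c v l : ℕ → ℝ) (ρ : ℝ), OrbSys L ℓ q c v l ρ → ℓ₁ ≤ ℓ →
      ∀ B : Finset ℕ, 1 ∈ B → (∀ b ∈ B, 1 ≤ b ∧ b ≤ q) → B ≠ {1} →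
        (∀ a b, 1 ≤ a → a ≤ q → a ∉ B → b ∈ B → |slp c v a b| ≤ ε) →
        ∃ B' : Finset ℕ, B' ⊂ B ∧ 1 ∈ B' ∧
          (∀ a b, 1 ≤ a → a ≤ q → a ∉ B' → b ∈ B' → |slp c v a b| ≤ η) := by
  classical
  obtain ⟨ε₀, hε₀, ℓ₀, hℓ₀, H⟩ := step_split (η / 4) (by positivity)
  set ε := min ε₀ (min η (η / (8 * (L + 1)))) with hεdef
  have hLp : (0 : ℝ) < L + 1 := by positivity
  have hε : 0 < ε := by positivity
  refine ⟨ε, hε, max ℓ₀ (max (4 / η) (16 * (2 * L + 1) / η)), le_trans hℓ₀ (le_max_left _ _), ?_⟩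
  intro ℓ q c v l ρ h hℓ B h1B hBq hB1 hB
  have hℓa : ℓ₀ ≤ ℓ := (le_max_left _ _).trans hℓ
  have hℓb : 4 / η ≤ ℓ := ((le_max_left _ _).trans (le_max_right _ _)).trans hℓ
  have hℓc : 16 * (2 * L + 1) / η ≤ ℓ := ((le_max_right _ _).trans (le_max_right _ _)).trans hℓ
  have hℓ2 := h.hℓ
  have hℓ0 : 0 < ℓ := by linarith
  have hεa : ε ≤ ε₀ := min_le_left _ _
  have hεb : ε ≤ η := (min_le_right _ _).trans (min_le_left _ _)
  have hεc : (L + 1) * ε ≤ η / 8 := by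
    have : ε ≤ η / (8 * (L + 1)) := (min_le_right _ _).trans (min_le_right _ _)
    rw [le_div_iff₀ (by positivity)] at this
    linarith
  have hs : ∀ k, 2 ≤ k → k ≤ q → k ∉ B → |slp c v k 1| ≤ ε := fun k h2 hk hkB =>
    hB k 1 (by omega) hk hkB h1B
  have htot := h.tot_sum B ε hε.le hs
  have htot' : ∑ k ∈ (Finset.Icc 2 q) \ B, |slp c v k 1| ≤ η / 4 := by
    have : 2 * (2 * (L : ℝ) + 1) / ℓ ≤ η / 8 := by
      rw [div_le_iff₀ hη] at hℓc
      rw [div_le_div_iff₀ hℓ0 (by norm_num)]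
      linarith
    linarith
  have hsum : ∀ x, 1 ≤ x → ∑ k ∈ (Finset.Icc (x + 1) q) \ B, |slp c v k 1| ≤ η / 4 := by
    intro x hx
    refine le_trans (Finset.sum_le_sum_of_subset_of_nonneg ?_ (fun _ _ _ => abs_nonneg _)) htot'
    exact Finset.sdiff_subset_sdiff (Finset.Icc_subset_Icc (by omega) le_rfl) le_rfl
  have hinv : 1 / ℓ ≤ η / 4 := by
    rw [div_le_iff₀ hη] at hℓb
    rw [div_le_div_iff₀ hℓ0 (by norm_num)]
    linarith
  have hchain : ∀ a b, 1 ≤ a → a ≤ q → 1 ≤ b → b ≤ q → a ≠ b → ¬ Ret c B a b →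
      |slp c v a b| ≤ η := by
    intro a b ha haq hb hbq hab hret
    have := h.chain B (η / 4) hinv ?_ (q - a) a b ha haq hb hbq hab (by omega) hret
    · linarith [hsum a ha, hsum b hb]
    · intro i j hi hiq hj hjq hij hc hiB hjB
      apply H L ℓ q c v l ρ h hℓa i j hi hiq hj hjq hij hc
      · exact (hB _ _ (by omega) (by omega) hiB hjB).trans hεa
      · exact (hB _ _ (by omega) (by omega) hiB h1B).trans hεa
  refine ⟨B.filter (fun k => k = 1 ∨ Ret c B k 1), ?_, ?_, ?_⟩
  · rw [Finset.filter_ssubset]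
    have hne : B.Nonempty := ⟨1, h1B⟩
    refine ⟨B.max' hne, B.max'_mem hne, ?_⟩
    rintro (hm | ⟨n, -, -, hm, -⟩)
    · apply hB1
      ext k
      rw [Finset.mem_singleton]
      constructor
      · intro hk
        have h3 := B.le_max' k hk
        have h4 := (hBq k hk).1
        omega
      · rintro rfl; exact h1B
    · have := B.le_max' _ hm
      omega
  · simp [h1B]
  · intro a b ha haq haB hbB
    rw [Finset.mem_filter] at haB hbB
    obtain ⟨hbB, hb⟩ := hbB
    by_cases haB' : a ∈ B
    · have ha' : ¬ (a = 1 ∨ Ret c B a 1) := fun hh => haB ⟨haB', hh⟩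
      push Not at ha'
      have hab : a ≠ b := by
        rintro rfl
        rcases hb with hb | hb
        · exact ha'.1 hb
        · exact ha'.2 hb
      apply hchain a b ha haq (hBq b hbB).1 (hBq b hbB).2 hab
      intro hret
      rcases hb with rfl | hb
      · exact ha'.2 hret
      · exact ha'.2 (hret.trans' hb)
    · exact (hB a b ha haq haB' hbB).trans hεb

lemma refine_all (L : ℕ) (n : ℕ) : ∃ ε : ℝ, 0 < ε ∧ ∃ ℓ₁ : ℝ, 1 ≤ ℓ₁ ∧
    ∀ (ℓ : ℝ) (q : ℕ) (c v l : ℕ → ℝ) (ρ : ℝ), OrbSys L ℓ q c v l ρ → ℓ₁ ≤ ℓ →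
      ∀ B : Finset ℕ, B.card ≤ n → 1 ∈ B → (∀ b ∈ B, 1 ≤ b ∧ b ≤ q) →
        (∀ a b, 1 ≤ a → a ≤ q → a ∉ B → b ∈ B → |slp c v a b| ≤ ε) →
        ∀ k, 2 ≤ k → k ≤ q → |slp c v k 1| ≤ 1 / 2 := by
  induction n with
  | zero =>
    refine ⟨1, one_pos, 1, le_rfl, ?_⟩
    intro ℓ q c v l ρ _ _ B hB h1
    rw [Nat.le_zero, Finset.card_eq_zero] at hB
    rw [hB] at h1
    simp at h1
  | succ n ih =>
    obtain ⟨η, hη, ℓa, hℓa, H⟩ := ih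
    obtain ⟨ε, hε, ℓb, hℓb, H'⟩ := refine_step L η hη
    refine ⟨min ε (1 / 2), by positivity, max ℓa ℓb, hℓa.trans (le_max_left _ _), ?_⟩
    intro ℓ q c v l ρ h hℓ B hcard h1 hBq hB k hk hkq
    by_cases hB1 : B = {1}
    · subst hB1
      exact (hB k 1 (by omega) hkq (by simp; omega) (by simp)).trans (min_le_right _ _)
    · obtain ⟨B', hss, h1', hB'⟩ := H' ℓ q c v l ρ h ((le_max_right _ _).trans hℓ) B h1 hBq hB1
        (fun a b ha haq haB hbB => (hB a b ha haq haB hbB).trans (min_le_left _ _))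
      have hc := Finset.card_lt_card hss
      exact H ℓ q c v l ρ h ((le_max_left _ _).trans hℓ) B' (by omega) h1'
        (fun b hb => hBq b (hss.1 hb)) hB' k hk hkq

lemma half (L : ℕ) : ∃ ℓ₁ : ℝ, 2 ≤ ℓ₁ ∧
    ∀ (ℓ : ℝ) (q : ℕ) (c v l : ℕ → ℝ) (ρ : ℝ), OrbSys L ℓ q c v l ρ → ℓ₁ ≤ ℓ →
        ∀ k, 2 ≤ k → k ≤ q → |slp c v k 1| ≤ 1 / 2 := by
  classical
  obtain ⟨ε, hε, ℓ₁, hℓ₁, H⟩ := refine_all L L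
  refine ⟨max (max 2 ℓ₁) (1 / ε), (le_max_left _ _).trans (le_max_left _ _), ?_⟩
  intro ℓ q c v l ρ h hℓ
  have hℓ2 := h.hℓ
  have hq := h.hq
  apply H ℓ q c v l ρ h (((le_max_right _ _).trans (le_max_left _ _)).trans hℓ)
    ((Finset.Icc 1 q).filter (fun k => c k < 0)) h.hN
  · simp only [Finset.mem_filter, Finset.mem_Icc]
    exact ⟨⟨le_rfl, by omega⟩, h.c1⟩
  · intro b hb
    simp only [Finset.mem_filter, Finset.mem_Icc] at hb
    exact hb.1
  · intro a b ha haq haB hbB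
    simp only [Finset.mem_filter, Finset.mem_Icc] at haB hbB
    have hac : 0 ≤ c a := by
      by_contra hh
      push Not at hh
      exact haB ⟨⟨ha, haq⟩, hh⟩
    refine (h.opp a b ha haq hbB.1.1 hbB.1.2 ?_ ?_).trans ?_
    · rintro rfl; linarith
    · exact mul_nonpos_of_nonneg_of_nonpos hac hbB.2.le
    · have := (le_max_right _ _).trans hℓ
      rw [div_le_iff₀ hε] at this
      rw [div_le_iff₀ (by linarith)]
      linarith

end OrbSys

/-- A root `ρ` of the deformed sum produces a vector satisfying the backward recursion. -/
lemma exists_vec (q : ℕ) (hq : 2 ≤ q) (D : ℕ → ℝ)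
    (hP : ∑ n ∈ Finset.range q, 1 / ∏ k ∈ Finset.range n, D (k + 1) ≤ 0) :
    ∃ ρ : ℝ, 0 < ρ ∧ ρ ≤ 1 ∧ ∃ v : ℕ → ℝ, v q = 0 ∧ v 1 = 1 ∧
      ∀ k, 1 ≤ k → k < q → v k = ρ * (v (k + 1) - 1) / D k := by
  set P : ℝ → ℝ := fun ρ => ∑ n ∈ Finset.range q, ρ ^ n / ∏ k ∈ Finset.range n, D (k + 1) with hPd
  obtain ⟨m, rfl⟩ : ∃ m, q = m + 1 := ⟨q - 1, by omega⟩
  have hcont : Continuous P := by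
    apply continuous_finsetSum
    intro n _
    exact (continuous_pow n).div_const _
  have h0 : P 0 = 1 := by
    simp only [hPd]
    rw [Finset.sum_range_succ']
    simp
  have h1 : P 1 ≤ 0 := by
    simpa only [hPd, one_pow] using hP
  obtain ⟨ρ, ⟨hρ0, hρ1⟩, hρ⟩ :=
    intermediate_value_Icc' (zero_le_one' ℝ) hcont.continuousOn (show (0 : ℝ) ∈ Set.Icc (P 1) (P 0) from
      ⟨h1, by rw [h0]; norm_num⟩)
  have hρ0' : 0 < ρ := by
    rcases eq_or_lt_of_le hρ0 with h | h
    · rw [← h, h0] at hρ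
      norm_num at hρ
    · exact h
  refine ⟨ρ, hρ0', hρ1, fun k => -∑ n ∈ Finset.range (m + 1 - k),
    ρ ^ (n + 1) / ∏ r ∈ Finset.range (n + 1), D (k + r), ?_, ?_, ?_⟩
  · simp
  · simp only [hPd] at hρ
    rw [Finset.sum_range_succ'] at hρ
    simp only [Finset.range_zero, Finset.prod_empty, pow_zero, div_one] at hρ
    have : ∀ n, ∏ r ∈ Finset.range (n + 1), D (1 + r) = ∏ r ∈ Finset.range (n + 1), D (r + 1) :=
      fun n => Finset.prod_congr rfl fun r _ => by rw [add_comm]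
    simp only [this, Nat.add_sub_cancel]
    linarith
  · intro k hk hkq
    obtain ⟨p, hp⟩ : ∃ p, m + 1 - k = p + 1 := ⟨m - k, by omega⟩
    have hp' : m + 1 - (k + 1) = p := by omega
    simp only [hp, hp']
    rw [Finset.sum_range_succ']
    have : ∀ n, ρ ^ (n + 1 + 1) / ∏ r ∈ Finset.range (n + 1 + 1), D (k + r) =
        ρ / D k * (ρ ^ (n + 1) / ∏ r ∈ Finset.range (n + 1), D (k + 1 + r)) := by
      intro n
      rw [Finset.prod_range_succ']
      have e : ∀ r, D (k + (r + 1)) = D (k + 1 + r) := fun r => by congr 1; omega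
      simp only [e, add_zero]
      rw [div_mul_div_comm, pow_succ' ρ (n + 1), mul_comm (D k)]
    simp only [this, ← Finset.mul_sum]
    simp only [zero_add, pow_one, Finset.prod_range_one, add_zero]
    ring

lemma fml_deriv (lm lp t x : ℝ) (hlm : 2 ≤ lm) (hlp : 2 ≤ lp) (hx : x ≠ 0) :
    deriv (fml lm lp t) x = (if x < 0 then lm else lp) * (fml lm lp t x - t) / x := by
  rcases lt_or_gt_of_ne hx with h | h
  · have ev : fml lm lp t =ᶠ[nhds x] fun y => (-y) ^ lm + t := by
      filter_upwards [Iio_mem_nhds h] with y hy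
      have hy : y < 0 := hy
      simp [fml, hy.le, abs_of_neg hy]
    have hd : HasDerivAt (fun y : ℝ => (-y) ^ lm + t) ((-1) * lm * (-x) ^ (lm - 1)) x :=
      (((hasDerivAt_id x).neg).rpow_const (Or.inl (by simpa using hx))).add_const t
    rw [ev.deriv_eq, hd.deriv, if_pos h]
    simp only [fml, if_pos h.le, abs_of_neg h]
    have hx' : 0 < -x := by linarith
    rw [Real.rpow_sub_one hx'.ne']
    field_simp
    ring
  · have ev : fml lm lp t =ᶠ[nhds x] fun y => y ^ lp + t := by
      filter_upwards [Ioi_mem_nhds h] with y hy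
      have hy : 0 < y := hy
      simp [fml, not_le.2 hy, abs_of_pos hy]
    have hd : HasDerivAt (fun y : ℝ => y ^ lp + t) (1 * lp * x ^ (lp - 1)) x :=
      ((hasDerivAt_id x).rpow_const (Or.inl (by simpa using hx))).add_const t
    rw [ev.deriv_eq, hd.deriv, if_neg (not_lt.2 h.le)]
    simp only [fml, if_neg (not_le.2 h), abs_of_pos h]
    rw [Real.rpow_sub_one h.ne']
    field_simp
    ring

lemma fml_sub (lm lp t x : ℝ) (hx : x ≠ 0) :
    fml lm lp t x - t = |x| ^ (if x < 0 then lm else lp) := by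
  rcases lt_or_gt_of_ne hx with h | h
  · simp [fml, h, h.le]
  · simp [fml, not_lt.2 h.le, not_le.2 h]

theorem stmt3 (L : ℕ) (hL : 1 ≤ L) :
    ∃ ℓ₀ : ℝ, 1 < ℓ₀ ∧
      ∀ lm lp : ℝ, ℓ₀ ≤ lm → ℓ₀ ≤ lp →
        ∀ q : ℕ, 1 ≤ q → ∀ c : ℝ,
          (fml lm lp c)^[q] 0 = 0 →
          (∀ j, 1 ≤ j → j < q → (fml lm lp c)^[j] 0 ≠ 0) →
          Set.ncard {j : ℕ | 1 ≤ j ∧ j < q ∧ (fml lm lp c)^[j] 0 < 0} ≤ L →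
          0 < ∑ n ∈ Finset.range q, 1 / fmlDfn lm lp c n := by
  classical
  obtain ⟨ℓ₁, hℓ₁, half⟩ := OrbSys.half L
  refine ⟨ℓ₁, by linarith, ?_⟩
  intro lm lp hlm hlp q hq t hcq hcne hcard
  rcases eq_or_lt_of_le hq with rfl | hq2
  · simp [fmlDfn]
  have hq2 : 2 ≤ q := hq2
  set c : ℕ → ℝ := fun k => (fml lm lp t)^[k] 0 with hc
  have hcs : ∀ k, c (k + 1) = fml lm lp t (c k) := fun k => Function.iterate_succ_apply' _ _ _
  have hc0 : c 0 = 0 := rfl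
  have hc1 : c 1 = t := by
    rw [hcs 0, hc0]
    simp [fml, Real.zero_rpow (show lm ≠ 0 by linarith)]
  have hit : ∀ k, (fml lm lp t)^[k] t = c (k + 1) := by
    intro k
    have : c (k + 1) = (fml lm lp t)^[k] (fml lm lp t 0) := Function.iterate_succ_apply _ _ _
    rw [this]
    congr 1
    exact (hc1.symm.trans (hcs 0))
  have hge : ∀ k, 1 ≤ k → t ≤ c k := by
    intro k hk
    obtain ⟨m, rfl⟩ : ∃ m, k = m + 1 := ⟨k - 1, by omega⟩
    rw [hcs]
    unfold fml
    split_ifs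
    · linarith [Real.rpow_nonneg (abs_nonneg (c m)) lm]
    · linarith [Real.rpow_nonneg (abs_nonneg (c m)) lp]
  have hcq : c q = 0 := hcq
  have hcne : ∀ k, 1 ≤ k → k < q → c k ≠ 0 := hcne
  have ht : t < 0 := by
    have h1 := hge q hq
    rw [hcq] at h1
    have h2 := hcne 1 le_rfl (by omega)
    rw [hc1] at h2
    exact lt_of_le_of_ne h1 h2
  set l : ℕ → ℝ := fun k => if c k < 0 then lm else lp with hl
  set D : ℕ → ℝ := fun k => deriv (fml lm lp t) (c k) with hD
  have hlpos : ∀ k, ℓ₁ ≤ l k := by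
    intro k
    simp only [hl]
    split_ifs <;> assumption
  have hrec : ∀ k, 1 ≤ k → k < q → c (k + 1) - c 1 = |c k| ^ (l k) := by
    intro k hk hkq
    rw [hcs, hc1, fml_sub _ _ _ _ (hcne k hk hkq)]
  have hDe : ∀ k, 1 ≤ k → k < q → D k = l k * (c (k + 1) - c 1) / c k := by
    intro k hk hkq
    rw [hcs, hc1]
    exact fml_deriv lm lp t (c k) (by linarith) (by linarith) (hcne k hk hkq)
  by_contra hcon
  have hP : ∑ n ∈ Finset.range q, 1 / ∏ k ∈ Finset.range n, D (k + 1) ≤ 0 := by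
    have : ∀ n, fmlDfn lm lp t n = ∏ k ∈ Finset.range n, D (k + 1) := by
      intro n
      unfold fmlDfn
      exact Finset.prod_congr rfl fun k _ => by rw [hit]
    simp only [this] at hcon
    exact not_lt.1 hcon
  obtain ⟨ρ, hρ0, hρ1, v, hvq, hv1, hv⟩ := exists_vec q hq2 D hP
  have hslq : ∀ k, slp c v k q = v k / c k := by
    intro k
    unfold slp
    rw [hcq, hvq, sub_zero, sub_zero]
  have hvrec : ∀ k, 1 ≤ k → k < q → slp c v k q = ρ / l k * slp c v (k + 1) 1 := by
    intro k hk hkq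
    rw [hslq, hv k hk hkq, hDe k hk hkq]
    unfold slp
    rw [hv1]
    have h1 : c k ≠ 0 := hcne k hk hkq
    have h2 : c (k + 1) - c 1 ≠ 0 := by
      rw [hrec k hk hkq]
      exact (Real.rpow_pos_of_pos (abs_pos.2 h1) _).ne'
    have h3 : l k ≠ 0 := by linarith [hlpos k]
    field_simp
  obtain ⟨K, hK, hKmax⟩ := Finset.exists_max_image (Finset.Icc 2 q) (fun k => |slp c v k 1|)
    ⟨2, by simp [hq2]⟩
  rw [Finset.mem_Icc] at hK
  set M := |slp c v K 1| with hM
  have hMmax : ∀ k, 2 ≤ k → k ≤ q → |slp c v k 1| ≤ M := fun k h1 h2 =>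
    hKmax k (Finset.mem_Icc.2 ⟨h1, h2⟩)
  have hMpos : 0 < M := by
    by_contra hM0
    have h2 := hMmax 2 le_rfl hq2
    have h3 : slp c v 2 1 = 0 := abs_nonpos_iff.1 (by linarith)
    have h4 := hvrec 1 le_rfl (by omega)
    rw [hslq, hv1, h3, mul_zero, hc1] at h4
    exact (div_ne_zero one_ne_zero ht.ne) h4
  have hsc : ∀ i j, slp c (fun k => v k / M) i j = slp c v i j / M := by
    intro i j
    unfold slp
    ring
  have sys : OrbSys L ℓ₁ q c (fun k => v k / M) l ρ := by
    refine ⟨hℓ₁, hq2, by rw [hc1]; exact ht, hcne, hcq, hlpos, ?_, hrec, by simp [hvq], ?_, hρ0, hρ1,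
      ?_, ?_⟩
    · intro i j hij
      simp only [hl]
      rcases pos_and_pos_or_neg_and_neg_of_mul_pos hij with ⟨h1, h2⟩ | ⟨h1, h2⟩
      · rw [if_neg (not_lt.2 h1.le), if_neg (not_lt.2 h2.le)]
      · rw [if_pos h1, if_pos h2]
    · intro k hk hkq
      rw [hsc, hsc, hvrec k hk hkq, mul_div_assoc]
    · rw [← Set.ncard_coe_finset]
      refine le_trans (le_of_eq ?_) hcard
      congr 1
      ext k
      simp only [Finset.coe_filter, Finset.mem_Icc, Set.mem_ofPred_eq]
      constructor
      · rintro ⟨⟨h1, h2⟩, h3⟩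
        refine ⟨h1, lt_of_le_of_ne h2 ?_, h3⟩
        rintro rfl
        exact absurd hcq h3.ne
      · rintro ⟨h1, h2, h3⟩
        exact ⟨⟨h1, h2.le⟩, h3⟩
    · intro k hk hkq
      rw [hsc, abs_div, abs_of_pos hMpos, div_le_one hMpos]
      exact hMmax k hk hkq
  have hfin := half ℓ₁ q c _ l ρ sys le_rfl K hK.1 hK.2
  rw [hsc, abs_div, abs_of_pos hMpos, ← hM, div_self hMpos.ne'] at hfin
  norm_num at hfin
end

section
/- Let f be in the class ℰ with distinguished critical point c > 0 (so f(c) = 1) and let b = sup{x ∈ I : x > c and f(x) > 0}. Suppose 0 < a₀ < b and c is a periodic point of period q for g_{a₀}(x) = a₀·f(x): g_{a₀}^j(c) ∈ I for 1 ≤ j ≤ q, g_{a₀}^q(c) = c, and g_{a₀}^j(c) ≠ c for 1 ≤ j < q. Then the positive transversality condition holds: the derivative at a = a₀ of the map a ↦ g_a^q(c) (where g_a(x) = a·f(x)), divided by ∏_{k=1}^{q−1} g_{a₀}′(g_{a₀}^k(c)), is strictly positive. -/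
/-- The real one-parameter family `g_a(x) = a·f(x)` (read on the real line through `re`). -/
noncomputable def gre (f : ℂ → ℂ) (a : ℝ) : ℝ → ℝ := fun x => a * (f x).re

section Helpers
open Complex Metric Set Filter Topology


theorem cos_add_int_pi (x : ℂ) (n : ℤ) : cos (x + n * Real.pi) = (-1) ^ n * cos x := by
  have := Complex.cos_antiperiodic.add_int_mul_eq (x := x) n
  rw [this]
  rcases Int.even_or_odd n with hk | hk
  · simp [Int.negOnePow_even n hk, hk.neg_one_zpow]
  · simp [Int.negOnePow_odd n hk, hk.neg_one_zpow]

theorem hol_log {u : ℂ → ℂ} (hu : DifferentiableOn ℂ u (ball 0 1))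
    (hne : ∀ z ∈ ball (0:ℂ) 1, u z ≠ 0) {l0 : ℂ} (hl : exp l0 = u 0) :
    ∃ L : ℂ → ℂ, DifferentiableOn ℂ L (ball 0 1) ∧ L 0 = l0 ∧
      ∀ z ∈ ball (0:ℂ) 1, exp (L z) = u z := by
  have h0 : (0:ℂ) ∈ ball (0:ℂ) 1 := by simp
  have hd : DifferentiableOn ℂ (fun z => deriv u z / u z) (ball 0 1) :=
    (hu.deriv isOpen_ball).div hu hne
  obtain ⟨L, hL0, hL⟩ := hd.isExactOn_ball.with_val_at 0 l0
  refine ⟨L, fun z hz => (hL z hz).differentiableAt.differentiableWithinAt, hL0, ?_⟩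
  have hk : ∀ z ∈ ball (0:ℂ) 1, HasDerivAt (fun z => u z * exp (-(L z))) 0 z := by
    intro z hz
    have h1 := (hu.differentiableAt (isOpen_ball.mem_nhds hz)).hasDerivAt
    have h2 := ((hL z hz).neg).cexp
    have := h1.mul h2
    refine this.congr_deriv ?_
    have := hne z hz
    simp only [Pi.neg_apply]
    field_simp
    ring
  have hc : ∀ z ∈ ball (0:ℂ) 1, u z * exp (-(L z)) = u 0 * exp (-(L 0)) := by
    intro z hz
    refine isOpen_ball.is_const_of_deriv_eq_zero (convex_ball (0:ℂ) 1).isPreconnected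
      (fun z hz => (hk z hz).differentiableAt.differentiableWithinAt)
      (fun z hz => (hk z hz).deriv) hz h0
  intro z hz
  have := hc z hz
  rw [hL0, ← hl, ← Complex.exp_add, add_neg_cancel, Complex.exp_zero, Complex.exp_neg] at this
  have h3 := Complex.exp_ne_zero (L z)
  field_simp at this
  exact this.symm

theorem hol_arccos {h : ℂ → ℂ} (hh : DifferentiableOn ℂ h (ball 0 1))
    (hne : ∀ z ∈ ball (0:ℂ) 1, h z ≠ 1 ∧ h z ≠ -1) {w0 : ℂ} (hw : cos w0 = h 0) :
    ∃ H : ℂ → ℂ, DifferentiableOn ℂ H (ball 0 1) ∧ H 0 = w0 ∧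
      ∀ z ∈ ball (0:ℂ) 1, cos (H z) = h z := by
  have h0 : (0:ℂ) ∈ ball (0:ℂ) 1 := by simp
  have hd : DifferentiableOn ℂ (fun z => 1 - h z ^ 2) (ball 0 1) :=
    (differentiableOn_const _).sub (hh.pow 2)
  have hn : ∀ z ∈ ball (0:ℂ) 1, 1 - h z ^ 2 ≠ 0 := by
    intro z hz hz0
    have : (h z - 1) * (h z + 1) = 0 := by linear_combination -hz0
    rcases mul_eq_zero.1 this with h1 | h1
    · exact (hne z hz).1 (by linear_combination h1)
    · exact (hne z hz).2 (by linear_combination h1)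
  have hs0 : sin w0 ≠ 0 := by
    intro hs
    have := Complex.sin_sq_add_cos_sq w0
    rw [hw, hs] at this
    exact hn 0 h0 (by linear_combination -this)
  obtain ⟨K, hK, hK0, hKe⟩ := hol_log hd hn (l0 := 2 * Complex.log (sin w0)) (by
    rw [two_mul, Complex.exp_add, Complex.exp_log hs0]
    have := Complex.sin_sq_add_cos_sq w0
    rw [hw] at this
    linear_combination this)
  set k : ℂ → ℂ := fun z => exp (K z / 2) with hk
  have hkd : DifferentiableOn ℂ k (ball 0 1) := (hK.div_const 2).cexp
  have hksq : ∀ z ∈ ball (0:ℂ) 1, k z ^ 2 = 1 - h z ^ 2 := by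
    intro z hz
    rw [← hKe z hz, hk, ← Complex.exp_nat_mul]; congr 1; push_cast; ring
  have hk0 : k 0 = sin w0 := by
    simp only [hk, hK0]
    rw [show 2 * Complex.log (sin w0) / 2 = Complex.log (sin w0) by ring, Complex.exp_log hs0]
  have hprod : ∀ z ∈ ball (0:ℂ) 1, (h z + k z * I) * (h z - k z * I) = 1 := by
    intro z hz
    linear_combination hksq z hz - k z ^ 2 * Complex.I_sq
  obtain ⟨L, hL, hL0, hLe⟩ := hol_log (u := fun z => h z + k z * I)
    (hh.add (hkd.mul_const I)) (fun z hz h1 => by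
      have := hprod z hz
      replace h1 : h z + k z * I = 0 := h1
      rw [h1] at this; simp at this) (l0 := w0 * I) (by
      rw [Complex.exp_mul_I, hk0, hw])
  refine ⟨fun z => L z * (-I), hL.mul_const _, ?_, ?_⟩
  · simp only [hL0]; linear_combination -w0 * Complex.I_sq
  · intro z hz
    have e1 : L z * (-I) * I = L z := by linear_combination -L z * Complex.I_sq
    have e2 := hLe z hz
    have e3 := hprod z hz
    rw [Complex.cos, neg_mul, e1, Complex.exp_neg, e2]
    have : (h z + k z * I)⁻¹ = (h z - k z * I) := inv_eq_of_mul_eq_one_right e3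
    rw [this]; ring

theorem net_point (w : ℂ) : ∃ ζ ∈ ball w 2, ∃ n : ℤ, cos (Real.pi * ζ) = n := by
  -- real part: nearest integer
  have key : ∀ t : ℝ, ∃ τ : ℝ, |τ - t| ≤ 1 ∧ ∃ n : ℤ, Real.cosh (Real.pi * τ) = n := by
    have pos : ∀ t : ℝ, 0 ≤ t → ∃ τ : ℝ, |τ - t| ≤ 1 ∧ ∃ n : ℤ, Real.cosh (Real.pi * τ) = n := by
      intro t ht
      have hpi := Real.pi_gt_three
      have hgap : Real.cosh (Real.pi * t) + 1 ≤ Real.cosh (Real.pi * (t+1)) := by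
        rw [mul_add, mul_one, Real.cosh_add]
        have h1 : 1 ≤ Real.cosh (Real.pi * t) := Real.one_le_cosh _
        have h2 : 0 ≤ Real.sinh (Real.pi * t) := Real.sinh_nonneg_iff.2 (by positivity)
        have h3 : 0 ≤ Real.sinh Real.pi := Real.sinh_nonneg_iff.2 (by positivity)
        have h4 : 2 ≤ Real.cosh Real.pi := by
          rw [Real.cosh_eq]
          have := Real.add_one_le_exp Real.pi
          have := Real.exp_pos (-Real.pi)
          linarith
        nlinarith [mul_nonneg h2 h3]
      have hmem : (⌈Real.cosh (Real.pi * t)⌉ : ℝ) ∈ Icc (Real.cosh (Real.pi * t)) (Real.cosh (Real.pi * (t+1))) :=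
        ⟨Int.le_ceil _, (Int.ceil_lt_add_one _).le.trans hgap⟩
      have hcont : ContinuousOn (fun τ => Real.cosh (Real.pi * τ)) (Icc t (t+1)) := by
        fun_prop
      obtain ⟨τ, hτ, he⟩ := intermediate_value_Icc (by linarith) hcont hmem
      exact ⟨τ, by rw [abs_le]; constructor <;> linarith [hτ.1, hτ.2], _, he⟩
    intro t
    rcases le_total 0 t with h | h
    · exact pos t h
    · obtain ⟨τ, h1, n, h2⟩ := pos (-t) (by linarith)
      refine ⟨-τ, ?_, n, ?_⟩
      · rw [abs_sub_comm]; convert h1 using 2; ring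
      · rw [mul_neg, Real.cosh_neg]; exact h2
  obtain ⟨τ, h1, n, h2⟩ := key w.im
  set k := round w.re
  refine ⟨(k : ℂ) + τ * I, ?_, ?_⟩
  · rw [mem_ball, dist_eq_norm]
    have hk : |(k:ℝ) - w.re| ≤ 1/2 := by rw [abs_sub_comm]; exact abs_sub_round w.re
    calc ‖(k:ℂ) + τ * I - w‖ ≤ |((k:ℂ) + τ * I - w).re| + |((k:ℂ) + τ * I - w).im| :=
          Complex.norm_le_abs_re_add_abs_im _
      _ = |(k:ℝ) - w.re| + |τ - w.im| := by simp
      _ < 2 := by linarith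
  · have e : (Real.pi : ℂ) * ((k:ℂ) + τ * I) = ((Real.pi * τ : ℝ) : ℂ) * I + k * Real.pi := by
      push_cast; ring
    rw [e, cos_add_int_pi, Complex.cos_mul_I, ← Complex.ofReal_cosh, h2]
    rcases Int.even_or_odd k with hk | hk
    · exact ⟨n, by rw [hk.neg_one_zpow]; simp⟩
    · exact ⟨-n, by rw [hk.neg_one_zpow]; simp⟩

/-- weak Bloch theorem -/
theorem bloch {g : ℂ → ℂ} (hg : DifferentiableOn ℂ g (ball 0 1)) {R : ℝ} (hR : 0 < R)
    (hno : ∀ w : ℂ, ∃ ζ ∈ ball w R, ∀ z ∈ ball (0:ℂ) 1, g z ≠ ζ) {z : ℂ} {r : ℝ} (hr : r < 1)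
    (hz : ‖z‖ ≤ r) : ‖deriv g z‖ * (r - ‖z‖) ≤ 48 * R := by
  have hr0 : 0 ≤ r := (norm_nonneg z).trans hz
  have hsub : closedBall (0:ℂ) r ⊆ ball 0 1 := closedBall_subset_ball hr
  have hg' : DifferentiableOn ℂ (deriv g) (ball 0 1) := hg.deriv isOpen_ball
  have hc : ContinuousOn (fun z => ‖deriv g z‖ * (r - ‖z‖)) (closedBall (0:ℂ) r) :=
    ((hg'.continuousOn.mono hsub).norm).mul (by fun_prop)
  obtain ⟨p, hp, hmax⟩ := (isCompact_closedBall (0:ℂ) r).exists_isMaxOn ⟨0, by simpa⟩ hc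
  have hmax' : ∀ ζ ∈ closedBall (0:ℂ) r, ‖deriv g ζ‖ * (r - ‖ζ‖) ≤ ‖deriv g p‖ * (r - ‖p‖) :=
    fun ζ hζ => hmax hζ
  refine (hmax' z (by simpa using hz)).trans ?_
  by_contra hcon
  push Not at hcon
  have hpr : ‖p‖ ≤ r := by simpa using hp
  have hpos : 0 < ‖deriv g p‖ * (r - ‖p‖) := by nlinarith
  have hd : 0 < ‖deriv g p‖ := by
    by_contra h; nlinarith [norm_nonneg (deriv g p)]
  have ht' : 0 < r - ‖p‖ := by
    by_contra h; nlinarith [norm_nonneg (deriv g p)]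
  set t := (r - ‖p‖) / 2 with ht
  have htp : 0 < t := by positivity
  set A := ‖deriv g p‖ with hA
  have hnp : ∀ ζ ∈ ball p t, ‖ζ‖ < ‖p‖ + t := by
    intro ζ hζ
    rw [mem_ball, dist_eq_norm] at hζ
    calc ‖ζ‖ = ‖p + (ζ - p)‖ := by ring_nf
      _ ≤ ‖p‖ + ‖ζ - p‖ := norm_add_le _ _
      _ < _ := by linarith
  have hball : ball p t ⊆ ball 0 1 := by
    intro ζ hζ
    have := hnp ζ hζ
    simp only [mem_ball_zero_iff]
    linarith
  have hbd : ∀ ζ ∈ ball p t, ‖deriv g ζ‖ ≤ 2 * A := by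
    intro ζ hζ
    have h1 := hnp ζ hζ
    have h2 := hmax' ζ (by simp only [mem_closedBall_zero_iff]; linarith)
    have h3 : t ≤ r - ‖ζ‖ := by linarith
    have h4 : ‖deriv g ζ‖ * t ≤ A * (2 * t) :=
      (mul_le_mul_of_nonneg_left h3 (norm_nonneg _)).trans (h2.trans (le_of_eq (by rw [ht]; ring)))
    nlinarith
  have hlip : ∀ ζ ∈ ball p t, ‖deriv g ζ - deriv g p‖ ≤ 3 * A / t * ‖ζ - p‖ := by
    intro ζ hζ
    have := dist_le_div_mul_dist_of_mapsTo_ball (f := deriv g) (c := p) (R₁ := t) (R₂ := 3 * A)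
      (hg'.mono hball) (fun ζ hζ => by
        rw [mem_closedBall, dist_eq_norm]
        calc _ ≤ ‖deriv g ζ‖ + ‖deriv g p‖ := norm_sub_le _ _
          _ ≤ _ := by linarith [hbd ζ hζ]) hζ
    simpa [dist_eq_norm] using this
  set s := t / 6 with hs
  have hsp : 0 < s := by positivity
  have hcb : closedBall p s ⊆ ball p t := closedBall_subset_ball (by rw [hs]; linarith)
  have hlow : ∀ ζ ∈ sphere p s, A * t / 12 ≤ ‖g ζ - g p‖ := by
    intro ζ hζ
    have hζs : ‖ζ - p‖ = s := by simpa [dist_eq_norm] using hζ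
    have hmv : ‖(g ζ - deriv g p * ζ) - (g p - deriv g p * p)‖ ≤ (3 * A / t * s) * ‖ζ - p‖ := by
      refine (convex_closedBall p s).norm_image_sub_le_of_norm_hasDerivWithin_le
        (f := fun ζ => g ζ - deriv g p * ζ) (f' := fun ζ => deriv g ζ - deriv g p * 1) (fun x hx => ?_) (fun x hx => ?_)
        (by simp [hsp.le]) (sphere_subset_closedBall hζ)
      · have h1 := (hg.differentiableAt (isOpen_ball.mem_nhds (hball (hcb hx)))).hasDerivAt
        exact (h1.sub ((hasDerivAt_id x).const_mul (deriv g p))).hasDerivWithinAt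
      · rw [mul_one]
        refine (hlip x (hcb hx)).trans ?_
        have : ‖x - p‖ ≤ s := by simpa [dist_eq_norm] using hx
        gcongr
    have e : g ζ - g p = ((g ζ - deriv g p * ζ) - (g p - deriv g p * p)) + deriv g p * (ζ - p) := by ring
    have h5 : ‖deriv g p * (ζ - p)‖ = A * s := by rw [norm_mul, hζs]
    have h6 : A * s - (3 * A / t * s) * s ≤ ‖g ζ - g p‖ := by
      rw [hζs] at hmv
      have := norm_sub_le (g ζ - g p) ((g ζ - deriv g p * ζ) - (g p - deriv g p * p))
      rw [show g ζ - g p - ((g ζ - deriv g p * ζ) - (g p - deriv g p * p)) = deriv g p * (ζ - p) by ring, h5] at this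
      linarith
    refine le_trans (le_of_eq ?_) h6
    rw [hs]; field_simp; norm_num
  have hdc : DiffContOnCl ℂ g (ball p s) := by
    refine DifferentiableOn.diffContOnCl ?_
    rw [closure_ball p hsp.ne']
    exact hg.mono (hcb.trans hball)
  have hpb : p ∈ ball (0:ℂ) 1 := hball (mem_ball_self htp)
  have hfreq : ∃ᶠ z in 𝓝 p, g z ≠ g p := by
    intro hev
    simp only [ne_eq, not_not] at hev
    have : deriv g p = 0 := by
      have h1 : g =ᶠ[𝓝 p] fun _ => g p := hev
      rw [h1.deriv_eq]; simp
    rw [hA, this] at hd; simp at hd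
  have himg := hdc.ball_subset_image_closedBall hsp hlow hfreq
  obtain ⟨ζ, hζ, hno'⟩ := hno (g p)
  have hRle : R ≤ A * t / 12 / 2 := by rw [ht]; linarith
  obtain ⟨y, hy, hye⟩ := himg (ball_subset_ball hRle hζ)
  exact hno' y (hball (hcb hy)) hye

/-- Schottky -/
theorem schottky (z0 : ℂ) : ∃ M : ℝ, ∀ F : ℂ → ℂ, DifferentiableOn ℂ F (ball 0 1) →
    (∀ z ∈ ball (0:ℂ) 1, F z ≠ 0 ∧ F z ≠ 1) → F 0 = z0 →
    ∀ z : ℂ, ‖z‖ ≤ 1/2 → ‖F z‖ ≤ M := by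
  have hpi : (Real.pi : ℂ) ≠ 0 := by exact_mod_cast Real.pi_ne_zero
  obtain ⟨w0, hw0⟩ := Complex.cos_surjective (2 * z0 - 1)
  obtain ⟨w1, hw1⟩ := Complex.cos_surjective (w0 / Real.pi)
  set Q : ℂ → ℂ := fun g => (1 + cos (Real.pi * cos (Real.pi * g))) / 2 with hQ
  have hQc : Continuous Q := by fun_prop
  obtain ⟨M, hM⟩ := (isCompact_closedBall (w1 / Real.pi) 400).exists_bound_of_continuousOn hQc.continuousOn
  refine ⟨M, fun F hF hF01 hF0 z hz => ?_⟩
  obtain ⟨H, hH, hH0, hHe⟩ := hol_arccos (h := fun z => 2 * F z - 1)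
    ((hF.const_mul 2).sub_const 1) (fun z hz => ⟨fun h => (hF01 z hz).2 (by linear_combination h / 2),
      fun h => (hF01 z hz).1 (by linear_combination h / 2)⟩) (w0 := w0) (by rw [hw0, hF0])
  have hHint : ∀ z ∈ ball (0:ℂ) 1, ∀ n : ℤ, H z / Real.pi ≠ n := by
    intro z hz n hn
    have h1 : H z = 0 + n * Real.pi := by rw [← hn]; field_simp; simp
    have h2 := hHe z hz
    rw [h1, cos_add_int_pi, Complex.cos_zero] at h2
    rcases Int.even_or_odd n with hk | hk
    · rw [hk.neg_one_zpow] at h2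
      exact (hF01 z hz).2 (by linear_combination -h2 / 2)
    · rw [hk.neg_one_zpow] at h2
      exact (hF01 z hz).1 (by linear_combination -h2 / 2)
  obtain ⟨K, hK, hK0, hKe⟩ := hol_arccos (h := fun z => H z / Real.pi)
    (hH.div_const _) (fun z hz => ⟨by simpa using hHint z hz 1, by simpa using hHint z hz (-1)⟩)
    (w0 := w1) (by rw [hw1, hH0])
  set g : ℂ → ℂ := fun z => K z / Real.pi with hg
  have hgd : DifferentiableOn ℂ g (ball 0 1) := hK.div_const _
  have hgK : ∀ z, Real.pi * g z = K z := fun z => by rw [hg]; field_simp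
  have hno : ∀ w : ℂ, ∃ ζ ∈ ball w 2, ∀ z ∈ ball (0:ℂ) 1, g z ≠ ζ := by
    intro w
    obtain ⟨ζ, hζ, n, hn⟩ := net_point w
    refine ⟨ζ, hζ, fun z hz he => ?_⟩
    rw [← he, hgK, hKe z hz] at hn
    exact hHint z hz n hn
  have hFQ : ∀ z ∈ ball (0:ℂ) 1, F z = Q (g z) := by
    intro z hz
    simp only [hQ]
    rw [hgK, hKe z hz, mul_div_cancel₀ _ hpi, hHe z hz]; ring
  have hz1 : z ∈ ball (0:ℂ) 1 := by rw [mem_ball_zero_iff]; linarith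
  rw [hFQ z hz1]
  apply hM
  rw [mem_closedBall, dist_eq_norm]
  have hg0 : g 0 = w1 / Real.pi := by simp only [hg, hK0]
  rw [← hg0]
  have hder : ∀ ζ ∈ closedBall (0:ℂ) (1/2), ‖deriv g ζ‖ ≤ 400 := by
    intro ζ hζ
    have hζ' : ‖ζ‖ ≤ 1/2 := by simpa using hζ
    have := bloch hgd two_pos hno (z := ζ) (r := 3/4) (by norm_num) (by linarith)
    nlinarith [norm_nonneg (deriv g ζ)]
  have := (convex_closedBall (0:ℂ) (1/2)).norm_image_sub_le_of_norm_hasDerivWithin_le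
    (f := g) (f' := deriv g) (C := 400) (fun x hx => (hgd.differentiableAt (isOpen_ball.mem_nhds
      (closedBall_subset_ball (by norm_num) hx))).hasDerivAt.hasDerivWithinAt) hder
    (mem_closedBall_self (by norm_num)) (y := z) (by simpa using hz)
  refine this.trans ?_
  rw [sub_zero]; linarith


/-- Path lifting through a local homeomorphism, given that partial lifts have cluster points. -/
theorem path_lift_gen {E : Type*} [TopologicalSpace E] [T2Space E] {p : E → ℂ}
    (hp : IsLocalHomeomorph p) {w : ℝ → ℂ} (hw : Continuous w) (e0 : E) (he0 : p e0 = w 0)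
    (hcl : ∀ s : ℝ, 0 < s → s ≤ 1 → ∀ γ : ℝ → E, ContinuousOn γ (Ico 0 s) →
      (∀ t ∈ Ico 0 s, p (γ t) = w t) → ∃ e, MapClusterPt e (𝓝[<] s) γ) :
    ∃ γ : ℝ → E, ContinuousOn γ (Icc 0 1) ∧ γ 0 = e0 ∧ ∀ t ∈ Icc (0:ℝ) 1, p (γ t) = w t := by
  set S : Set ℝ := {s | s ∈ Icc (0:ℝ) 1 ∧ ∃ γ : ℝ → E, ContinuousOn γ (Icc 0 s) ∧ γ 0 = e0 ∧
    ∀ t ∈ Icc (0:ℝ) s, p (γ t) = w t} with hS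
  -- extension
  have hext : ∀ s ∈ S, ∀ e : E, ∀ φ : OpenPartialHomeomorph E ℂ, p = φ → 
      ∀ δ > 0, ∀ c, (∀ t, |t - c| < δ → w t ∈ φ.target) → |s - c| < δ →
      (∀ γ : ℝ → E, ContinuousOn γ (Icc 0 s) → γ 0 = e0 → (∀ t ∈ Icc (0:ℝ) s, p (γ t) = w t) →
        γ s = φ.symm (w s)) → 
      ∀ s', s ≤ s' → s' ≤ 1 → s' < c + δ → s' ∈ S := by
    rintro s ⟨hs01, γ, hγ, hγ0, hγp⟩ e φ hφ δ hδ c hc hsc hend s' hss' hs'1 hs'c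
    have hγs := hend γ hγ hγ0 hγp
    refine ⟨⟨hs01.1.trans hss', hs'1⟩, fun t => if t ≤ s then γ t else φ.symm (w t), ?_, ?_, ?_⟩
    · have hcover : Icc (0:ℝ) s' = Icc 0 s ∪ Icc s s' := (Icc_union_Icc_eq_Icc hs01.1 hss').symm
      rw [hcover]
      refine ContinuousOn.union_of_isClosed ?_ ?_ isClosed_Icc isClosed_Icc
      · refine hγ.congr fun t ht => ?_
        simp [ht.2]
      · have h1 : ContinuousOn (fun t => φ.symm (w t)) (Icc s s') := by
          refine φ.continuousOn_symm.comp hw.continuousOn ?_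
          intro t ht
          apply hc
          rw [abs_lt] at hsc ⊢
          constructor <;> linarith [ht.1, ht.2]
        refine h1.congr fun t ht => ?_
        rcases eq_or_lt_of_le ht.1 with h | h
        · subst h; simp [hγs]
        · simp [not_le.2 h]
    · simp [hs01.1, hγ0]
    · intro t ht
      by_cases h : t ≤ s
      · simp only [h, if_true]; exact hγp t ⟨ht.1, h⟩
      · simp only [h, if_false]
        rw [hφ]
        apply φ.right_inv
        apply hc
        rw [abs_lt] at hsc ⊢
        push Not at h
        constructor <;> linarith [ht.1, ht.2]
  have hnear : ∀ s e, p e = w s → ∃ φ : OpenPartialHomeomorph E ℂ, e ∈ φ.source ∧ p = φ ∧ 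
      ∃ δ > 0, (∀ t, |t - s| < δ → w t ∈ φ.target) := by
    intro s e hes
    obtain ⟨φ, h1, h2⟩ := hp e
    refine ⟨φ, h1, h2, ?_⟩
    have : w ⁻¹' φ.target ∈ 𝓝 s := hw.continuousAt.preimage_mem_nhds
      (φ.open_target.mem_nhds (by rw [← hes, h2]; exact φ.map_source h1))
    obtain ⟨δ, hδ, hb⟩ := Metric.mem_nhds_iff.1 this
    exact ⟨δ, hδ, fun t ht => hb (by simpa [Real.dist_eq] using ht)⟩
  have h0S : (0:ℝ) ∈ S := ⟨by simp, fun _ => e0, continuousOn_const, rfl, fun t ht => by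
    have : t = 0 := le_antisymm ht.2 ht.1
    rw [this]; exact he0⟩
  have hbdd : BddAbove S := ⟨1, fun s hs => hs.1.2⟩
  have hdown : ∀ s ∈ S, ∀ s', 0 ≤ s' → s' ≤ s → s' ∈ S := by
    rintro s ⟨h1, γ, h2, h3, h4⟩ s' h0 hs'
    exact ⟨⟨h0, hs'.trans h1.2⟩, γ, h2.mono (Icc_subset_Icc_right hs'), h3,
      fun t ht => h4 t ⟨ht.1, ht.2.trans hs'⟩⟩
  set σ := sSup S with hσ
  have hσ0 : 0 ≤ σ := le_csSup hbdd h0S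
  have hσ1 : σ ≤ 1 := csSup_le ⟨0, h0S⟩ fun s hs => hs.1.2
  -- uniqueness
  have huniq : ∀ s, 0 ≤ s → ∀ γ₁ γ₂ : ℝ → E, ContinuousOn γ₁ (Icc 0 s) → ContinuousOn γ₂ (Icc 0 s) →
      γ₁ 0 = e0 → γ₂ 0 = e0 → (∀ t ∈ Icc (0:ℝ) s, p (γ₁ t) = w t) → 
      (∀ t ∈ Icc (0:ℝ) s, p (γ₂ t) = w t) → EqOn γ₁ γ₂ (Icc 0 s) := by
    intro s hs γ₁ γ₂ h1 h2 h3 h4 h5 h6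
    exact (T2Space.isSeparatedMap p).eqOn_of_comp_eqOn hp.isLocallyInjective isPreconnected_Icc h1 h2
      (fun t ht => by simp [h5 t ht, h6 t ht]) (left_mem_Icc.2 hs) (h3.trans h4.symm)
  have hfin : ∃ δ > 0, ∀ s', 0 ≤ s' → s' ≤ 1 → s' < σ + δ → s' ∈ S := by
    rcases eq_or_lt_of_le hσ0 with h | hσpos
    · obtain ⟨φ, h1, h2, δ, hδ, h3⟩ := hnear 0 e0 he0
      refine ⟨δ, hδ, fun s' hs0 hs1 hs' => ?_⟩
      refine hext 0 h0S e0 φ h2 δ hδ 0 h3 (by simpa) ?_ s' hs0 hs1 (by rw [h]; exact hs')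
      intro γ _ hγ0 _
      rw [hγ0, ← he0, h2, φ.left_inv h1]
    · have hlt : ∀ s, 0 ≤ s → s < σ → s ∈ S := by
        intro s h0 hs
        obtain ⟨s1, h1, h2⟩ := exists_lt_of_lt_csSup ⟨0, h0S⟩ hs
        exact hdown s1 h1 s h0 h2.le
      have hex : ∀ s : ℝ, ∃ γ : ℝ → E, 0 ≤ s → s < σ → ContinuousOn γ (Icc 0 s) ∧ γ 0 = e0 ∧
          ∀ t ∈ Icc (0:ℝ) s, p (γ t) = w t := by
        intro s
        by_cases h : 0 ≤ s ∧ s < σ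
        · obtain ⟨_, γ, hγ⟩ := hlt s h.1 h.2
          exact ⟨γ, fun _ _ => hγ⟩
        · exact ⟨fun _ => e0, fun h1 h2 => absurd ⟨h1, h2⟩ h⟩
      choose G hG using hex
      set Γ : ℝ → E := fun t => G t t with hΓ
      have hΓeq : ∀ s, 0 ≤ s → s < σ → EqOn Γ (G s) (Icc 0 s) := by
        intro s h0 hs t ht
        have a := hG s h0 hs
        have b := hG t ht.1 (ht.2.trans_lt hs)
        exact huniq t ht.1 _ _ b.1 (a.1.mono (Icc_subset_Icc_right ht.2)) b.2.1 a.2.1 b.2.2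
          (fun u hu => a.2.2 u ⟨hu.1, hu.2.trans ht.2⟩) (right_mem_Icc.2 ht.1)
      have hΓc : ContinuousOn Γ (Ico 0 σ) := by
        intro t ht
        obtain ⟨s, hts, hsσ⟩ := exists_between ht.2
        have h0s := ht.1.trans hts.le
        have h1 : ContinuousWithinAt Γ (Icc 0 s) t :=
          ((hG s h0s hsσ).1.congr (hΓeq s h0s hsσ)) t ⟨ht.1, hts.le⟩
        refine h1.mono_of_mem_nhdsWithin ?_
        filter_upwards [self_mem_nhdsWithin, mem_nhdsWithin_of_mem_nhds (Iio_mem_nhds hts)] with u hu1 hu2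
        exact ⟨hu1.1, le_of_lt hu2⟩
      have hΓp : ∀ t ∈ Ico 0 σ, p (Γ t) = w t := fun t ht =>
        (hG t ht.1 ht.2).2.2 t (right_mem_Icc.2 ht.1)
      obtain ⟨e, he⟩ := hcl σ hσpos hσ1 Γ hΓc hΓp
      have hev : ∀ᶠ t in 𝓝[<] σ, t ∈ Ico 0 σ := by
        filter_upwards [self_mem_nhdsWithin, mem_nhdsWithin_of_mem_nhds (Ioi_mem_nhds hσpos)] with t h1 h2
        exact ⟨le_of_lt h2, h1⟩
      have hpe : p e = w σ := by
        have h1 : MapClusterPt (p e) (𝓝[<] σ) (p ∘ Γ) := he.continuousAt_comp hp.continuous.continuousAt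
        have h2 : Tendsto (p ∘ Γ) (𝓝[<] σ) (𝓝 (w σ)) := by
          refine (hw.continuousAt.tendsto.mono_left nhdsWithin_le_nhds).congr' ?_
          filter_upwards [hev] with t ht
          exact (hΓp t ht).symm
        have h3 : (𝓝 (p e) ⊓ 𝓝 (w σ)).NeBot := by
          refine NeBot.mono h1 ?_
          exact inf_le_inf_left _ h2
        exact eq_of_nhds_neBot h3
      obtain ⟨φ, h1, h2, δ, hδ, h3⟩ := hnear σ e hpe
      have hfr : ∃ᶠ t in 𝓝[<] σ, Γ t ∈ φ.source :=
        mapClusterPt_iff_frequently.1 he _ (φ.open_source.mem_nhds h1)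
      have hev2 : ∀ᶠ t in 𝓝[<] σ, |t - σ| < δ := by
        refine mem_nhdsWithin_of_mem_nhds ?_
        have := Metric.ball_mem_nhds σ hδ
        filter_upwards [this] with t ht
        simpa [Real.dist_eq] using ht
      obtain ⟨t, htφ, ht, htδ⟩ := (hfr.and_eventually (hev.and hev2)).exists
      refine ⟨δ, hδ, fun s' hs0 hs1 hs' => ?_⟩
      rcases le_total s' t with hst | hst
      · exact hlt s' hs0 (hst.trans_lt ht.2)
      refine hext t (hlt t ht.1 ht.2) e φ h2 δ hδ σ h3 htδ ?_ s' hst hs1 hs'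
      intro γ hγ hγ0 hγp
      have hb := hG t ht.1 ht.2
      have : γ t = Γ t := huniq t ht.1 _ _ hγ hb.1 hγ0 hb.2.1 hγp hb.2.2 (right_mem_Icc.2 ht.1)
      rw [this, ← hΓp t ht, h2, φ.left_inv htφ]
  obtain ⟨δ, hδ, hfin⟩ := hfin
  have hσS : 1 ∈ S := by
    by_contra h1
    have hσlt : σ + δ ≤ 1 := by
      by_contra h
      push Not at h
      exact h1 (hfin 1 zero_le_one le_rfl h)
    have := le_csSup hbdd (hfin (σ + δ/2) (by linarith) (by linarith) (by linarith))
    rw [← hσ] at this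
    linarith
  exact hσS.2

section
variable {D : Set ℂ} {f : ℂ → ℂ}

theorem hol_lift (hDopen : IsOpen D) (hf : DifferentiableOn ℂ f D)
    (hasymp : ∀ γ : ℝ → ℂ, ContinuousOn γ (Set.Ico 0 1) →
      (∀ t ∈ Set.Ico (0 : ℝ) 1, γ t ∈ D) →
      (∀ K : Set ℂ, IsCompact K → K ⊆ D → ∀ᶠ t in nhdsWithin 1 (Set.Iio 1), γ t ∉ K) →
      ∀ v : ℂ, Filter.Tendsto (fun t => f (γ t)) (nhdsWithin 1 (Set.Iio 1)) (nhds v) → v = 0)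
    (hcrit : ∀ z ∈ D, deriv f z = 0 → f z = 0 ∨ f z = 1)
    {w : ℂ → ℂ} (hw : DifferentiableOn ℂ w (ball 0 1))
    (hw01 : ∀ z ∈ ball (0:ℂ) 1, w z ≠ 0 ∧ w z ≠ 1) {x : ℂ} (hx : x ∈ D) (hfx : f x = w 0) :
    ∃ u : ℂ → ℂ, DifferentiableOn ℂ u (ball 0 1) ∧ u 0 = x ∧
      ∀ z ∈ ball (0:ℂ) 1, u z ∈ D ∧ f (u z) = w z := by
  set U : Set ℂ := {z | z ∈ D ∧ f z ≠ 0 ∧ f z ≠ 1} with hU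
  have hstrict : ∀ z ∈ D, HasStrictDerivAt f (deriv f z) z := fun z hz =>
    (hf.analyticAt (hDopen.mem_nhds hz)).hasStrictDerivAt
  have hUd : ∀ z ∈ U, deriv f z ≠ 0 := by
    rintro z ⟨h1, h2, h3⟩ h
    rcases hcrit z h1 h with h | h
    · exact h2 h
    · exact h3 h
  have hUo : IsOpen U := by
    have : U = D ∩ f ⁻¹' ({0}ᶜ ∩ {1}ᶜ) := by
      ext z; simp only [hU, mem_ofPred_eq, mem_inter_iff, mem_preimage, mem_compl_iff, mem_singleton_iff, ne_eq]
    rw [this]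
    exact hf.continuousOn.isOpen_inter_preimage hDopen
      (isClosed_singleton.isOpen_compl.inter isClosed_singleton.isOpen_compl)
  set p : U → ℂ := fun z => f z with hp
  have hloc : IsLocalHomeomorph p := by
    rw [isLocalHomeomorph_iff_isLocalHomeomorphOn_univ]
    have h1 : IsLocalHomeomorphOn f U := by
      intro z hz
      exact ⟨((hstrict z hz.1).hasStrictFDerivAt_equiv (hUd z hz)).toOpenPartialHomeomorph f,
        HasStrictFDerivAt.mem_toOpenPartialHomeomorph_source _, rfl⟩
    have h2 : IsLocalHomeomorph (Subtype.val : U → ℂ) :=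
      hUo.isOpenEmbedding_subtypeVal.isLocalHomeomorph
    exact h1.comp (isLocalHomeomorph_iff_isLocalHomeomorphOn_univ.1 h2) (fun z _ => z.2)
  have h0 : (0:ℂ) ∈ ball (0:ℂ) 1 := by simp
  have hxU : x ∈ U := ⟨hx, by rw [hfx]; exact (hw01 0 h0).1, by rw [hfx]; exact (hw01 0 h0).2⟩
  have hcl : ∀ W : ℝ → ℂ, Continuous W → (∀ t, W t ≠ 0 ∧ W t ≠ 1) →
      ∀ s : ℝ, 0 < s → s ≤ 1 → ∀ γ : ℝ → U, ContinuousOn γ (Ico 0 s) →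
      (∀ t ∈ Ico 0 s, p (γ t) = W t) → ∃ e, MapClusterPt e (𝓝[<] s) γ := by
    intro W hW hW01 s hs hs1 γ hγ hγW
    have hev : ∀ᶠ t in 𝓝[<] s, t ∈ Ico 0 s := by
      filter_upwards [self_mem_nhdsWithin, mem_nhdsWithin_of_mem_nhds (Ioi_mem_nhds hs)] with t h1 h2
      exact ⟨le_of_lt h2, h1⟩
    have hlim : Tendsto (fun t => f (γ t)) (𝓝[<] s) (𝓝 (W s)) := by
      refine (hW.continuousAt.tendsto.mono_left nhdsWithin_le_nhds).congr' ?_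
      filter_upwards [hev] with t ht
      exact (hγW t ht).symm
    by_contra hno
    have hmulT : Tendsto (fun t : ℝ => s * t) (𝓝[<] 1) (𝓝[<] s) := by
      refine tendsto_nhdsWithin_iff.2 ⟨?_, ?_⟩
      · have : Tendsto (fun t : ℝ => s * t) (𝓝 1) (𝓝 (s * 1)) := (continuous_const.mul continuous_id).continuousAt
        rw [mul_one] at this
        exact this.mono_left nhdsWithin_le_nhds
      · filter_upwards [self_mem_nhdsWithin] with t ht
        have : t < 1 := ht
        simp only [mem_Iio]; nlinarith
    refine (hW01 s).1 (hasymp (fun t => (γ (s * t) : ℂ)) ?_ (fun t ht => (γ (s*t)).2.1) ?_ (W s) (hlim.comp hmulT))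
    · refine continuous_subtype_val.comp_continuousOn (hγ.comp (by fun_prop) ?_)
      intro t ht
      exact ⟨mul_nonneg hs.le ht.1, by nlinarith [ht.2]⟩
    · intro K hK hKD
      by_contra hfr
      have hfr' : ∃ᶠ t in 𝓝[<] s, (γ t : ℂ) ∈ K := by
        have : ∃ᶠ t in 𝓝[<] (1:ℝ), (γ (s * t) : ℂ) ∈ K := hfr
        exact hmulT.frequently this
      obtain ⟨z, hzK, hz⟩ := hK.exists_mapClusterPt_of_frequently hfr'
      have hfz : f z = W s := by
        have h1 : MapClusterPt (f z) (𝓝[<] s) (f ∘ fun t => (γ t : ℂ)) :=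
          hz.continuousAt_comp (hf.continuousOn.continuousAt (hDopen.mem_nhds (hKD hzK)))
        have h3 : (𝓝 (f z) ⊓ 𝓝 (W s)).NeBot := NeBot.mono h1 (inf_le_inf_left _ hlim)
        exact eq_of_nhds_neBot h3
      have hzU : z ∈ U := ⟨hKD hzK, by rw [hfz]; exact (hW01 s).1, by rw [hfz]; exact (hW01 s).2⟩
      refine hno ⟨⟨z, hzU⟩, ?_⟩
      rw [mapClusterPt_iff_frequently] at hz ⊢
      intro N hN
      rw [nhds_subtype, mem_comap] at hN
      obtain ⟨V, hV, hVN⟩ := hN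
      exact (hz V hV).mono fun t ht => hVN ht
  -- radial paths
  have hin : ∀ z ∈ ball (0:ℂ) 1, ∀ t : unitInterval, ((t:ℝ):ℂ) * z ∈ ball (0:ℂ) 1 := by
    intro z hz t
    rw [mem_ball_zero_iff] at hz ⊢
    rw [norm_mul, Complex.norm_real, Real.norm_eq_abs, abs_of_nonneg t.2.1]
    have := t.2.2
    nlinarith [norm_nonneg z, t.2.1]
  have hpath : ∀ z : ball (0:ℂ) 1, ∃ Γ : unitInterval → U, Continuous Γ ∧ Γ 0 = ⟨x, hxU⟩ ∧
      ∀ t, p (Γ t) = w ((t:ℝ) * z) := by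
    intro z
    have hWc : Continuous (fun t : ℝ => w ((projIcc (0:ℝ) 1 zero_le_one t : ℝ) * z)) := by
      refine hw.continuousOn.comp_continuous ?_ (fun t => hin z z.2 _)
      have : Continuous (projIcc (0:ℝ) 1 zero_le_one) := continuous_projIcc
      fun_prop
    obtain ⟨γ, h1, h2, h3⟩ := path_lift_gen hloc hWc ⟨x, hxU⟩ (by
      simp [hp, hfx]) (hcl _ hWc (fun t => hw01 _ (hin z z.2 _)))
    refine ⟨fun t => γ t, h1.comp_continuous continuous_subtype_val (fun t => t.2), by simpa using h2, ?_⟩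
    intro t
    have := h3 t t.2
    rw [this, projIcc_of_mem zero_le_one t.2]
  choose Γ hΓc hΓ0 hΓp using hpath
  have hcont := hloc.continuous_lift (T2Space.isSeparatedMap p)
    (A := ball (0:ℂ) 1)
    (f := ⟨fun a : unitInterval × ball (0:ℂ) 1 => w ((a.1:ℝ) * a.2), by
      refine hw.continuousOn.comp_continuous (by fun_prop) (fun a => hin a.2 a.2.2 _)⟩)
    (g := fun a => Γ a.2 a.1) (by ext a; exact hΓp _ _) (by simp only [hΓ0]; exact continuous_const)
    hΓc
  have hV : Continuous (fun z : ball (0:ℂ) 1 => Γ z 1) :=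
    hcont.comp (f := fun z : ball (0:ℂ) 1 => ((1:unitInterval), z)) (by fun_prop)
  classical
  set u : ℂ → ℂ := fun z => if hz : z ∈ ball (0:ℂ) 1 then (Γ ⟨z, hz⟩ 1 : ℂ) else 0 with hu
  have huc : ContinuousOn u (ball 0 1) := by
    rw [continuousOn_iff_continuous_domRestrict]
    have : (ball (0:ℂ) 1).domRestrict u = fun z => (Γ z 1 : ℂ) := by
      ext z
      have hz := z.2
      simp only [hu, domRestrict_apply, hz, dite_true]
    rw [this]
    exact continuous_subtype_val.comp hV
  have hup : ∀ z ∈ ball (0:ℂ) 1, u z ∈ U ∧ f (u z) = w z := by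
    intro z hz
    have h1 : u z = (Γ ⟨z, hz⟩ 1 : ℂ) := by simp only [hu, hz, dite_true]
    rw [h1]
    refine ⟨(Γ ⟨z, hz⟩ 1).2, ?_⟩
    have := hΓp ⟨z, hz⟩ 1
    simpa [hp] using this
  refine ⟨u, ?_, ?_, fun z hz => ⟨(hup z hz).1.1, (hup z hz).2⟩⟩
  · intro z hz
    have hs := (hstrict _ (hup z hz).1.1)
    have hne := hUd _ (hup z hz).1
    have hca : ContinuousAt u z := huc.continuousAt (isOpen_ball.mem_nhds hz)
    have hinv := hs.to_localInverse hne
    have hev := (hs.hasStrictFDerivAt_equiv hne).eventually_left_inverse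
    have hev2 : ∀ᶠ y in 𝓝 z, hs.localInverse f _ _ hne (w y) = u y := by
      filter_upwards [hca.eventually hev, isOpen_ball.mem_nhds hz] with y hy hyb
      rw [← (hup y hyb).2]; exact hy
    have hwd := hw.differentiableAt (isOpen_ball.mem_nhds hz)
    rw [(hup z hz).2] at hinv
    have hcomp : DifferentiableAt ℂ (fun y => hs.localInverse f _ _ hne (w y)) z :=
      DifferentiableAt.comp z hinv.hasDerivAt.differentiableAt hwd
    exact (hcomp.congr_of_eventuallyEq (hev2.mono fun y hy => hy.symm)).differentiableWithinAt
  · have h1 : u 0 = (Γ ⟨0, h0⟩ 1 : ℂ) := by simp only [hu, h0, dite_true]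
    rw [h1]
    have : Γ ⟨0, h0⟩ = fun _ => ⟨x, hxU⟩ := by
      refine (T2Space.isSeparatedMap p).eq_of_comp_eq hloc.isLocallyInjective (hΓc _) continuous_const ?_ 0 (hΓ0 _)
      ext t
      have := hΓp ⟨0, h0⟩ t
      rw [mul_zero] at this
      exact this.trans hfx.symm
    rw [this]
end


theorem limit_div_deriv {f u v : ℂ → ℂ} {y d s : ℂ} {m : ℕ} (hf : HasStrictDerivAt f d y)
    (hd : d ≠ 0) (hu : ContinuousAt u 0) (hv : ContinuousAt v 0) (hu0 : u 0 = y) (hv0 : v 0 = y)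
    (hlim : Tendsto (fun t => (f (u t) - f (v t)) / t ^ m) (𝓝[≠] 0) (𝓝 s)) :
    Tendsto (fun t => (u t - v t) / t ^ m) (𝓝[≠] 0) (𝓝 (s / d)) := by
  -- local inverse
  have hinv := hf.to_localInverse hd
  set φ := hf.localInverse f d y hd with hφ
  have hev := (hf.hasStrictFDerivAt_equiv hd).eventually_left_inverse
  have e1 : ∀ᶠ t in 𝓝 (0:ℂ), φ (f (u t)) = u t := by
    have := hu.tendsto; rw [hu0] at this
    exact this.eventually hev
  have e2 : ∀ᶠ t in 𝓝 (0:ℂ), φ (f (v t)) = v t := by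
    have := hv.tendsto; rw [hv0] at this
    exact this.eventually hev
  have hfc : ContinuousAt f y := hf.hasDerivAt.continuousAt
  have tu : Tendsto (fun t => f (u t)) (𝓝[≠] 0) (𝓝 (f y)) := by
    have := hu.tendsto; rw [hu0] at this
    exact (hfc.tendsto.comp this).mono_left nhdsWithin_le_nhds
  have tv : Tendsto (fun t => f (v t)) (𝓝[≠] 0) (𝓝 (f y)) := by
    have := hv.tendsto; rw [hv0] at this
    exact (hfc.tendsto.comp this).mono_left nhdsWithin_le_nhds
  have hlo := hinv.isLittleO.comp_tendsto (tu.prodMk_nhds tv)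
  have hO : (fun t => f (u t) - f (v t)) =O[𝓝[≠] 0] (fun t : ℂ => t ^ m) := by
    refine Asymptotics.isBigO_of_div_tendsto_nhds ?_ s hlim
    filter_upwards [self_mem_nhdsWithin] with t ht h0
    exact absurd h0 (pow_ne_zero _ ht)
  have hlo2 := hlo.trans_isBigO hO
  have h1 := hlo2.tendsto_div_nhds_zero
  have h2 := h1.add (hlim.const_mul d⁻¹)
  rw [zero_add, show d⁻¹ * s = s / d by rw [div_eq_mul_inv, mul_comm]] at h2
  refine h2.congr' ?_
  filter_upwards [nhdsWithin_le_nhds e1, nhdsWithin_le_nhds e2] with t h1 h2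
  simp only [Function.comp_apply]
  rw [h1, h2]
  simp
  ring

theorem limit_bound {h : ℂ → ℂ} {B : ℝ} {m : ℕ} {s : ℂ} (hh : DifferentiableOn ℂ h (ball 0 1))
    (hB : ∀ t : ℂ, ‖t‖ ≤ 1/2 → ‖h t‖ ≤ B)
    (hlim : Tendsto (fun t => h t / t ^ m) (𝓝[≠] 0) (𝓝 s)) : ‖s‖ ≤ B * 2 ^ m := by
  classical
  set k : ℂ → ℂ := Function.update (fun t => h t / t ^ m) 0 s with hk
  have hkc : ContinuousAt k 0 := continuousAt_update_same.2 hlim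
  have hkne : ∀ t, t ≠ 0 → k t = h t / t ^ m := fun t ht => by simp [hk, ht]
  have hkd : ∀ t ∈ ball (0:ℂ) 1, t ≠ 0 → DifferentiableAt ℂ k t := by
    intro t ht ht0
    have h1 : DifferentiableAt ℂ (fun t => h t / t ^ m) t :=
      (hh.differentiableAt (isOpen_ball.mem_nhds ht)).div (by fun_prop) (pow_ne_zero _ ht0)
    refine h1.congr_of_eventuallyEq ?_
    filter_upwards [isOpen_ne.mem_nhds ht0] with u hu
    exact hkne u hu
  have hk0 : DifferentiableAt ℂ k 0 := by
    refine (Complex.analyticAt_of_differentiable_on_punctured_nhds_of_continuousAt ?_ hkc).differentiableAt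
    filter_upwards [self_mem_nhdsWithin, nhdsWithin_le_nhds (ball_mem_nhds (0:ℂ) one_pos)] with t h1 h2
    exact hkd t h2 h1
  have hkD : DifferentiableOn ℂ k (closure (ball 0 (1/2))) := by
    intro t ht
    have ht' : t ∈ ball (0:ℂ) 1 := closedBall_subset_ball (by norm_num) (closure_ball_subset_closedBall ht)
    by_cases h : t = 0
    · subst h; exact hk0.differentiableWithinAt
    · exact (hkd t ht' h).differentiableWithinAt
  have := Complex.norm_le_of_forall_mem_frontier_norm_le (C := B * 2 ^ m) (isBounded_ball (x := (0:ℂ)) (r := 1/2))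
    hkD.diffContOnCl (fun t ht => ?_) (subset_closure (mem_ball_self (by norm_num)) : (0:ℂ) ∈ _)
  · simpa [hk] using this
  · rw [frontier_ball _ (by norm_num), mem_sphere_zero_iff_norm] at ht
    have ht0 : t ≠ 0 := by rintro rfl; norm_num at ht
    rw [hkne t ht0, norm_div, norm_pow, ht, div_le_iff₀ (by positivity), mul_assoc, ← mul_pow]
    norm_num
    exact hB t ht.le

structure IsMot (N : ℕ) (c : ℂ) (y : ℕ → ℂ) (z : ℕ → ℂ → ℂ) : Prop where
  diff : ∀ j ≤ N, DifferentiableOn ℂ (z j) (ball 0 1)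
  base : ∀ j ≤ N, z j 0 = y j
  ne0 : ∀ j ≤ N, ∀ t ∈ ball (0:ℂ) 1, z j t ≠ 0
  inj : ∀ t ∈ ball (0:ℂ) 1, ∀ i ≤ N, ∀ j ≤ N, z i t = z j t → i = j
  last : ∀ t ∈ ball (0:ℂ) 1, z N t = c

theorem core {D : Set ℂ} {f : ℂ → ℂ} (hDopen : IsOpen D) (hf : DifferentiableOn ℂ f D)
    (hlift : ∀ w : ℂ → ℂ, DifferentiableOn ℂ w (ball 0 1) → (∀ z ∈ ball (0:ℂ) 1, w z ≠ 0 ∧ w z ≠ 1) →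
      ∀ x ∈ D, f x = w 0 → ∃ u : ℂ → ℂ, DifferentiableOn ℂ u (ball 0 1) ∧ u 0 = x ∧
      ∀ z ∈ ball (0:ℂ) 1, u z ∈ D ∧ f (u z) = w z)
    {c a₀ : ℂ} (hf0 : f 0 = 0) (hfc : f c = 1) {N : ℕ} {y : ℕ → ℂ} (hy0 : y 0 = a₀) (hyN : y N = c)
    (hyD : ∀ j ≤ N, y j ∈ D) (hyne : ∀ j ≤ N, y j ≠ 0)
    (hinj : ∀ i ≤ N, ∀ j ≤ N, y i = y j → i = j) (hstep : ∀ j < N, a₀ * f (y j) = y (j+1))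
    (hd : ∀ j < N, deriv f (y j) ≠ 0)
    {G : ℕ → ℂ → ℂ} (hG0 : ∀ a, G 0 a = a) (hGs : ∀ j a, G (j+1) a = a * f (G j a))
    (hG : ¬ ∀ᶠ a in 𝓝 a₀, G N a = c) {ρ : ℝ} (hρ0 : 0 < ρ) (hρ1 : ρ ≤ 1)
    (hP : ∑ k ∈ Finset.range (N+1), (ρ:ℂ) ^ k * y k / ∏ i ∈ Finset.range k, (a₀ * deriv f (y i)) = 0) :
    False := by
  have ha0 : a₀ ≠ 0 := hy0 ▸ hyne 0 (Nat.zero_le _)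
  have hc0 : c ≠ 0 := hyN ▸ hyne N le_rfl
  have hρc : (ρ:ℂ) ≠ 0 := by exact_mod_cast hρ0.ne'
  have hb0 : (0:ℂ) ∈ ball (0:ℂ) 1 := by simp
  have hN : N ≠ 0 := by
    rintro rfl
    simp at hP
    exact hyne 0 le_rfl hP
  -- lifting of motions
  have hstepM : ∀ z, IsMot N c y z → ∃ z', IsMot N c y z' ∧ ∀ j < N, ∀ t ∈ ball (0:ℂ) 1,
      f (z' j t) = z (j+1) t / z 0 t := by
    intro z hz
    have hex : ∀ j, ∃ u : ℂ → ℂ, j < N → (DifferentiableOn ℂ u (ball 0 1) ∧ u 0 = y j ∧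
        ∀ t ∈ ball (0:ℂ) 1, u t ∈ D ∧ f (u t) = z (j+1) t / z 0 t) := by
      intro j
      by_cases hj : j < N
      · obtain ⟨u, hu⟩ := hlift (fun t => z (j+1) t / z 0 t)
          ((hz.diff (j+1) hj).div (hz.diff 0 (Nat.zero_le _)) (hz.ne0 0 (Nat.zero_le _)))
          (fun t ht => ⟨div_ne_zero (hz.ne0 _ hj t ht) (hz.ne0 _ (Nat.zero_le _) t ht), fun h => by
            rw [div_eq_one_iff_eq (hz.ne0 _ (Nat.zero_le _) t ht)] at h
            have := hz.inj t ht _ hj _ (Nat.zero_le _) h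
            omega⟩) (y j) (hyD j hj.le) (by
            rw [hz.base _ hj, hz.base 0 (Nat.zero_le _), ← hstep j hj, hy0]
            field_simp)
        exact ⟨u, fun _ => hu⟩
      · exact ⟨0, fun h => absurd h hj⟩
    choose u hu using hex
    have hz' : ∀ j < N, (fun j => if j < N then u j else fun _ => c) j = u j := fun j hj => by simp [hj]
    have hzN : (fun j => if j < N then u j else fun _ => c) N = fun _ => c := by simp
    set z' : ℕ → ℂ → ℂ := fun j => if j < N then u j else fun _ => c
    have hneq0 : ∀ j < N, ∀ t ∈ ball (0:ℂ) 1, u j t ≠ 0 := by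
      intro j hj t ht h0
      have := ((hu j hj).2.2 t ht).2
      rw [h0, hf0] at this
      exact div_ne_zero (hz.ne0 _ hj t ht) (hz.ne0 _ (Nat.zero_le _) t ht) this.symm
    have hneqc : ∀ j < N, ∀ t ∈ ball (0:ℂ) 1, u j t ≠ c := by
      intro j hj t ht h0
      have := ((hu j hj).2.2 t ht).2
      rw [h0, hfc, eq_comm, div_eq_one_iff_eq (hz.ne0 _ (Nat.zero_le _) t ht)] at this
      have := hz.inj t ht _ hj _ (Nat.zero_le _) this
      omega
    refine ⟨z', ⟨?_, ?_, ?_, ?_, ?_⟩, ?_⟩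
    · intro j hj
      rcases hj.lt_or_eq with h | rfl
      · rw [hz' j h]; exact (hu j h).1
      · rw [hzN]; exact differentiableOn_const _
    · intro j hj
      rcases hj.lt_or_eq with h | rfl
      · rw [hz' j h]; exact (hu j h).2.1
      · rw [hzN, hyN]
    · intro j hj t ht
      rcases hj.lt_or_eq with h | rfl
      · rw [hz' j h]; exact hneq0 j h t ht
      · rw [hzN]; exact hc0
    · intro t ht i hi j hj hij
      rcases hi.lt_or_eq with h | h <;> rcases hj.lt_or_eq with h' | h'
      · rw [hz' i h, hz' j h'] at hij
        have h1 := ((hu i h).2.2 t ht).2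
        have h2 := ((hu j h').2.2 t ht).2
        rw [hij, h2, div_left_inj' (hz.ne0 _ (Nat.zero_le _) t ht)] at h1
        have := hz.inj t ht _ h' _ h h1
        omega
      · rw [hz' i h, h', hzN] at hij
        exact absurd hij (hneqc i h t ht)
      · rw [hz' j h', h, hzN] at hij
        exact absurd hij.symm (hneqc j h' t ht)
      · rw [h, h']
    · intro t ht; rw [hzN]
    · intro j hj t ht
      rw [hz' j hj]
      exact ((hu j hj).2.2 t ht).2
  -- orbit functions are analytic
  have hGan : ∀ j ≤ N, AnalyticAt ℂ (G j) a₀ ∧ G j a₀ = y j := by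
    intro j
    induction j with
    | zero => 
      intro _
      have : G 0 = fun a => a := funext hG0
      rw [this]
      exact ⟨analyticAt_id, hy0.symm⟩
    | succ j ih =>
      intro hj
      obtain ⟨h1, h2⟩ := ih (by omega)
      have : G (j+1) = fun a => a * f (G j a) := funext (hGs j)
      rw [this]
      refine ⟨analyticAt_id.mul (AnalyticAt.fun_comp ?_ h1), ?_⟩
      · rw [h2]; exact hf.analyticAt (hDopen.mem_nhds (hyD j (by omega)))
      · simp only [h2]; exact hstep j (by omega)
  obtain ⟨m, k, hk, hk0, hkF⟩ : ∃ (m : ℕ) (k : ℂ → ℂ), AnalyticAt ℂ k a₀ ∧ k a₀ ≠ 0 ∧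
      ∀ᶠ a in 𝓝 a₀, G N a - c = (a - a₀) ^ m • k a := by
    refine (((hGan N le_rfl).1.sub analyticAt_const).exists_eventuallyEq_pow_smul_nonzero_iff).2 ?_
    intro h
    apply hG
    filter_upwards [h] with a ha
    simpa [sub_eq_zero] using ha
  have hev1 : ∀ᶠ a in 𝓝 a₀, ∀ j ∈ Finset.range N, DifferentiableAt ℂ (G j) a ∧ G j a ≠ 0 ∧ G j a ≠ c := by
    rw [Filter.eventually_all_finset]
    intro j hj
    have hj : j < N := Finset.mem_range.1 hj
    obtain ⟨h1, h2⟩ := hGan j hj.le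
    refine (h1.eventually_analyticAt.mono fun a ha => ha.differentiableAt).and (.and ?_ ?_)
    · exact h1.continuousAt.eventually_ne (by rw [h2]; exact hyne j hj.le)
    · refine h1.continuousAt.eventually_ne (by
        rw [h2, ← hyN]; intro h
        have := hinj _ hj.le _ le_rfl h
        omega)
  have hev2 : ∀ᶠ a in 𝓝 a₀, ∀ i ∈ Finset.range N, ∀ j ∈ Finset.range N, G i a = G j a → i = j := by
    rw [Filter.eventually_all_finset]
    intro i hi
    rw [Filter.eventually_all_finset]
    intro j hj
    have hi : i < N := Finset.mem_range.1 hi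
    have hj : j < N := Finset.mem_range.1 hj
    obtain ⟨h1, h2⟩ := hGan i hi.le
    obtain ⟨h3, h4⟩ := hGan j hj.le
    by_cases hij : i = j
    · exact Eventually.of_forall fun _ _ => hij
    have hs : ∀ᶠ a in 𝓝 a₀, G i a - G j a ≠ 0 := 
      (h1.continuousAt.sub h3.continuousAt).eventually_ne (by
        rw [Pi.sub_apply, h2, h4, sub_ne_zero]
        exact fun h => hij (hinj _ hi.le _ hj.le h))
    filter_upwards [hs] with a ha h
    exact absurd (sub_eq_zero.2 h) ha
  obtain ⟨ε, hε, hball⟩ := Metric.eventually_nhds_iff_ball.1 (hev1.and hev2)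
  have hεc : (ε:ℂ) ≠ 0 := by exact_mod_cast hε.ne'
  have haff : ∀ t ∈ ball (0:ℂ) 1, a₀ + ε * t ∈ ball a₀ ε := by
    intro t ht
    rw [mem_ball_zero_iff] at ht
    rw [mem_ball, dist_eq_norm, add_sub_cancel_left, norm_mul, Complex.norm_real, Real.norm_eq_abs,
      abs_of_pos hε]
    nlinarith
  set z0 : ℕ → ℂ → ℂ := fun j t => if j < N then G j (a₀ + ε * t) else c with hz0
  have hz0lt : ∀ j < N, z0 j = fun t => G j (a₀ + ε * t) := fun j hj => by
    funext t; simp [hz0, hj]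
  have hz0N : z0 N = fun _ => c := by funext t; simp [hz0]
  have hmot0 : IsMot N c y z0 := by
    refine ⟨?_, ?_, ?_, ?_, ?_⟩
    · intro j hj
      rcases hj.lt_or_eq with h | rfl
      · rw [hz0lt j h]
        intro t ht
        have h1 := ((hball _ (haff t ht)).1 j (Finset.mem_range.2 h)).1
        exact (DifferentiableAt.comp (g := G j) (f := fun t : ℂ => a₀ + ε * t) t h1 (by fun_prop)).differentiableWithinAt
      · rw [hz0N]; exact differentiableOn_const _
    · intro j hj
      rcases hj.lt_or_eq with h | rfl
      · rw [hz0lt j h]; simp [(hGan j hj).2]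
      · rw [hz0N, hyN]
    · intro j hj t ht
      rcases hj.lt_or_eq with h | rfl
      · rw [hz0lt j h]
        exact ((hball _ (haff t ht)).1 j (Finset.mem_range.2 h)).2.1
      · rw [hz0N]; exact hc0
    · intro t ht i hi j hj hij
      have hb := hball _ (haff t ht)
      rcases hi.lt_or_eq with h | h <;> rcases hj.lt_or_eq with h' | h'
      · rw [hz0lt i h, hz0lt j h'] at hij
        exact hb.2 i (Finset.mem_range.2 h) j (Finset.mem_range.2 h') hij
      · rw [hz0lt i h, h', hz0N] at hij
        exact absurd hij (hb.1 i (Finset.mem_range.2 h)).2.2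
      · rw [hz0lt j h', h, hz0N] at hij
        exact absurd hij.symm (hb.1 j (Finset.mem_range.2 h')).2.2
      · rw [h, h']
    · intro t ht; rw [hz0N]
  -- sequence of lifts
  choose! lf hlf1 hlf2 using hstepM
  set Z : ℕ → ℕ → ℂ → ℂ := fun n => lf^[n] z0 with hZ
  have hZs : ∀ n, Z (n+1) = lf (Z n) := fun n => Function.iterate_succ_apply' lf n z0
  have hZm : ∀ n, IsMot N c y (Z n) := by
    intro n
    induction n with
    | zero => exact hmot0
    | succ n ih => rw [hZs]; exact hlf1 _ ih
  have hZf : ∀ n, ∀ j < N, ∀ t ∈ ball (0:ℂ) 1, f (Z (n+1) j t) = Z n (j+1) t / Z n 0 t := by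
    intro n j hj t ht
    rw [hZs]; exact hlf2 _ (hZm n) j hj t ht
  have hZc : ∀ n, ∀ j ≤ N, ContinuousAt (Z n j) 0 := fun n j hj =>
    ((hZm n).diff j hj).continuousOn.continuousAt (isOpen_ball.mem_nhds hb0)
  have hbev : ∀ᶠ t in 𝓝[≠] (0:ℂ), t ∈ ball (0:ℂ) 1 := nhdsWithin_le_nhds (isOpen_ball.mem_nhds hb0)
  have hZt : ∀ n, ∀ j ≤ N, Tendsto (Z n j) (𝓝[≠] 0) (𝓝 (y j)) := fun n j hj => by
    rw [← (hZm n).base j hj]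
    exact (hZc n j hj).tendsto.mono_left nhdsWithin_le_nhds
  have hstrict : ∀ j < N, HasStrictDerivAt f (deriv f (y j)) (y j) := fun j hj =>
    (hf.analyticAt (hDopen.mem_nhds (hyD j hj.le))).hasStrictDerivAt
  -- the functional
  set ℓ : ℕ → ℂ := fun j => (ρ:ℂ) ^ j / ∏ i ∈ Finset.range j, (a₀ * deriv f (y i)) with hℓ
  have hℓ0 : ℓ 0 = 1 := by simp [hℓ]
  have hℓs : ∀ j < N, ℓ j / (a₀ * deriv f (y j)) = ℓ (j+1) / ρ := by
    intro j hj
    simp only [hℓ]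
    rw [Finset.prod_range_succ, pow_succ]
    have h1 := hd j hj
    have h2 : ∏ i ∈ Finset.range j, (a₀ * deriv f (y i)) ≠ 0 := 
      Finset.prod_ne_zero_iff.2 fun i hi => mul_ne_zero ha0 (hd i ((Finset.mem_range.1 hi).trans hj))
    field_simp
  have hℓne : ∀ j ≤ N, ℓ j ≠ 0 := by
    intro j hj
    refine div_ne_zero (pow_ne_zero _ hρc) (Finset.prod_ne_zero_iff.2 fun i hi => mul_ne_zero ha0 (hd i ((Finset.mem_range.1 hi).trans_le hj)))
  have hℓy : ∑ j ∈ Finset.range N, ℓ (j+1) * y (j+1) = - a₀ := by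
    have h1 : ∑ k ∈ Finset.range (N+1), ℓ k * y k = 0 := by
      rw [← hP]
      refine Finset.sum_congr rfl fun k _ => ?_
      simp only [hℓ]; ring
    rw [Finset.sum_range_succ', hℓ0, hy0] at h1
    linear_combination h1
  have hA : ∀ η : ℕ → ℂ, η N = 0 → 
      ∑ j ∈ Finset.range N, ℓ j * ((η (j+1) / a₀ - y (j+1) * η 0 / a₀ ^ 2) / deriv f (y j)) =
      (ρ:ℂ)⁻¹ * ∑ j ∈ Finset.range N, ℓ j * η j := by
    intro η hη
    have h1 : ∀ j ∈ Finset.range N, ℓ j * ((η (j+1) / a₀ - y (j+1) * η 0 / a₀ ^ 2) / deriv f (y j)) =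
        (ρ:ℂ)⁻¹ * (ℓ (j+1) * η (j+1)) - (ρ:ℂ)⁻¹ * η 0 / a₀ * (ℓ (j+1) * y (j+1)) := by
      intro j hj
      have hj := Finset.mem_range.1 hj
      have h2 := hℓs j hj
      have h3 := hd j hj
      calc _ = (ℓ j / (a₀ * deriv f (y j))) * (η (j+1) - y (j+1) * η 0 / a₀) := by
            field_simp
        _ = _ := by rw [h2]; field_simp
    rw [Finset.sum_congr rfl h1, Finset.sum_sub_distrib, ← Finset.mul_sum, ← Finset.mul_sum, hℓy]
    have h4 : ∑ j ∈ Finset.range N, ℓ (j+1) * η (j+1) = ∑ j ∈ Finset.range N, ℓ j * η j - η 0 := by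
      have := Finset.sum_range_succ' (fun j => ℓ j * η j) N
      rw [Finset.sum_range_succ, hη, hℓ0] at this
      linear_combination -this
    rw [h4]
    field_simp
    ring
  set κ := (ε:ℂ) ^ m * k a₀ with hκ
  have hκ0 : κ ≠ 0 := mul_ne_zero (pow_ne_zero _ hεc) hk0
  have hκlim : Tendsto (fun t : ℂ => (G N (a₀ + ε * t) - c) / t ^ m) (𝓝[≠] 0) (𝓝 κ) := by
    have haff0 : Tendsto (fun t : ℂ => a₀ + ε * t) (𝓝 0) (𝓝 a₀) := by
      have : Continuous (fun t : ℂ => a₀ + ε * t) := by fun_prop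
      simpa using this.tendsto 0
    have h1 : Tendsto (fun t : ℂ => (ε:ℂ) ^ m * k (a₀ + ε * t)) (𝓝[≠] 0) (𝓝 κ) :=
      ((hk.continuousAt.tendsto.comp haff0).mono_left nhdsWithin_le_nhds).const_mul _
    refine h1.congr' ?_
    filter_upwards [nhdsWithin_le_nhds (haff0.eventually hkF), self_mem_nhdsWithin] with t ht ht0
    have ht0 : t ≠ 0 := ht0
    rw [ht, smul_eq_mul, add_sub_cancel_left, mul_pow]
    field_simp
  obtain ⟨κ', hκ', hη⟩ : ∃ κ' : ℂ, κ' ≠ 0 ∧ ∀ n, ∃ η : ℕ → ℂ, η N = 0 ∧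
      (∀ j ≤ N, Tendsto (fun t => (Z (n+1) j t - Z n j t) / t ^ m) (𝓝[≠] 0) (𝓝 (η j))) ∧
      ∑ j ∈ Finset.range N, ℓ j * η j = ((ρ:ℂ)⁻¹) ^ n * κ' := by
    refine ⟨ℓ (N-1) * (-(κ / a₀) / deriv f (y (N-1))), ?_, ?_⟩
    · refine mul_ne_zero (hℓne _ (by omega)) (div_ne_zero (neg_ne_zero.2 (div_ne_zero hκ0 ha0)) (hd _ (by omega)))
    intro n
    have hlast : ∀ n, Tendsto (fun t => (Z (n+1) N t - Z n N t) / t ^ m) (𝓝[≠] 0) (𝓝 0) := by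
      intro n
      refine tendsto_const_nhds.congr' ?_
      filter_upwards [hbev] with t ht
      rw [(hZm _).last t ht, (hZm _).last t ht]; simp
    induction n with
    | zero =>
      refine ⟨fun j => if j = N - 1 then -(κ / a₀) / deriv f (y (N-1)) else 0, ?_, ?_, ?_⟩
      · exact if_neg (by omega)
      · intro j hj
        rcases hj.lt_or_eq with h | h
        · have key : Tendsto (fun t => (f (Z 1 j t) - f (Z 0 j t)) / t ^ m) (𝓝[≠] 0) 
              (𝓝 (if j = N - 1 then -(κ / a₀) else 0)) := by
            have hform : ∀ᶠ t in 𝓝[≠] (0:ℂ), f (Z 1 j t) - f (Z 0 j t) = 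
                if j = N - 1 then -((G N (a₀ + ε * t) - c) / (Z 0 0 t)) else 0 := by
              filter_upwards [hbev] with t ht
              have hz00 : Z 0 0 t = a₀ + ε * t := by
                change z0 0 t = _
                rw [hz0lt 0 (by omega)]; exact hG0 _
              have hne := (hZm 0).ne0 0 (Nat.zero_le _) t ht
              have hzj : Z 0 j t = G j (a₀ + ε * t) := by
                change z0 j t = _
                rw [hz0lt j h]
              have hgj : f (Z 0 j t) = G (j+1) (a₀ + ε * t) / Z 0 0 t := by
                rw [hGs, hzj, ← hz00]; field_simp
              rw [hZf 0 j h t ht, hgj]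
              by_cases hjN : j = N - 1
              · rw [if_pos hjN]
                have : j + 1 = N := by omega
                rw [this, (hZm 0).last t ht]; ring
              · rw [if_neg hjN]
                have : Z 0 (j+1) t = G (j+1) (a₀ + ε * t) := by
                  change z0 (j+1) t = _
                  rw [hz0lt (j+1) (by omega)]
                rw [this]; ring
            by_cases hjN : j = N - 1
            · rw [if_pos hjN]
              have h0 := hZt 0 0 (Nat.zero_le _)
              rw [hy0] at h0
              refine ((hκlim.div h0 ha0).neg).congr' ?_
              filter_upwards [hform] with t ht
              rw [ht, if_pos hjN]
              simp only [Pi.div_apply]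
              ring
            · rw [if_neg hjN]
              refine tendsto_const_nhds.congr' ?_
              filter_upwards [hform] with t ht
              rw [ht, if_neg hjN]; simp
          have := limit_div_deriv (hstrict j h) (hd j h) (hZc 1 j hj) (hZc 0 j hj) ((hZm 1).base j hj)
            ((hZm 0).base j hj) key
          convert this using 2
          by_cases hjN : j = N - 1
          · simp [hjN]
          · simp [hjN]
        · subst h; beta_reduce; rw [if_neg (by omega)]; exact hlast 0
      · rw [pow_zero, one_mul, Finset.sum_eq_single (N-1)]
        · simp
        · intro j _ hj; simp [hj]
        · intro h; exact absurd (Finset.mem_range.2 (by omega)) h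
    | succ n ih =>
      obtain ⟨η, hηN, hη, hsum⟩ := ih
      refine ⟨fun j => if j < N then (η (j+1) / a₀ - y (j+1) * η 0 / a₀ ^ 2) / deriv f (y j) else 0, by simp, ?_, ?_⟩
      · intro j hj
        rcases hj.lt_or_eq with h | h
        · beta_reduce; rw [if_pos h]
          refine limit_div_deriv (hstrict j h) (hd j h) (hZc _ j hj) (hZc _ j hj) ((hZm _).base j hj)
            ((hZm _).base j hj) ?_
          have hA1 := hZt (n+1) 0 (Nat.zero_le _)
          have hA0 := hZt n 0 (Nat.zero_le _)
          rw [hy0] at hA1 hA0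
          have hB0 := hZt n (j+1) h
          have t1 := (hη (j+1) h).div hA1 ha0
          have t2 := (hB0.mul (hη 0 (Nat.zero_le _))).div (hA1.mul hA0) (mul_ne_zero ha0 ha0)
          have t3 := t1.sub t2
          rw [← pow_two] at t3
          refine t3.congr' ?_
          filter_upwards [hbev] with t ht
          rw [hZf (n+1) j h t ht, hZf n j h t ht]
          have hne1 := (hZm (n+1)).ne0 0 (Nat.zero_le _) t ht
          have hne0 := (hZm n).ne0 0 (Nat.zero_le _) t ht
          simp only [Pi.div_apply, Pi.mul_apply]
          rw [div_div, div_sub_div _ _ hne1 hne0, ← mul_div_assoc, div_div, div_div, mul_comm (t^m) (Z (n+1) 0 t)]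
          by_cases htm : t ^ m = 0
          · simp [htm]
          field_simp
          ring
        · subst h; beta_reduce; rw [if_neg (by omega)]; exact hlast (n+1)
      · rw [pow_succ' ((ρ:ℂ)⁻¹) n, mul_assoc, ← hsum, ← hA η hηN]
        refine Finset.sum_congr rfl fun j hj => ?_
        beta_reduce; rw [if_pos (Finset.mem_range.1 hj)]
  choose η hηN hηlim hηsum using hη
  -- bounds
  have hbd : ∀ j, ∃ M : ℝ, j < N → ∀ n, ∀ t : ℂ, ‖t‖ ≤ 1/2 → ‖Z n j t‖ ≤ M := by
    intro j
    obtain ⟨M, hM⟩ := schottky (y j / c)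
    refine ⟨M * ‖c‖, fun hj n t ht => ?_⟩
    have := hM (fun t => Z n j t / c) (((hZm n).diff j hj.le).div_const c) (fun t ht => 
      ⟨div_ne_zero ((hZm n).ne0 j hj.le t ht) hc0, fun h => by
        rw [div_eq_one_iff_eq hc0, ← (hZm n).last t ht] at h
        have := (hZm n).inj t ht _ hj.le _ le_rfl h
        omega⟩) (by rw [(hZm n).base j hj.le]) t ht
    rwa [norm_div, div_le_iff₀ (norm_pos_iff.2 hc0)] at this
  choose M hM using hbd
  set B := ∑ j ∈ Finset.range N, ‖ℓ j‖ * (M j + M j) with hB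
  have hfinal : ∀ n : ℕ, (n:ℝ) * ‖κ'‖ ≤ B * 2 ^ m := by
    intro n
    have hlim : Tendsto (fun t => (∑ j ∈ Finset.range N, ℓ j * (Z n j t - Z 0 j t)) / t ^ m) (𝓝[≠] 0)
        (𝓝 (∑ i ∈ Finset.range n, ((ρ:ℂ)⁻¹) ^ i * κ')) := by
      have h1 : Tendsto (fun t => ∑ i ∈ Finset.range n, ∑ j ∈ Finset.range N, 
          ℓ j * ((Z (i+1) j t - Z i j t) / t ^ m)) (𝓝[≠] 0) 
          (𝓝 (∑ i ∈ Finset.range n, ∑ j ∈ Finset.range N, ℓ j * η i j)) := by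
        refine tendsto_finsetSum _ fun i _ => tendsto_finsetSum _ fun j hj => ?_
        exact (hηlim i j (Finset.mem_range.1 hj).le).const_mul _
      simp only [hηsum] at h1
      refine h1.congr fun t => ?_
      rw [Finset.sum_comm, Finset.sum_div]
      refine Finset.sum_congr rfl fun j _ => ?_
      rw [← Finset.mul_sum, ← Finset.sum_div, Finset.sum_range_sub (fun i => Z i j t) n]
      ring
    have h2 := limit_bound (B := B) (DifferentiableOn.fun_sum fun j hj => 
      ((((hZm n).diff j (Finset.mem_range.1 hj).le).sub 
        ((hZm 0).diff j (Finset.mem_range.1 hj).le)).const_mul (ℓ j))) (fun t ht => by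
        refine (norm_sum_le _ _).trans (Finset.sum_le_sum fun j hj => ?_)
        rw [norm_mul]
        have hj := Finset.mem_range.1 hj
        gcongr
        exact (norm_sub_le _ _).trans (add_le_add (hM j hj n t ht) (hM j hj 0 t ht))) hlim
    refine le_trans ?_ h2
    rw [← Finset.sum_mul, norm_mul]
    gcongr
    have h3 : ∑ i ∈ Finset.range n, ((ρ:ℂ)⁻¹) ^ i = ((∑ i ∈ Finset.range n, (ρ⁻¹) ^ i : ℝ) : ℂ) := by
      push_cast; rfl
    rw [h3, Complex.norm_real, Real.norm_eq_abs]
    refine le_trans ?_ (le_abs_self _)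
    have h4 : ∀ i ∈ Finset.range n, (1:ℝ) ≤ (ρ⁻¹) ^ i := fun i _ =>
      one_le_pow₀ ((one_le_inv₀ hρ0).2 hρ1)
    have := Finset.sum_le_sum h4
    simpa using this
  have hκp : 0 < ‖κ'‖ := norm_pos_iff.2 hκ'
  obtain ⟨n, hn⟩ := exists_nat_gt (B * 2 ^ m / ‖κ'‖)
  rw [div_lt_iff₀ hκp] at hn
  exact absurd (hfinal n) (not_le.2 hn)


theorem no_max {I : Set ℝ} {φ : ℝ → ℝ} (hcont : ∀ x ∈ I, ContinuousAt φ x)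
    (hcrit : ∀ x ∈ I, deriv φ x = 0 → φ x = 0 ∨ φ x = 1) {p r x : ℝ} (hI : Icc p r ⊆ I)
    (hx : x ∈ Icc p r) (h1 : 1 < φ x) (hp : φ p < φ x) (hr : φ r < φ x) : False := by
  obtain ⟨z, hz, hzm⟩ := isCompact_Icc.exists_isMaxOn ⟨x, hx⟩
    (fun w hw => (hcont w (hI hw)).continuousWithinAt)
  have hxz : φ x ≤ φ z := hzm hx
  have hzp : p ≠ z := by rintro rfl; linarith
  have hzr : z ≠ r := by rintro rfl; linarith
  have hl : IsLocalMax φ z := hzm.isLocalMax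
    (Icc_mem_nhds (lt_of_le_of_ne hz.1 hzp) (lt_of_le_of_ne hz.2 hzr))
  rcases hcrit z (hI hz) hl.deriv_eq_zero with h | h <;> linarith

theorem no_min {I : Set ℝ} {φ : ℝ → ℝ} (hcont : ∀ x ∈ I, ContinuousAt φ x)
    (hcrit : ∀ x ∈ I, deriv φ x = 0 → φ x = 0 ∨ φ x = 1) {p r x : ℝ} (hI : Icc p r ⊆ I)
    (hx : x ∈ Icc p r) (h1 : φ x < 0) (hp : φ x < φ p) (hr : φ x < φ r) : False := by
  obtain ⟨z, hz, hzm⟩ := isCompact_Icc.exists_isMinOn ⟨x, hx⟩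
    (fun w hw => (hcont w (hI hw)).continuousWithinAt)
  have hxz : φ z ≤ φ x := hzm hx
  have hzp : p ≠ z := by rintro rfl; linarith
  have hzr : z ≠ r := by rintro rfl; linarith
  have hl : IsLocalMin φ z := hzm.isLocalMin
    (Icc_mem_nhds (lt_of_le_of_ne hz.1 hzp) (lt_of_le_of_ne hz.2 hzr))
  rcases hcrit z (hI hz) hl.deriv_eq_zero with h | h <;> linarith

theorem orbit_analytic {I : Set ℝ} {φ : ℝ → ℝ} (han : ∀ x ∈ I, AnalyticAt ℝ φ x) {c : ℝ}
    {X : ℕ → ℝ → ℝ} (hX0 : ∀ a, X 0 a = c) (hXs : ∀ j a, X (j+1) a = a * φ (X j a))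
    {a : ℝ} : ∀ j, (∀ i < j, X i a ∈ I) → AnalyticAt ℝ (X j) a := by
  intro j
  induction j with
  | zero =>
    intro _
    have : X 0 = fun _ => c := funext hX0
    rw [this]; exact analyticAt_const
  | succ j ih =>
    intro h
    have : X (j+1) = fun a => a * φ (X j a) := funext (hXs j)
    rw [this]
    exact analyticAt_id.mul ((han _ (h j (by omega))).fun_comp (ih fun i hi => h i (by omega)))

theorem real_part {I : Set ℝ} {φ : ℝ → ℝ} (hIopen : IsOpen I) (hIconn : I.OrdConnected)
    (hI0 : (0:ℝ) ∈ I) (han : ∀ x ∈ I, AnalyticAt ℝ φ x)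
    (hcrit : ∀ x ∈ I, deriv φ x = 0 → φ x = 0 ∨ φ x = 1) (h0 : φ 0 = 0)
    {c : ℝ} (hc0 : 0 < c) (hcI : c ∈ I) (hc1 : φ c = 1) {b : ℝ}
    (hb : b = sSup {x : ℝ | x ∈ I ∧ c < x ∧ 0 < φ x})
    (has : ∀ x0 < b, Ico x0 b ⊆ I → b ∉ I → ∀ L, Tendsto φ (𝓝[<] b) (𝓝 L) → L = 0)
    {a₀ : ℝ} (ha₀ : 0 < a₀) (ha₀b : a₀ < b) {q : ℕ} (hq : 1 ≤ q)
    {X : ℕ → ℝ → ℝ} (hX0 : ∀ a, X 0 a = c) (hXs : ∀ j a, X (j+1) a = a * φ (X j a))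
    (hev : ∀ᶠ t in 𝓝 a₀, (∀ j ≤ q, X j t ∈ I) ∧ X q t = c) : False := by
  have hcont : ∀ x ∈ I, ContinuousAt φ x := fun x hx => (han x hx).continuousAt
  set S := {x : ℝ | x ∈ I ∧ c < x ∧ 0 < φ x} with hS
  have hbpos : 0 < b := ha₀.trans ha₀b
  have hSne : S.Nonempty := by
    by_contra h
    rw [not_nonempty_iff_eq_empty] at h
    rw [h, Real.sSup_empty] at hb; linarith
  have hSb : BddAbove S := by
    by_contra h
    rw [Real.sSup_of_not_bddAbove h] at hb; linarith
  have hleb : ∀ x ∈ S, x ≤ b := fun x hx => hb ▸ le_csSup hSb hx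
  have hcb : c < b := by
    obtain ⟨x, hx⟩ := hSne
    exact hx.2.1.trans_le (hleb x hx)
  have hgt : ∀ x < b, ∃ s ∈ S, x < s := fun x hx => exists_lt_of_lt_csSup hSne (hb ▸ hx)
  have hIco : ∀ x, 0 ≤ x → x < b → x ∈ I := fun x h1 h2 => by
    obtain ⟨s, hs, hxs⟩ := hgt x h2
    exact hIconn.out hI0 hs.1 ⟨h1, hxs.le⟩
  have hle1 : ∀ x, 0 ≤ x → x ≤ c → 0 ≤ φ x ∧ φ x ≤ 1 := by
    intro x h1 h2
    constructor
    · by_contra! h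
      exact no_min hcont hcrit (hIconn.out hI0 hcI) ⟨h1, h2⟩ h (by linarith) (by linarith)
    · by_contra! h
      exact no_max hcont hcrit (hIconn.out hI0 hcI) ⟨h1, h2⟩ h (by linarith) (by linarith)
  have hnn : ∀ x, 0 ≤ x → x < b → 0 ≤ φ x := by
    intro x h1 h2
    rcases le_or_gt x c with h | h
    · exact (hle1 x h1 h).1
    · by_contra! hx
      obtain ⟨s, hs, hxs⟩ := hgt x h2
      have := hs.2.2
      exact no_min hcont hcrit (hIconn.out hcI hs.1) ⟨h.le, hxs.le⟩ hx (by linarith) (by linarith)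
  have hX1 : ∀ a, X 1 a = a := fun a => by rw [hXs, hX0, hc1, mul_one]
  -- invariance
  have hinv : ∀ a d, 0 < a → a ≤ d → (∀ x, 0 ≤ x → x ≤ d → 0 ≤ φ x ∧ φ x ≤ 1) →
      ∀ j, 0 ≤ X (j+1) a ∧ X (j+1) a ≤ a := by
    intro a d ha had hd j
    induction j with
    | zero => rw [hX1]; exact ⟨ha.le, le_rfl⟩
    | succ j ih =>
      rw [hXs]
      have := hd _ ih.1 (ih.2.trans had)
      exact ⟨mul_nonneg ha.le this.1, by nlinarith⟩
  set u : Set ℝ := {a | ∀ᶠ t in 𝓝 a, (∀ j ≤ q, X j t ∈ I) ∧ X q t = c} with hu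
  have huo : IsOpen u := isOpen_setOf_eventually_nhds
  have hself : ∀ a ∈ u, (∀ j ≤ q, X j a ∈ I) ∧ X q a = c := fun a ha => by
    have h : ∀ᶠ t in 𝓝 a, (∀ j ≤ q, X j t ∈ I) ∧ X q t = c := ha
    exact h.self_of_nhds
  -- limits of orbits stay in I
  have hclI : ∀ a ∈ closure u, a ∈ Ioo 0 b → ∀ j ≤ q, X j a ∈ I := by
    intro a hau has'
    by_cases hcase : ∀ x, 0 ≤ x → x < b → φ x ≤ 1
    · intro j hj
      cases j with
      | zero => rw [hX0]; exact hcI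
      | succ j =>
        have := hinv a a has'.1 le_rfl (fun x h1 h2 => 
          ⟨hnn x h1 (h2.trans_lt has'.2), hcase x h1 (h2.trans_lt has'.2)⟩) j
        exact hIco _ this.1 (this.2.trans_lt has'.2)
    push Not at hcase
    obtain ⟨x1, hx10, hx1b, hx1⟩ := hcase
    have hx1c : c < x1 := by
      by_contra! h
      linarith [(hle1 x1 hx10 h).2]
    have hmono : ∀ x y, c < x → x ≤ y → y ∈ I → 1 < φ x → φ x ≤ φ y := by
      intro x y hcx hxy hy h1
      by_contra! h
      exact no_max hcont hcrit (hIconn.out hcI hy) ⟨hcx.le, hxy⟩ h1 (by linarith) h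
    have hIb : ∀ x ∈ I, x < b := by
      intro x hx
      by_contra! hbx
      obtain ⟨y, hy, hxy⟩ : ∃ y ∈ I, x < y := by
        have := (hIopen.mem_nhds hx)
        obtain ⟨e, he, hsub⟩ := Metric.mem_nhds_iff.1 this
        refine ⟨x + e/2, hsub ?_, by linarith⟩
        rw [Metric.mem_ball, Real.dist_eq]
        rw [abs_of_pos (by linarith)]; linarith
      have := hmono x1 y hx1c (by linarith) hy hx1
      have := hleb y ⟨hy, by linarith, by linarith⟩
      linarith
    have hunb : ∀ K : ℝ, ∃ x, x1 ≤ x ∧ x < b ∧ K < φ x := by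
      intro K
      by_contra! hK
      have hM : MonotoneOn φ (Ioo x1 b) := by
        intro x hx y hy hxy
        have := hmono x1 x hx1c hx.1.le (hIco x (by linarith [hx.1]) hx.2) hx1
        exact hmono x y (by linarith [hx.1]) hxy (hIco y (by linarith [hy.1]) hy.2) (by linarith)
      have hbdd : BddAbove (φ '' Ioo x1 b) := by
        refine ⟨K, ?_⟩
        rintro _ ⟨x, hx, rfl⟩
        exact hK x hx.1.le hx.2
      have hT := hM.tendsto_nhdsWithin_Ioo_left (nonempty_Ioo.2 hx1b) hbdd
      have hz := has x1 hx1b (fun x hx => hIco x (by linarith [hx.1]) hx.2) (fun h => lt_irrefl _ (hIb b h)) _ hT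
      have hm : (x1 + b)/2 ∈ Ioo x1 b := ⟨by linarith, by linarith⟩
      have h1 := le_csSup hbdd ⟨_, hm, rfl⟩
      have h2 := hmono x1 ((x1+b)/2) hx1c hm.1.le (hIco _ (by linarith [hm.1]) hm.2) hx1
      linarith
    have horb : ∀ t ∈ u, 0 < t → ∀ j ≤ q, 0 ≤ X j t ∧ X j t < b := by
      intro t ht ht0 j
      induction j with
      | zero => intro _; rw [hX0]; exact ⟨hc0.le, hcb⟩
      | succ j ih =>
        intro hj
        have := ih (by omega)
        refine ⟨?_, hIb _ ((hself t ht).1 _ hj)⟩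
        rw [hXs]; exact mul_nonneg ht0.le (hnn _ this.1 this.2)
    haveI : (𝓝[u] a).NeBot := mem_closure_iff_nhdsWithin_neBot.1 hau
    have hpos : ∀ᶠ t in 𝓝[u] a, a/2 < t := 
      nhdsWithin_le_nhds (lt_mem_nhds (by linarith [has'.1]))
    have hmem : ∀ᶠ t in 𝓝[u] a, t ∈ u := self_mem_nhdsWithin
    intro j
    induction j using Nat.strong_induction_on with
    | _ j ih =>
    intro hj
    have hcX : Tendsto (X j) (𝓝[u] a) (𝓝 (X j a)) :=
      (orbit_analytic han hX0 hXs j (fun i hi => ih i hi (by omega))).continuousAt.mono_left nhdsWithin_le_nhds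
    have hge : 0 ≤ X j a := by
      refine ge_of_tendsto hcX ?_
      filter_upwards [hpos, hmem] with t h1 h2
      exact (horb t h2 (by linarith [has'.1]) j hj).1
    have hle : X j a ≤ b := by
      refine le_of_tendsto hcX ?_
      filter_upwards [hpos, hmem] with t h1 h2
      exact (horb t h2 (by linarith [has'.1]) j hj).2.le
    rcases hle.lt_or_eq with h | h
    · exact hIco _ hge h
    exfalso
    rcases hj.lt_or_eq with hjq | hjq
    · obtain ⟨x2, hx2, hx2b, hK⟩ := hunb (b / (a/2))
      have hev2 : ∀ᶠ t in 𝓝[u] a, x2 < X j t := hcX.eventually (lt_mem_nhds (by rw [h]; exact hx2b))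
      obtain ⟨t, h1, h2, h3⟩ := (hpos.and (hmem.and hev2)).exists
      have hb1 := horb t h2 (by linarith [has'.1]) (j+1) hjq
      have hb2 := hmono x1 x2 hx1c hx2 (hIco _ (by linarith) hx2b) hx1
      have hb3 := hmono x2 (X j t) (by linarith) h3.le ((hself t h2).1 j hj) (by linarith)
      rw [hXs] at hb1
      have ha2 : 0 < a/2 := by linarith [has'.1]
      rw [div_lt_iff₀ ha2] at hK
      have : 0 < φ (X j t) := by linarith
      nlinarith [hb1.2]
    · have : X j a = c := by
        refine tendsto_nhds_unique hcX (tendsto_const_nhds.congr' ?_)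
        filter_upwards [hmem] with t ht
        rw [hjq]; exact (hself t ht).2.symm
      linarith
  have hsub : Ioo 0 b ⊆ u := by
    refine isPreconnected_Ioo.subset_of_closure_inter_subset huo ⟨a₀, ⟨ha₀, ha₀b⟩, hev⟩ ?_
    rintro a ⟨hau, ha⟩
    by_contra hnu
    have horb := hclI a hau ha
    have hana := orbit_analytic han hX0 hXs (a := a)
    have hE : ∀ᶠ t in 𝓝 a, ∀ j ≤ q, X j t ∈ I := by
      have : ∀ᶠ t in 𝓝 a, ∀ j ∈ Iic q, X j t ∈ I := by
        rw [eventually_all_finite (finite_Iic q)]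
        intro j hj
        exact (hana j fun i hi => horb i (le_trans hi.le hj)).continuousAt.eventually_mem
          (hIopen.mem_nhds (horb j hj))
      exact this
    have hF : ∃ᶠ t in 𝓝[≠] a, X q t = c := by
      have h1 : ∃ᶠ t in 𝓝 a, t ∈ u := mem_closure_iff_frequently.1 hau
      have h2 : ∃ᶠ t in 𝓝[≠] a, t ∈ u := by
        rw [frequently_nhdsWithin_iff]
        refine h1.mono fun t ht => ⟨ht, ?_⟩
        rintro rfl
        exact hnu ht
      exact h2.mono fun t ht => (hself t ht).2
    have hG := ((hana q fun i hi => horb i hi.le).frequently_eq_iff_eventually_eq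
      (analyticAt_const (v := c))).1 hF
    exact hnu (hE.and hG)
  have hmem := hsub (show c/2 ∈ Ioo 0 b from ⟨by linarith, by linarith⟩)
  have h1 := (hself _ hmem).2
  obtain ⟨n, rfl⟩ : ∃ n, q = n + 1 := ⟨q - 1, by omega⟩
  have h2 := (hinv (c/2) c (by linarith) (by linarith) hle1 n).2
  linarith

theorem prod_Icc_shift (h : ℕ → ℝ) (N : ℕ) :
    ∏ k ∈ Finset.Icc 1 N, h k = ∏ i ∈ Finset.range N, h (i+1) := by
  induction N with
  | zero => simp
  | succ N ih => rw [Finset.prod_Icc_succ_top (by omega), ih, Finset.prod_range_succ]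

theorem deriv_formula {φ : ℝ → ℝ} {c : ℝ} {X : ℕ → ℝ → ℝ} (hX0 : ∀ a, X 0 a = c)
    (hXs : ∀ j a, X (j+1) a = a * φ (X j a)) {a₀ : ℝ} (ha₀ : a₀ ≠ 0) {N : ℕ} {d : ℕ → ℝ}
    (hφ : ∀ j < N, HasDerivAt φ (d j) (X (j+1) a₀)) (hd : ∀ j < N, d j ≠ 0) :
    ∀ k ≤ N, HasDerivAt (X (k+1))
      (((∑ j ∈ Finset.range (k+1), X (j+1) a₀ / ∏ i ∈ Finset.range j, (a₀ * d i)) / a₀) *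
        ∏ i ∈ Finset.range k, (a₀ * d i)) a₀ := by
  intro k
  induction k with
  | zero =>
    intro _
    have h1 : X (0+1) = fun a => a * φ c := funext fun a => by rw [hXs, hX0]
    have h2 := (hasDerivAt_id a₀).mul_const (φ c)
    rw [h1]
    refine h2.congr_deriv ?_
    simp [hXs, hX0]
    field_simp
  | succ k ih =>
    intro hk
    have h1 : X (k+1+1) = fun a => a * φ (X (k+1) a) := funext fun a => by rw [hXs]
    have h3 := (hφ k hk).comp a₀ (ih (by omega))
    have h2 := (hasDerivAt_id a₀).mul h3
    have hp : ∏ i ∈ Finset.range k, (a₀ * d i) ≠ 0 := by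
      rw [Finset.prod_ne_zero_iff]
      intro i hi
      exact mul_ne_zero ha₀ (hd i (by have := Finset.mem_range.1 hi; omega))
    have hdk := hd k hk
    have h4 : X (k+1+1) = (id * (φ ∘ X (k+1)) : ℝ → ℝ) := h1
    have h5 : φ (X (k+1) a₀) = X (k+1+1) a₀ / a₀ := by rw [hXs (k+1)]; field_simp
    rw [h4]
    refine h2.congr_deriv ?_
    rw [Finset.sum_range_succ _ (k+1), Finset.prod_range_succ]
    simp only [Function.comp, id]
    rw [h5]
    field_simp
    ring

theorem stmt4_aux
    (D : Set ℂ) (I : Set ℝ) (f : ℂ → ℂ)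
    (hDopen : IsOpen D) (hDconn : IsConnected D)
    (hDconj : ∀ z ∈ D, (starRingEnd ℂ) z ∈ D)
    (hIopen : IsOpen I) (hIconn : I.OrdConnected) (hI0 : (0 : ℝ) ∈ I)
    (hDI : ∀ x : ℝ, (x : ℂ) ∈ D ↔ x ∈ I)
    (hf : DifferentiableOn ℂ f D)
    (hfreal : ∀ x ∈ I, (f x).im = 0)
    (hfsurj : f '' D = Set.univ)
    (hf0 : f 0 = 0)
    (hasymp : ∀ γ : ℝ → ℂ, ContinuousOn γ (Set.Ico 0 1) →
      (∀ t ∈ Set.Ico (0 : ℝ) 1, γ t ∈ D) →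
      (∀ K : Set ℂ, IsCompact K → K ⊆ D → ∀ᶠ t in nhdsWithin 1 (Set.Iio 1), γ t ∉ K) →
      ∀ v : ℂ, Filter.Tendsto (fun t => f (γ t)) (nhdsWithin 1 (Set.Iio 1)) (nhds v) → v = 0)
    (hcrit : ∀ z ∈ D, deriv f z = 0 → f z = 0 ∨ f z = 1)
    (c : ℝ) (hc0 : 0 < c) (hcI : c ∈ I)
    (hmax : IsLocalMax (fun x : ℝ => (f x).re) c)
    (hposmax : 0 < (f c).re)
    (hfc1 : f c = 1)
    (hmin : ∀ c' : ℝ, 0 < c' → c' ∈ I → IsLocalMax (fun x : ℝ => (f x).re) c' →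
      0 < (f c').re → c ≤ c')
    (b : ℝ) (hb : b = sSup {x : ℝ | x ∈ I ∧ c < x ∧ 0 < (f x).re})
    (a₀ : ℝ) (ha₀ : 0 < a₀) (ha₀b : a₀ < b)
    (q : ℕ) (hq : 1 ≤ q)
    (horbI : ∀ j : ℕ, 1 ≤ j → j ≤ q → (gre f a₀)^[j] c ∈ I)
    (hper : (gre f a₀)^[q] c = c)
    (hnper : ∀ j : ℕ, 1 ≤ j → j < q → (gre f a₀)^[j] c ≠ c) :
    0 < deriv (fun a => (gre f a)^[q] c) a₀ /
        ∏ k ∈ Finset.Icc 1 (q - 1), deriv (gre f a₀) ((gre f a₀)^[k] c) := by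
  obtain ⟨N, rfl⟩ : ∃ n, q = n + 1 := ⟨q - 1, by omega⟩
  rw [Nat.add_sub_cancel]
  set X : ℕ → ℝ → ℝ := fun j a => (gre f a)^[j] c with hXdef
  set φ : ℝ → ℝ := fun x => (f x).re with hφdef
  have hX0 : ∀ a, X 0 a = c := fun a => rfl
  have hXs : ∀ j a, X (j+1) a = a * φ (X j a) := fun j a => Function.iterate_succ_apply' (gre f a) j c
  have hXI : ∀ j ≤ N + 1, X j a₀ ∈ I := by
    intro j hj
    rcases Nat.eq_zero_or_pos j with h | h
    · rw [h]; exact hcI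
    · exact horbI j h hj
  have hXN : X (N+1) a₀ = c := hper
  -- real structure of f
  have hfa : ∀ x ∈ I, AnalyticAt ℂ f x := fun x hx =>
    hf.analyticAt (hDopen.mem_nhds ((hDI x).2 hx))
  have hfre : ∀ x ∈ I, f x = (φ x : ℂ) := fun x hx =>
    Complex.ext (by simp [hφdef]) (by simp [hfreal x hx])
  have hφan : ∀ x ∈ I, AnalyticAt ℝ φ x := fun x hx => (hfa x hx).re_ofReal
  have hφd : ∀ x ∈ I, HasDerivAt φ (deriv f x).re x := fun x hx =>
    (hfa x hx).differentiableAt.hasDerivAt.real_of_complex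
  have hdre : ∀ x ∈ I, deriv f x = ((deriv f x).re : ℂ) := by
    intro x hx
    have h1 := (hfa x hx).differentiableAt.hasDerivAt.comp_ofReal
    have h2 := (hφd x hx).ofReal_comp
    refine h1.unique (h2.congr_of_eventuallyEq ?_)
    filter_upwards [hIopen.mem_nhds hx] with t ht
    exact hfre t ht
  have hφcrit : ∀ x ∈ I, deriv φ x = 0 → φ x = 0 ∨ φ x = 1 := by
    intro x hx h
    rw [(hφd x hx).deriv] at h
    have h2 := hdre x hx
    rw [h] at h2
    rcases hcrit x ((hDI x).2 hx) (by simpa using h2) with h3 | h3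
    · left; simp [hφdef, h3]
    · right; simp [hφdef, h3]
  have hφ0 : φ 0 = 0 := by simp [hφdef, hf0]
  have hφc : φ c = 1 := by simp [hφdef, hfc1]
  have hX1 : ∀ a, X 1 a = a := fun a => by rw [hXs, hX0, hφc, mul_one]
  -- asymptotic
  have has : ∀ x0 < b, Ico x0 b ⊆ I → b ∉ I → ∀ L, Tendsto φ (𝓝[<] b) (𝓝 L) → L = 0 := by
    intro x0 hx0 hsub hbI L hL
    have hbd : 0 < b - x0 := by linarith
    have hin : ∀ t ∈ Ico (0:ℝ) 1, x0 + t * (b - x0) ∈ Ico x0 b := by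
      intro t ht
      exact ⟨by nlinarith [ht.1], by nlinarith [ht.2]⟩
    have hct : Continuous (fun t : ℝ => x0 + t * (b - x0)) := by fun_prop
    have h1 : Tendsto (fun t : ℝ => x0 + t * (b - x0)) (𝓝[<] 1) (𝓝 b) := by
      have := hct.tendsto 1
      rw [show x0 + 1 * (b - x0) = b by ring] at this
      exact this.mono_left nhdsWithin_le_nhds
    have h01 : ∀ᶠ t in 𝓝[<] (1:ℝ), t ∈ Ico (0:ℝ) 1 := by
      filter_upwards [self_mem_nhdsWithin, nhdsWithin_le_nhds (lt_mem_nhds (zero_lt_one (α := ℝ)))] with t h1 h2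
      exact ⟨h2.le, h1⟩
    have h2 : Tendsto (fun t : ℝ => x0 + t * (b - x0)) (𝓝[<] 1) (𝓝[<] b) := by
      rw [tendsto_nhdsWithin_iff]
      refine ⟨h1, ?_⟩
      filter_upwards [h01] with t ht
      exact (hin t ht).2
    have key := hasymp (fun t => ((x0 + t * (b - x0) : ℝ) : ℂ))
      (Complex.continuous_ofReal.comp hct).continuousOn
      (fun t ht => (hDI _).2 (hsub (hin t ht)))
      (by
        intro K hK hKD
        have hbK : (b:ℂ) ∈ Kᶜ := fun h => hbI ((hDI b).1 (hKD h))
        exact ((Complex.continuous_ofReal.tendsto b).comp h1).eventually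
          (hK.isClosed.isOpen_compl.mem_nhds hbK))
      (L:ℂ) (by
        have h3 := (Complex.continuous_ofReal.tendsto L).comp (hL.comp h2)
        refine h3.congr' ?_
        filter_upwards [h01] with t ht
        exact (hfre _ (hsub (hin t ht))).symm)
    exact_mod_cast key
  -- shifting
  have hshift : ∀ i j, X i a₀ = X j a₀ → ∀ n, X (i+n) a₀ = X (j+n) a₀ := by
    intro i j h n
    induction n with
    | zero => exact h
    | succ n ih => rw [← add_assoc, ← add_assoc, hXs, hXs, ih]
  have hne : ∀ j ≤ N + 1, X j a₀ ≠ 0 := by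
    intro j hj h
    have : ∀ n, X (j+n) a₀ = 0 := by
      intro n
      induction n with
      | zero => exact h
      | succ n ih => rw [← add_assoc, hXs, ih, hφ0, mul_zero]
    have h2 := this (N + 1 - j)
    rw [show j + (N + 1 - j) = N + 1 by omega, hXN] at h2
    linarith
  have hinj' : ∀ i j, i < j → j ≤ N → X (i+1) a₀ ≠ X (j+1) a₀ := by
    intro i j hij hj h
    have := hshift _ _ h (N - j)
    rw [show j + 1 + (N - j) = N + 1 by omega, hXN] at this
    exact hnper (i + 1 + (N - j)) (by omega) (by omega) this
  have hinj : ∀ i ≤ N, ∀ j ≤ N, X (i+1) a₀ = X (j+1) a₀ → i = j := by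
    intro i hi j hj h
    rcases lt_trichotomy i j with h1 | h1 | h1
    · exact absurd h (hinj' i j h1 hj)
    · exact h1
    · exact absurd h.symm (hinj' j i h1 hi)
  have hdne : ∀ j < N, deriv f (X (j+1) a₀ : ℝ) ≠ 0 := by
    intro j hj h
    have hmem := hXI (j+1) (by omega)
    rcases hcrit _ ((hDI _).2 hmem) h with h1 | h1
    · refine hne (j+2) (by omega) ?_
      rw [hXs (j+1)]
      simp [hφdef, h1]
    · have : X (j+1+1) a₀ = X (0+1) a₀ := by
        rw [hXs (j+1), zero_add, hX1]
        simp [hφdef, h1]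
      have := hinj _ (by omega) _ (by omega) this
      omega
  set d : ℕ → ℝ := fun j => (deriv f (X (j+1) a₀ : ℝ)).re with hd
  have hdc : ∀ j < N, deriv f (X (j+1) a₀ : ℝ) = (d j : ℂ) := fun j hj =>
    hdre _ (hXI (j+1) (by omega))
  have hdne' : ∀ j < N, d j ≠ 0 := by
    intro j hj h
    refine hdne j hj ?_
    rw [hdc j hj, h]; simp
  -- the polynomial
  set P : ℝ → ℝ := fun ρ => ∑ k ∈ Finset.range (N+1), ρ ^ k * X (k+1) a₀ /
    ∏ i ∈ Finset.range k, (a₀ * d i) with hP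
  have hPcont : Continuous P := by
    refine continuous_finsetSum _ fun k _ => ?_
    fun_prop
  have hP0 : P 0 = a₀ := by
    simp only [hP]
    rw [Finset.sum_eq_single 0]
    · simp [hX1]
    · intro k _ hk; simp [hk]
    · simp
  set G : ℕ → ℂ → ℂ := fun j a => Nat.rec a (fun _ z => a * f z) j with hGdef
  have hG0 : ∀ a, G 0 a = a := fun a => rfl
  have hGs : ∀ j a, G (j+1) a = a * f (G j a) := fun j a => rfl
  have hGX : ∀ (t : ℝ) j, (∀ i ≤ j, X i t ∈ I) → G j (t:ℂ) = (X (j+1) t : ℝ) := by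
    intro t j
    induction j with
    | zero => intro _; rw [hG0, zero_add, hX1]
    | succ j ih =>
      intro h
      rw [hGs, ih (fun i hi => h i (by omega)), hXs (j+1), hfre _ (h (j+1) le_rfl)]
      push_cast; rfl
  have hG : ¬ ∀ᶠ a in 𝓝 (a₀:ℂ), G N a = c := by
    intro hev
    have hev1 : ∀ᶠ t : ℝ in 𝓝 a₀, G N (t:ℂ) = c :=
      (Complex.continuous_ofReal.tendsto a₀).eventually hev
    have hE : ∀ᶠ t in 𝓝 a₀, ∀ j ≤ N + 1, X j t ∈ I := by
      have : ∀ᶠ t in 𝓝 a₀, ∀ j ∈ Iic (N+1), X j t ∈ I := by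
        rw [eventually_all_finite (finite_Iic (N+1))]
        intro j hj
        exact (orbit_analytic hφan hX0 hXs j fun i hi => hXI i (le_trans hi.le hj)).continuousAt.eventually_mem
          (hIopen.mem_nhds (hXI j hj))
      exact this
    refine real_part hIopen hIconn hI0 hφan hφcrit hφ0 hc0 hcI hφc hb has ha₀ ha₀b hq hX0 hXs ?_
    filter_upwards [hev1, hE] with t h1 h2
    refine ⟨h2, ?_⟩
    rw [hGX t N (fun i hi => h2 i (by omega))] at h1
    exact_mod_cast h1
  have hPne : ∀ ρ : ℝ, 0 < ρ → ρ ≤ 1 → P ρ ≠ 0 := by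
    intro ρ h0 h1 hz
    refine core (y := fun j => ((X (j+1) a₀ : ℝ) : ℂ)) (a₀ := (a₀:ℂ)) (c := (c:ℂ)) (N := N) (G := G) (ρ := ρ) hDopen hf
      (fun w hw hw01 x hx hfx => hol_lift hDopen hf hasymp hcrit hw hw01 hx hfx) hf0 hfc1
      ?_ ?_ ?_ ?_ ?_ ?_ hdne hG0 hGs hG h0 h1 ?_
    · beta_reduce; rw [zero_add, hX1]
    · beta_reduce; rw [hXN]
    · intro j hj; exact (hDI _).2 (hXI _ (by omega))
    · intro j hj; beta_reduce; exact_mod_cast hne _ (by omega)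
    · intro i hi j hj h; exact hinj i hi j hj (by exact_mod_cast h)
    · intro j hj
      beta_reduce
      rw [hfre _ (hXI _ (by omega)), hXs (j+1)]; push_cast; rfl
    · have h2 : ((P ρ : ℝ) : ℂ) = 0 := by rw [hz]; simp
      rw [← h2]
      simp only [hP]
      push_cast
      refine Finset.sum_congr rfl fun k hk => ?_
      congr 1
      refine Finset.prod_congr rfl fun i hi => ?_
      have := Finset.mem_range.1 hk
      have := Finset.mem_range.1 hi
      rw [hdc i (by omega)]
  have hP1 : 0 < P 1 := by
    by_contra! h
    obtain ⟨ρ, hρ, hρz⟩ := intermediate_value_Icc' (zero_le_one (α := ℝ)) hPcont.continuousOn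
      (show (0:ℝ) ∈ Icc (P 1) (P 0) from ⟨h, by rw [hP0]; exact ha₀.le⟩)
    rcases hρ.1.lt_or_eq with h1 | h1
    · exact hPne ρ h1 hρ.2 hρz
    · rw [← h1, hP0] at hρz; linarith
  have hder := deriv_formula hX0 hXs ha₀.ne' (N := N) (d := d)
    (fun j hj => hφd _ (hXI _ (by omega))) hdne' N le_rfl
  have hprod : ∏ k ∈ Finset.Icc 1 N, deriv (gre f a₀) ((gre f a₀)^[k] c) =
      ∏ i ∈ Finset.range N, (a₀ * d i) := by
    rw [prod_Icc_shift]
    refine Finset.prod_congr rfl fun i hi => ?_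
    have := Finset.mem_range.1 hi
    exact ((hφd (X (i+1) a₀) (hXI _ (by omega))).const_mul a₀).deriv
  have hpne : ∏ i ∈ Finset.range N, (a₀ * d i) ≠ 0 := by
    rw [Finset.prod_ne_zero_iff]
    intro i hi
    exact mul_ne_zero ha₀.ne' (hdne' i (Finset.mem_range.1 hi))
  have hder' : deriv (fun a => (gre f a)^[N+1] c) a₀ = _ := hder.deriv
  rw [hprod, hder', mul_div_assoc, div_self hpne, mul_one]
  refine div_pos ?_ ha₀
  simpa [hP] using hP1

end Helpers

theorem stmt4
    (D : Set ℂ) (I : Set ℝ) (f : ℂ → ℂ)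
    -- `D` is a domain, symmetric w.r.t. `ℝ`
    (hDopen : IsOpen D) (hDconn : IsConnected D)
    (hDconj : ∀ z ∈ D, (starRingEnd ℂ) z ∈ D)
    -- `D ∩ ℝ = I`, an open interval containing `0`
    (hIopen : IsOpen I) (hIconn : I.OrdConnected) (hI0 : (0 : ℝ) ∈ I)
    (hDI : ∀ x : ℝ, (x : ℂ) ∈ D ↔ x ∈ I)
    -- `f` is holomorphic on `D`
    (hf : DifferentiableOn ℂ f D)
    -- `f(I) ⊆ ℝ`
    (hfreal : ∀ x ∈ I, (f x).im = 0)
    -- `f(D) = ℂ`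
    (hfsurj : f '' D = Set.univ)
    -- `f(0) = 0`
    (hf0 : f 0 = 0)
    -- the only possible finite asymptotic value of `f` is `0`
    (hasymp : ∀ γ : ℝ → ℂ, ContinuousOn γ (Set.Ico 0 1) →
      (∀ t ∈ Set.Ico (0 : ℝ) 1, γ t ∈ D) →
      (∀ K : Set ℂ, IsCompact K → K ⊆ D → ∀ᶠ t in nhdsWithin 1 (Set.Iio 1), γ t ∉ K) →
      ∀ v : ℂ, Filter.Tendsto (fun t => f (γ t)) (nhdsWithin 1 (Set.Iio 1)) (nhds v) → v = 0)
    -- every critical value of `f` lies in `{0, 1}`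
    (hcrit : ∀ z ∈ D, deriv f z = 0 → f z = 0 ∨ f z = 1)
    -- `c > 0` is the minimal positive local maximum of `f`, with `f(c) = 1`
    (c : ℝ) (hc0 : 0 < c) (hcI : c ∈ I)
    (hmax : IsLocalMax (fun x : ℝ => (f x).re) c)
    (hposmax : 0 < (f c).re)
    (hfc1 : f c = 1)
    (hmin : ∀ c' : ℝ, 0 < c' → c' ∈ I → IsLocalMax (fun x : ℝ => (f x).re) c' →
      0 < (f c').re → c ≤ c')
    -- `b = sup {x ∈ I : x > c, f(x) > 0}`
    (b : ℝ) (hb : b = sSup {x : ℝ | x ∈ I ∧ c < x ∧ 0 < (f x).re})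
    -- `0 < a₀ < b`
    (a₀ : ℝ) (ha₀ : 0 < a₀) (ha₀b : a₀ < b)
    -- `c` is periodic of period `q` for `g_{a₀}`
    (q : ℕ) (hq : 1 ≤ q)
    (horbI : ∀ j : ℕ, 1 ≤ j → j ≤ q → (gre f a₀)^[j] c ∈ I)
    (hper : (gre f a₀)^[q] c = c)
    (hnper : ∀ j : ℕ, 1 ≤ j → j < q → (gre f a₀)^[j] c ≠ c) :
    -- positive transversality
    0 < deriv (fun a => (gre f a)^[q] c) a₀ /
        ∏ k ∈ Finset.Icc 1 (q - 1), deriv (gre f a₀) ((gre f a₀)^[k] c) := by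
  exact stmt4_aux D I f hDopen hDconn hDconj hIopen hIconn hI0 hDI hf hfreal hfsurj hf0 hasymp hcrit c
    hc0 hcI hmax hposmax hfc1 hmin b hb a₀ ha₀ ha₀b q hq horbI hper hnper
end

section
/- Let d ≥ 2 be an even integer and for c ∈ ℝ let f_c(x) = x^d + c. If q ≥ 1 is an integer and c ∈ ℝ satisfy f_c^q(0) = 0 and f_c^j(0) ≠ 0 for all 1 ≤ j < q, then the positive transversality condition holds: ∑_{n=0}^{q−1} 1/Df_c^n(c) > 0. -/
open MeasureTheory

/-- sums over d-th roots -/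
lemma root_sum (d : ℕ) (hd : 2 ≤ d) (ζ : ℂ) (hζ : IsPrimitiveRoot ζ d) (w a : ℂ) (hw : w ≠ 0)
    (hwa : w ^ d ≠ a ^ d) :
    ∑ j ∈ Finset.range d, 1 / ((d * (ζ ^ j * w) ^ (d - 1)) ^ 2 * (ζ ^ j * w - a)) =
      a / (d * w ^ d * (w ^ d - a ^ d)) := by
  have hd0 : (d : ℂ) ≠ 0 := by exact_mod_cast (by omega : d ≠ 0)
  have hζ0 : ζ ≠ 0 := hζ.ne_zero (by omega)
  have hsub : w ^ d - a ^ d ≠ 0 := sub_ne_zero.mpr hwa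
  have key : ∀ m, ¬ d ∣ m → ∑ j ∈ Finset.range d, (ζ ^ j) ^ m = 0 := by
    intro m hm
    have h1 : ζ ^ m ≠ 1 := fun h => hm ((hζ.pow_eq_one_iff_dvd m).1 h)
    have h2 := mul_geom_sum (ζ ^ m) d
    rw [← pow_mul, mul_comm m d, pow_mul, hζ.pow_eq_one, one_pow, sub_self] at h2
    rcases mul_eq_zero.1 h2 with h | h
    · exact absurd (sub_eq_zero.1 h) h1
    · rw [← h]; refine Finset.sum_congr rfl fun j _ => ?_
      rw [← pow_mul, ← pow_mul, mul_comm]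
  have step : ∀ j ∈ Finset.range d, 1 / ((d * (ζ ^ j * w) ^ (d - 1)) ^ 2 * (ζ ^ j * w - a)) =
      (∑ i ∈ Finset.range d, (ζ ^ j) ^ (i + 2) * (w ^ (i + 2) * a ^ (d - 1 - i))) /
        (d ^ 2 * (w ^ d) ^ 2 * (w ^ d - a ^ d)) := by
    intro j _
    set z := ζ ^ j * w with hz
    have hz0 : z ≠ 0 := mul_ne_zero (pow_ne_zero _ hζ0) hw
    have hzd : z ^ d = w ^ d := by
      rw [hz, mul_pow, ← pow_mul, mul_comm j d, pow_mul, hζ.pow_eq_one, one_pow, one_mul]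
    have hza : z - a ≠ 0 := by
      intro h; apply hwa; rw [← hzd, sub_eq_zero.1 h]
    have hg := geom_sum₂_mul z a d
    have e1 : ∑ i ∈ Finset.range d, (ζ ^ j) ^ (i + 2) * (w ^ (i + 2) * a ^ (d - 1 - i)) =
        z ^ 2 * ∑ i ∈ Finset.range d, z ^ i * a ^ (d - 1 - i) := by
      rw [Finset.mul_sum]; refine Finset.sum_congr rfl fun i _ => ?_
      rw [hz]; ring
    have e2 : z ^ d = z ^ (d - 1) * z := by
      rw [← pow_succ]; congr 1; omega
    rw [e1, ← hzd, ← hg]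
    have hg0 : ∑ i ∈ Finset.range d, z ^ i * a ^ (d - 1 - i) ≠ 0 := by
      intro h; rw [h, zero_mul, hzd] at hg; exact hsub hg.symm
    rw [e2]
    field_simp
  rw [Finset.sum_congr rfl step, ← Finset.sum_div, Finset.sum_comm]
  have e3 : ∑ i ∈ Finset.range d, ∑ j ∈ Finset.range d,
      (ζ ^ j) ^ (i + 2) * (w ^ (i + 2) * a ^ (d - 1 - i)) = d * w ^ d * a := by
    rw [Finset.sum_eq_single (d - 2)]
    · have : d - 2 + 2 = d := by omega
      rw [this, show d - 1 - (d - 2) = 1 by omega]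
      have : ∀ j ∈ Finset.range d, (ζ ^ j) ^ d * (w ^ d * a ^ 1) = w ^ d * a := by
        intro j _
        rw [← pow_mul, mul_comm j d, pow_mul, hζ.pow_eq_one, one_pow, one_mul, pow_one]
      rw [Finset.sum_congr rfl this]; simp; ring
    · intro i hi hne
      rw [← Finset.sum_mul, key, zero_mul]
      rintro ⟨k, hk⟩
      have := Finset.mem_range.1 hi
      have : k < 2 := by
        by_contra h
        have : d * 2 ≤ d * k := Nat.mul_le_mul_left _ (by omega)
        omega
      interval_cases k <;> omega
    · intro h; exact absurd (Finset.mem_range.2 (by omega)) h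
  rw [e3]
  have : w ^ d ≠ 0 := pow_ne_zero _ hw
  field_simp

/-- area change of variables for `z ↦ z^d + c` on one branch. -/
lemma branch_cov (d : ℕ) (c : ℂ) (A : Set ℂ) (hA : MeasurableSet A)
    (hinj : Set.InjOn (fun z : ℂ => z ^ d + c) A) (g : ℂ → ENNReal) :
    ∫⁻ u in (fun z : ℂ => z ^ d + c) '' A, g u =
      ∫⁻ w in A, ENNReal.ofReal (‖(d : ℂ) * w ^ (d - 1)‖ ^ 2) * g (w ^ d + c) := by
  have hder : ∀ x ∈ A, HasFDerivWithinAt (fun z : ℂ => z ^ d + c)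
      ((ContinuousLinearMap.toSpanSingleton ℂ ((d : ℂ) * x ^ (d - 1))).restrictScalars ℝ) A x := by
    intro x _
    have := ((hasDerivAt_pow d x).add_const c).hasFDerivAt.restrictScalars ℝ
    exact this.hasFDerivWithinAt
  rw [lintegral_image_eq_lintegral_abs_det_fderiv_mul volume hA hder hinj]
  congr 1; ext w; congr 2
  have : ((ContinuousLinearMap.toSpanSingleton ℂ ((d : ℂ) * w ^ (d - 1))).restrictScalars ℝ).det
     = ‖(d : ℂ) * w ^ (d - 1)‖ ^ 2 := by
    generalize (d : ℂ) * w ^ (d - 1) = b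
    rw [ContinuousLinearMap.det]
    have h : (((ContinuousLinearMap.toSpanSingleton ℂ b).restrictScalars ℝ : ℂ →L[ℝ] ℂ) : ℂ →ₗ[ℝ] ℂ)
       = ((ContinuousLinearMap.toSpanSingleton ℂ b : ℂ →L[ℂ] ℂ) : ℂ →ₗ[ℂ] ℂ).restrictScalars ℝ := rfl
    rw [h, LinearMap.det_restrictScalars, Algebra.norm_complex_apply, Complex.normSq_eq_norm_sq]
    congr 2
    have := LinearMap.det_ring ((ContinuousLinearMap.toSpanSingleton ℂ b : ℂ →L[ℂ] ℂ) : ℂ →ₗ[ℂ] ℂ)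
    simpa using this
  rw [this, abs_of_nonneg (by positivity)]

lemma int_pole (a : ℂ) (R : ℝ) : IntegrableOn (fun z : ℂ => 1 / (z - a)) (Metric.ball 0 R) := by
  have : LocallyIntegrable (fun z : ℂ => 1 / z) := by
    apply locallyIntegrable_of_norm_le_rpow (C := 1) (α := 1) (by simp) (by simp)
    · refine Filter.Eventually.of_forall fun z => ?_
      simp [Real.rpow_neg_one]
    · exact (by fun_prop : Measurable (fun z : ℂ => 1 / z)).aestronglyMeasurable
  have h2 : IntegrableOn (fun z : ℂ => 1 / z) (Metric.ball (-a) R) :=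
    (this.integrableOn_isCompact (isCompact_closedBall (-a) R)).mono_set Metric.ball_subset_closedBall
  have h3 := (measurePreserving_sub_right volume a).integrableOn_comp_preimage
    (measurableEmbedding_subRight a) (f := fun z : ℂ => 1 / z) (s := Metric.ball (-a) R)
  have h4 := h3.2 h2
  have h5 : Metric.ball (0 : ℂ) R = (fun x => x - a) ⁻¹' Metric.ball (-a) R := by
    ext z; simp [dist_eq_norm]
  rw [h5]; exact h4

/-- The transfer operator contracts area. -/
lemma transfer_le (d : ℕ) (hd : 2 ≤ d) (c ζ : ℂ) (hζ : IsPrimitiveRoot ζ d) (φ ψ : ℂ → ℂ)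
    (hφm : Measurable φ) (F : Set ℂ) (hF : F.Finite)
    (hψ : ∀ u, u ∉ F → ∀ w : ℂ, w ^ d + c = u → ψ u =
      ∑ j ∈ Finset.range d, φ (ζ ^ j * w) * (1 / (d * (ζ ^ j * w) ^ (d - 1)) ^ 2))
    (B : Set ℂ) (hB : MeasurableSet B) :
    ∫⁻ u in B, ‖ψ u‖ₑ ≤ ∫⁻ w in (fun z : ℂ => z ^ d + c) ⁻¹' B, ‖φ w‖ₑ := by
  have hd0 : (d : ℂ) ≠ 0 := by exact_mod_cast (by omega : d ≠ 0)
  have hζ0 : ζ ≠ 0 := hζ.ne_zero (by omega)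
  set r : ℂ → ℂ := fun u => (u - c) ^ ((d : ℂ)⁻¹) with hr
  have hrm : Measurable r := by fun_prop
  have hrd : ∀ u, r u ^ d = u - c := fun u => Complex.cpow_nat_inv_pow _ (by omega)
  have hζd : ∀ j, (ζ ^ j) ^ d = 1 := fun j => by
    rw [← pow_mul, mul_comm j d, pow_mul, hζ.pow_eq_one, one_pow]
  set G : ℕ → ℂ → ENNReal := fun j u =>
    ‖φ (ζ ^ j * r u) * (1 / (d * (ζ ^ j * r u) ^ (d - 1)) ^ 2)‖ₑ with hG
  have hGm : ∀ j, Measurable (G j) := by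
    intro j
    have h1 : Measurable fun u => ζ ^ j * r u := hrm.const_mul _
    have h2 : Measurable fun u => φ (ζ ^ j * r u) := hφm.comp h1
    have h3 : Measurable fun u => (1 / (d * (ζ ^ j * r u) ^ (d - 1)) ^ 2 : ℂ) := by fun_prop
    exact (h2.mul h3).enorm
  set A : ℕ → Set ℂ := fun j => {w | w ≠ 0 ∧ w ^ d + c ∈ B ∧ w = ζ ^ j * r (w ^ d + c)} with hA
  have hfm : Measurable fun z : ℂ => z ^ d + c := by fun_prop
  have hAm : ∀ j, MeasurableSet (A j) := by
    intro j
    refine (measurableSet_singleton (0 : ℂ)).compl.inter ((hfm hB).inter ?_)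
    exact measurableSet_eq_fun measurable_id ((hrm.comp hfm).const_mul _)
  have hinj : ∀ j, Set.InjOn (fun z : ℂ => z ^ d + c) (A j) := by
    intro j x hx y hy hxy
    simp only at hxy
    rw [hx.2.2, hy.2.2, hxy]
  have himg : ∀ j, B \ {c} ⊆ (fun z : ℂ => z ^ d + c) '' (A j) := by
    rintro j u ⟨hu, huc⟩
    have e : (ζ ^ j * r u) ^ d + c = u := by rw [mul_pow, hζd, hrd]; ring
    refine ⟨ζ ^ j * r u, ⟨?_, ?_, ?_⟩, e⟩
    · intro h
      rw [h, zero_pow (by omega), zero_add] at e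
      exact huc e.symm
    · rw [e]; exact hu
    · rw [e]
  have hae : ∀ᵐ u ∂(volume.restrict B), ‖ψ u‖ₑ ≤ ∑ j ∈ Finset.range d, G j u := by
    have : ∀ᵐ u : ℂ, u ∉ F := by
      have := hF.measure_zero volume
      exact measure_eq_zero_iff_ae_notMem.1 this
    refine ae_restrict_of_ae ?_
    filter_upwards [this] with u hu
    rw [hψ u hu (r u) (by rw [hrd]; ring)]
    exact enorm_sum_le _ _
  have hBc : (volume.restrict B : Measure ℂ) = volume.restrict (B \ {c}) := by
    refine (Measure.restrict_congr_set ?_).symm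
    exact sdiff_null_ae_eq_self (by simp)
  have hdisj : Set.PairwiseDisjoint (↑(Finset.range d)) A := by
    intro i hi j hj hij
    refine Set.disjoint_left.2 fun w hwi hwj => hij ?_
    have h1 := hwi.2.2
    have h2 := hwj.2.2
    have hr0 : r (w ^ d + c) ≠ 0 := by
      intro h; rw [h, mul_zero] at h1; exact hwi.1 h1
    have h3 : ζ ^ i = ζ ^ j := mul_right_cancel₀ hr0 (h1.symm.trans h2)
    exact hζ.pow_inj (by simpa using hi) (by simpa using hj) h3
  calc ∫⁻ u in B, ‖ψ u‖ₑ ≤ ∫⁻ u in B, ∑ j ∈ Finset.range d, G j u := lintegral_mono_ae hae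
    _ = ∑ j ∈ Finset.range d, ∫⁻ u in B, G j u := lintegral_finsetSum _ fun j _ => hGm j
    _ ≤ ∑ j ∈ Finset.range d, ∫⁻ w in A j, ‖φ w‖ₑ := by
        refine Finset.sum_le_sum fun j _ => ?_
        rw [hBc]
        refine (lintegral_mono_set (himg j)).trans ?_
        rw [branch_cov d c (A j) (hAm j) (hinj j)]
        refine le_of_eq (setLIntegral_congr_fun (hAm j) fun w hw => ?_)
        have hw0 : w ≠ 0 := hw.1
        simp only [hG]
        rw [← hw.2.2]
        have hne : (d : ℂ) * w ^ (d - 1) ≠ 0 := mul_ne_zero hd0 (pow_ne_zero _ hw0)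
        rw [← norm_pow, ofReal_norm, ← enorm_mul]
        congr 1
        field_simp
    _ = ∫⁻ w in ⋃ j ∈ Finset.range d, A j, ‖φ w‖ₑ :=
        (lintegral_biUnion_finset hdisj (fun j _ => hAm j) _).symm
    _ ≤ _ := by
        refine lintegral_mono_set ?_
        intro w hw
        simp only [Set.mem_iUnion] at hw
        obtain ⟨j, _, hj⟩ := hw
        exact hj.2.1

/-- A sum of simple poles with nonzero residue at an isolated one vanishes only finitely often. -/
lemma poles_finite (m : ℕ) (p b : ℕ → ℂ) (hb : b 0 ≠ 0) (hp : ∀ k, 1 ≤ k → k ≤ m → p k ≠ p 0) :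
    {z : ℂ | ∑ k ∈ Finset.range (m + 1), b k * (1 / (z - p k)) = 0}.Finite := by
  classical
  set P : Polynomial ℂ := ∑ k ∈ Finset.range (m + 1), Polynomial.C (b k) *
    ∏ j ∈ (Finset.range (m + 1)).erase k, (Polynomial.X - Polynomial.C (p j)) with hP
  have hP0 : P ≠ 0 := by
    intro h
    have h1 : P.eval (p 0) = 0 := by rw [h]; simp
    rw [hP, Polynomial.eval_finsetSum, Finset.sum_eq_single 0] at h1
    · rw [Polynomial.eval_mul, Polynomial.eval_C, Polynomial.eval_prod] at h1
      rcases mul_eq_zero.1 h1 with h2 | h2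
      · exact hb h2
      · obtain ⟨j, hj, hj2⟩ := Finset.prod_eq_zero_iff.1 h2
        simp only [Finset.mem_erase, Finset.mem_range] at hj
        simp only [Polynomial.eval_sub, Polynomial.eval_X, Polynomial.eval_C] at hj2
        exact hp j (by omega) (by omega) (sub_eq_zero.1 hj2).symm
    · intro k _ hk
      rw [Polynomial.eval_mul, Polynomial.eval_prod, Finset.prod_eq_zero (i := 0)]
      · simp
      · simp [hk.symm]
      · simp
    · simp
  refine ((P.roots.toFinset ∪ (Finset.range (m + 1)).image p).finite_toSet).subset ?_
  intro z hz
  simp only [Set.mem_ofPred_eq] at hz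
  by_cases hzp : z ∈ (Finset.range (m + 1)).image p
  · exact Finset.mem_coe.2 (Finset.mem_union_right _ hzp)
  · refine Finset.mem_coe.2 (Finset.mem_union_left _ ?_)
    have hne : ∀ j ∈ Finset.range (m + 1), z - p j ≠ 0 := by
      intro j hj h
      exact hzp (Finset.mem_image.2 ⟨j, hj, (sub_eq_zero.1 h).symm⟩)
    rw [Multiset.mem_toFinset, Polynomial.mem_roots hP0, Polynomial.IsRoot, hP,
      Polynomial.eval_finsetSum]
    have : ∀ k ∈ Finset.range (m + 1), (Polynomial.C (b k) *
      ∏ j ∈ (Finset.range (m + 1)).erase k, (Polynomial.X - Polynomial.C (p j))).eval z =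
      b k * (1 / (z - p k)) * ∏ j ∈ Finset.range (m + 1), (z - p j) := by
      intro k hk
      rw [← Finset.mul_prod_erase _ _ hk, Polynomial.eval_mul, Polynomial.eval_prod]
      have := hne k hk
      simp only [Polynomial.eval_sub, Polynomial.eval_X, Polynomial.eval_C]
      field_simp
    rw [Finset.sum_congr rfl this, ← Finset.sum_mul, hz, zero_mul]

lemma nonvanish (d : ℕ) (hd : 2 ≤ d) (c : ℂ) (m : ℕ) (p b : ℕ → ℂ) (hp0 : p 0 = c)
    (hp : ∀ k, p (k + 1) = p k ^ d + c) (hm : p m = 0) (hne : ∀ k, k < m → p k ≠ 0)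
    (t : ℝ) (ht0 : 0 < t) (ht1 : t ≤ 1) (hb0 : b 0 = 1)
    (hb : ∀ k, k < m → b (k + 1) = t * b k / (d * p k ^ (d - 1))) :
    ∑ k ∈ Finset.range (m + 1), b k ≠ 0 := by
  intro hsum
  have hd0 : (d : ℂ) ≠ 0 := by exact_mod_cast (by omega : d ≠ 0)
  have htc : (t : ℂ) ≠ 0 := by exact_mod_cast ht0.ne'
  obtain ⟨ζ, hζ⟩ : ∃ ζ : ℂ, IsPrimitiveRoot ζ d :=
    ⟨_, Complex.isPrimitiveRoot_exp d (by omega)⟩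
  set φ : ℂ → ℂ := fun z => ∑ k ∈ Finset.range (m + 1), b k * (1 / (z - p k)) with hφ
  have hφm : Measurable φ := by
    refine Finset.measurable_sum _ fun k _ => ?_
    fun_prop
  have hfin : {z | φ z = 0}.Finite := by
    refine poles_finite m p b (by rw [hb0]; exact one_ne_zero) ?_
    intro k h1 h2 h
    obtain ⟨k, rfl⟩ : ∃ l, k = l + 1 := ⟨k - 1, by omega⟩
    rw [hp, hp0] at h
    exact hne k (by omega) ((pow_eq_zero_iff (n := d) (by omega)).1 (add_eq_right.1 h))
  -- the eigenvalue equation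
  have heig : ∀ u, u ∉ (((Finset.range (m + 2)).image p : Finset ℂ) : Set ℂ) → ∀ w : ℂ,
      w ^ d + c = u → (t : ℂ)⁻¹ * φ u =
      ∑ j ∈ Finset.range d, φ (ζ ^ j * w) * (1 / (d * (ζ ^ j * w) ^ (d - 1)) ^ 2) := by
    intro u hu w hw
    have hup : ∀ k, k < m + 2 → u - p k ≠ 0 := by
      intro k hk h
      exact hu (Finset.mem_coe.2 (Finset.mem_image.2
        ⟨k, Finset.mem_range.2 hk, (sub_eq_zero.1 h).symm⟩))
    have hw0 : w ≠ 0 := by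
      rintro rfl
      apply hup 0 (by omega)
      rw [hp0, ← hw, zero_pow (by omega)]; ring
    have hwp : ∀ k, k < m + 1 → w ^ d ≠ p k ^ d := by
      intro k hk h
      apply hup (k + 1) (by omega)
      rw [hp, ← hw, h, sub_self]
    have hwd : w ^ d = u - p 0 := by rw [hp0, ← hw]; ring
    have e1 : ∑ j ∈ Finset.range d, φ (ζ ^ j * w) * (1 / (d * (ζ ^ j * w) ^ (d - 1)) ^ 2) =
        ∑ k ∈ Finset.range (m + 1), b k * (p k / (d * w ^ d * (w ^ d - p k ^ d))) := by
      simp only [hφ, Finset.sum_mul]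
      rw [Finset.sum_comm]
      refine Finset.sum_congr rfl fun k hk => ?_
      rw [← root_sum d hd ζ hζ w (p k) hw0 (hwp k (Finset.mem_range.1 hk)), Finset.mul_sum]
      refine Finset.sum_congr rfl fun j _ => ?_
      rw [mul_assoc, one_div_mul_one_div, mul_comm (_ - _)]
    have e2 : ∀ k ∈ Finset.range m, b k * (p k / (d * w ^ d * (w ^ d - p k ^ d))) =
        (t : ℂ)⁻¹ * (b (k + 1) * (1 / (u - p (k + 1))) - b (k + 1) * (1 / (u - p 0))) := by
      intro k hk
      have hk := Finset.mem_range.1 hk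
      have h1 := hne k hk
      have h2 : w ^ d - p k ^ d ≠ 0 := sub_ne_zero.2 (hwp k (by omega))
      have h3 : u - p (k + 1) = w ^ d - p k ^ d := by rw [hp, ← hw]; ring
      have h4 : w ^ d ≠ 0 := pow_ne_zero _ hw0
      have h5 : p k ^ d = p k ^ (d - 1) * p k := by
        rw [← pow_succ]; congr 1; omega
      rw [h3, ← hwd, hb k hk]
      have h6 : p k ^ (d - 1) ≠ 0 := pow_ne_zero _ h1
      rw [h5] at h2 ⊢
      generalize p k ^ (d - 1) = s at h2 h6 ⊢
      generalize w ^ d = v at h2 h4 ⊢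
      obtain ⟨e, he⟩ : ∃ e, e = v - s * p k := ⟨_, rfl⟩
      rw [← he] at h2 ⊢
      have hv : v = e + s * p k := by rw [he]; ring
      field_simp
      rw [hv]
      ring
    rw [e1, Finset.sum_range_succ, hm, zero_div, mul_zero, add_zero, Finset.sum_congr rfl e2,
      ← Finset.mul_sum, Finset.sum_sub_distrib, ← Finset.sum_mul]
    congr 1
    simp only [hφ]
    rw [Finset.sum_range_succ'] at hsum ⊢
    rw [eq_neg_of_add_eq_zero_left hsum]
    ring
  set R : ℝ := 3 + ‖c‖ with hR
  have hle := transfer_le d hd c ζ hζ φ (fun u => (t : ℂ)⁻¹ * φ u) hφm _ (Finset.finite_toSet _)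
    heig (Metric.ball 0 R) Metric.isOpen_ball.measurableSet
  have hsub : (fun z : ℂ => z ^ d + c) ⁻¹' (Metric.ball 0 R) ⊆ Metric.ball 0 (2 + ‖c‖) := by
    intro z hz
    simp only [Set.mem_preimage, mem_ball_zero_iff] at hz ⊢
    by_contra! h
    have hc := norm_nonneg c
    have h1 : ‖z‖ ^ 2 ≤ ‖z‖ ^ d := pow_le_pow_right₀ (by linarith) hd
    have h2 : ‖z‖ ^ d ≤ ‖z ^ d + c‖ + ‖c‖ := by
      rw [← norm_pow]
      have := norm_sub_le (z ^ d + c) c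
      simpa using this
    nlinarith
  have hlow : ∫⁻ u in Metric.ball 0 R, ‖φ u‖ₑ ≤ ∫⁻ u in Metric.ball 0 R, ‖(t : ℂ)⁻¹ * φ u‖ₑ := by
    refine lintegral_mono fun u => ?_
    rw [enorm_le_iff_norm_le, norm_mul, norm_inv, Complex.norm_real, Real.norm_of_nonneg ht0.le]
    exact le_mul_of_one_le_left (norm_nonneg _) (one_le_inv₀ ht0 |>.2 ht1)
  have hfin2 : ∫⁻ u in Metric.ball 0 (2 + ‖c‖), ‖φ u‖ₑ ≠ ⊤ := by
    have : IntegrableOn φ (Metric.ball 0 (2 + ‖c‖)) := by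
      refine integrable_finsetSum _ fun k _ => ?_
      exact (int_pole (p k) (2 + ‖c‖)).const_mul (b k)
    exact this.2.ne
  have hBsub : Metric.ball (0 : ℂ) (2 + ‖c‖) ⊆ Metric.ball 0 R :=
    Metric.ball_subset_ball (by linarith)
  have hfinal := (hlow.trans hle).trans (lintegral_mono_set hsub)
  have hsplit := lintegral_inter_add_sdiff (μ := (volume : Measure ℂ)) (fun u => ‖φ u‖ₑ)
    (Metric.ball (0 : ℂ) R) (B := Metric.ball (0 : ℂ) (2 + ‖c‖)) Metric.isOpen_ball.measurableSet
  rw [Set.inter_eq_self_of_subset_right hBsub] at hsplit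
  have hzero : ∫⁻ u in Metric.ball (0 : ℂ) R \ Metric.ball 0 (2 + ‖c‖), ‖φ u‖ₑ = 0 := by
    rw [← hsplit] at hfinal
    by_contra h
    exact absurd hfinal (not_le.2 (ENNReal.lt_add_right hfin2 h))
  rw [lintegral_eq_zero_iff hφm.enorm] at hzero
  have hnull : ∀ᵐ u ∂(volume.restrict (Metric.ball (0 : ℂ) R \ Metric.ball 0 (2 + ‖c‖))), False := by
    have : ∀ᵐ u : ℂ, u ∉ {z | φ z = 0} :=
      measure_eq_zero_iff_ae_notMem.1 (hfin.measure_zero volume)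
    filter_upwards [hzero, ae_restrict_of_ae this] with u h1 h2
    exact h2 (by simpa using h1)
  have hmeas0 : volume (Metric.ball (0 : ℂ) R \ Metric.ball 0 (2 + ‖c‖)) = 0 := by
    simpa [ae_iff] using hnull
  have hopen : IsOpen (Metric.ball (0 : ℂ) R \ Metric.closedBall 0 (2 + ‖c‖)) :=
    Metric.isOpen_ball.sdiff Metric.isClosed_closedBall
  have hpos := hopen.measure_pos volume ⟨((5 / 2 + ‖c‖ : ℝ) : ℂ), by
    have hc := norm_nonneg c
    rw [Set.mem_sdiff, mem_ball_zero_iff, mem_closedBall_zero_iff, Complex.norm_real,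
      Real.norm_of_nonneg (by linarith)]
    constructor <;> linarith⟩
  exact hpos.ne' (measure_mono_null
    (Set.sdiff_subset_sdiff_right Metric.ball_subset_closedBall) hmeas0)

theorem stmt5 (d : ℕ) (hd : 2 ≤ d) (hdev : Even d) (c : ℝ)
    (q : ℕ) (hq : 1 ≤ q)
    (hper : (fun x : ℝ => x ^ d + c)^[q] 0 = 0)
    (hne : ∀ j, 1 ≤ j → j < q → (fun x : ℝ => x ^ d + c)^[j] 0 ≠ 0) :
    0 < ∑ n ∈ Finset.range q,
        1 / ∏ k ∈ Finset.range n,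
            deriv (fun x : ℝ => x ^ d + c) ((fun x : ℝ => x ^ d + c)^[k] c) := by
  obtain ⟨m, rfl⟩ : ∃ m, q = m + 1 := ⟨q - 1, by omega⟩
  set f : ℝ → ℝ := fun x => x ^ d + c with hf
  have hf0 : f 0 = c := by simp only [hf]; rw [zero_pow (by omega), zero_add]
  have hit : ∀ k, f^[k + 1] 0 = f^[k] c := fun k => by rw [Function.iterate_succ_apply, hf0]
  have hder : ∀ x, deriv f x = d * x ^ (d - 1) := by
    intro x; simp [hf]
  set D : ℕ → ℝ := fun n => ∏ k ∈ Finset.range n, deriv f (f^[k] c) with hD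
  have hcont : ContinuousOn (fun t : ℝ => ∑ n ∈ Finset.range (m + 1), t ^ n * (1 / D n))
    (Set.Icc 0 1) := by fun_prop
  by_contra! hcon
  have h0 : ∑ n ∈ Finset.range (m + 1), (0 : ℝ) ^ n * (1 / D n) = 1 := by
    rw [Finset.sum_range_succ']
    simp [hD]
  have hmem : (0 : ℝ) ∈ Set.Icc (∑ n ∈ Finset.range (m + 1), (1 : ℝ) ^ n * (1 / D n))
      (∑ n ∈ Finset.range (m + 1), (0 : ℝ) ^ n * (1 / D n)) := by
    rw [h0]; simpa using hcon
  obtain ⟨t, ⟨ht0, ht1⟩, ht⟩ := intermediate_value_Icc' zero_le_one hcont hmem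
  simp only at ht
  have htpos : 0 < t := by
    rcases ht0.eq_or_lt with h | h
    · rw [← h, h0] at ht; exact absurd ht one_ne_zero
    · exact h
  refine nonvanish d hd (c : ℂ) m (fun k => ((f^[k] c : ℝ) : ℂ))
    (fun k => ((t ^ k * (1 / D k) : ℝ) : ℂ)) (by simp) ?_ ?_ ?_ t htpos ht1 (by simp [hD]) ?_ ?_
  · intro k
    rw [Function.iterate_succ_apply']
    simp [hf]
  · rw [← hit, hper]; simp
  · intro k hk
    rw [← hit]
    exact_mod_cast hne (k + 1) (by omega) (by omega)
  · intro k hk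
    have : D (k + 1) = D k * (d * (f^[k] c) ^ (d - 1)) := by
      simp only [hD]
      rw [Finset.prod_range_succ, hder]
    rw [this, pow_succ]
    push_cast
    simp only [one_div, mul_inv, div_eq_mul_inv]
    ring
  · rw [← Complex.ofReal_sum, ht]; simp
end
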